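/- There is an absolute constant c > 0 such that for every integer t ≥ 2, every t-quasi-planar topological graph on n > 2 vertices has at most n·(log₂ n)^{c·log₂ t} edges. -/

import Mathlib

/-- A topological graph: a simple graph drawn in the plane. Vertices are represented by
distinct points, and each edge `uv` is represented by a curve connecting the point of `u`
to the point of `v` that passes through no point representing a vertex other than its two
endpoints. -/
structure TopologicalGraph (V : Type*) where
  /-- The underlying abstract simple graph. -/
  G : SimpleGraph V
  /-- The point representing each vertex. -/
  pos : V → ℝ × ℝ
  pos_inj : Function.Injective pos
  /-- The curve representing each edge (symmetric in the two endpoints). -/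
  arc : V → V → Set (ℝ × ℝ)
  arc_symm : ∀ u v, arc u v = arc v u
  arc_spec : ∀ u v, G.Adj u v → ∃ f : ℝ → ℝ × ℝ,
    ContinuousOn f (Set.Icc 0 1) ∧ f 0 = pos u ∧ f 1 = pos v ∧
      arc u v = f '' Set.Icc 0 1
  arc_avoid : ∀ u v, G.Adj u v → ∀ w, w ≠ u → w ≠ v → pos w ∉ arc u v

/-- Two edges `uv` and `xy` of a topological graph cross if their curves share a point
that is not a common endpoint of the two edges. -/
def TopologicalGraph.Crosses {V : Type*} (T : TopologicalGraph V) (u v x y : V) : Prop :=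
  ∃ p ∈ T.arc u v ∩ T.arc x y,
    ∀ w, (w = u ∨ w = v) → (w = x ∨ w = y) → p ≠ T.pos w

/-- The crossing relation on edges regarded as unordered pairs. -/
def TopologicalGraph.CrossesE {V : Type*} (T : TopologicalGraph V) (e e' : Sym2 V) : Prop :=
  ∃ u v x y, e = s(u, v) ∧ e' = s(x, y) ∧ T.Crosses u v x y

/-- A topological graph is `t`-quasi-planar if it has no `t` pairwise crossing edges. -/
def TopologicalGraph.QuasiPlanar {V : Type*} (T : TopologicalGraph V) (t : ℕ) : Prop :=
  ¬ ∃ E : Finset (Sym2 V), ↑E ⊆ T.G.edgeSet ∧ E.card = t ∧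
      (E : Set (Sym2 V)).Pairwise T.CrossesE

namespace QP
open Set Complex
open scoped unitInterval

/-! ### Winding -/

theorem exists_log_sq (F : C(I × I, ℂ)) (h : ∀ x, F x ≠ 0) :
    ∃ G : C(I × I, ℂ), ∀ x, Complex.exp (G x) = F x := by
  have h01 : (0:ℝ) ≤ 1 := zero_le_one
  let F' : C(ℝ × ℝ, ℂ) := ⟨fun x => F (projIcc 0 1 h01 x.1, projIcc 0 1 h01 x.2), by fun_prop⟩
  have h0 : F' (0, 0) ≠ 0 := h _
  rcases Complex.isCoveringMapOn_exp.existsUnique_continuousMap_lifts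
    F' (a₀ := ((0:ℝ), (0:ℝ))) (exp_log h0) (fun x => h _) with ⟨f, ⟨-, hf⟩, -⟩
  refine ⟨⟨fun x => f (x.1, x.2), by fun_prop⟩, fun x => ?_⟩
  have := congrFun hf ((x.1 : ℝ), (x.2 : ℝ))
  simpa [F'] using this

theorem exists_log_path {u v : ℂ} (γ : Path u v) (z : ℂ) (h : z ∉ range γ) :
    ∃ g : C(I, ℂ), ∀ t, Complex.exp (g t) = γ t - z := by
  obtain ⟨G, hG⟩ := exists_log_sq ⟨fun x => γ x.1 - z, by fun_prop⟩ (fun x hx => h ⟨x.1, by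
    simpa [sub_eq_zero] using hx⟩)
  exact ⟨⟨fun t => G (t, 0), by fun_prop⟩, fun t => hG (t, 0)⟩

open Classical in
/-- total change of argument of `γ - z` along `γ` -/
noncomputable def Theta {u v : ℂ} (γ : Path u v) (z : ℂ) : ℝ :=
  if h : z ∉ range γ then
    ((exists_log_path γ z h).choose 1 - (exists_log_path γ z h).choose 0).im else 0

theorem exp_eq_const (g g' : C(I, ℂ)) (h : ∀ t, Complex.exp (g t) = Complex.exp (g' t)) :
    g 1 - g 0 = g' 1 - g' 0 := by
  have hc : ∀ t, ∃ n : ℤ, g t - g' t = n * (2 * Real.pi * Complex.I) := by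
    intro t
    obtain ⟨n, hn⟩ := Complex.exp_eq_exp_iff_exists_int.1 (h t)
    exact ⟨n, by rw [hn]; ring⟩
  let f : I → ℝ := fun t => (g t - g' t).im / (2 * Real.pi)
  have hf : Continuous f := by fun_prop
  have hfn : ∀ t, ∃ n : ℤ, f t = n := by
    intro t
    obtain ⟨n, hn⟩ := hc t
    refine ⟨n, ?_⟩
    simp only [f, hn]
    simp
    
  choose n hn using hfn
  have hnc : Continuous n := by
    have : Continuous (fun t => ((n t : ℤ) : ℝ)) := by
      have : (fun t => ((n t : ℤ) : ℝ)) = f := by ext t; exact (hn t).symm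
      rw [this]; exact hf
    exact (Int.isClosedEmbedding_coe_real.isInducing.continuous_iff).2 this
  have e : n 0 = n 1 := PreconnectedSpace.constant inferInstance hnc
  have e2 : f 0 = f 1 := by rw [hn, hn, e]
  obtain ⟨a, ha⟩ := hc 0
  obtain ⟨b, hb⟩ := hc 1
  have : (a:ℝ) = b := by
    have h1 : f 0 = a := by simp only [f, ha]; simp
    have h2 : f 1 = b := by simp only [f, hb]; simp
    rw [← h1, ← h2, e2]
  have : a = b := by exact_mod_cast this
  subst this
  linear_combination hb - ha

theorem Theta_eq {u v : ℂ} (γ : Path u v) (z : ℂ) (g : C(I, ℂ))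
    (hg : ∀ t, Complex.exp (g t) = γ t - z) : Theta γ z = (g 1).im - (g 0).im := by
  have h : z ∉ range γ := by
    rintro ⟨t, ht⟩
    have := hg t
    rw [ht, sub_self] at this
    exact Complex.exp_ne_zero _ this
  rw [Theta, dif_pos h, exp_eq_const _ g, Complex.sub_im]
  intro t
  rw [(exists_log_path γ z h).choose_spec t, hg]

theorem log_im {w c : ℂ} (h : Complex.exp w = c) : ∃ n : ℤ, w.im = arg c + n * (2 * Real.pi) := by
  have hc : c ≠ 0 := h ▸ Complex.exp_ne_zero _
  have : Complex.exp w = Complex.exp (Complex.log c) := by rw [h, exp_log hc]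
  obtain ⟨n, hn⟩ := Complex.exp_eq_exp_iff_exists_int.1 this
  refine ⟨n, ?_⟩
  rw [hn]; simp [Complex.log_im]

theorem Theta_arg {u v : ℂ} (γ : Path u v) (z : ℂ) (h : z ∉ range γ) :
    ∃ n : ℤ, Theta γ z = arg (v - z) - arg (u - z) + n * (2 * Real.pi) := by
  obtain ⟨g, hg⟩ := exists_log_path γ z h
  rw [Theta_eq γ z g hg]
  obtain ⟨a, ha⟩ := log_im (hg 1)
  obtain ⟨b, hb⟩ := log_im (hg 0)
  rw [γ.target] at ha
  rw [γ.source] at hb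
  exact ⟨a - b, by rw [ha, hb]; push_cast; ring⟩

theorem arg_swap {x y : ℂ} (h : x ≠ y) :
    ∃ n : ℤ, arg (x - y) = arg (y - x) + Real.pi + n * (2 * Real.pi) := by
  have h1 : y - x ≠ 0 := sub_ne_zero.2 h.symm
  have : Complex.exp (Complex.log (y - x) + Real.pi * Complex.I) = x - y := by
    rw [Complex.exp_add, exp_log h1, Complex.exp_pi_mul_I]; ring
  obtain ⟨n, hn⟩ := log_im this
  refine ⟨-n, ?_⟩
  simp [Complex.log_im] at hn
  push_cast
  linarith

theorem Theta_square {u v z w : ℂ} (γ : Path u v) (δ : Path z w)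
    (h : Disjoint (range γ) (range δ)) :
    Theta γ w - Theta γ z = Theta δ v - Theta δ u := by
  obtain ⟨G, hG⟩ := exists_log_sq ⟨fun x => γ x.1 - δ x.2, by fun_prop⟩ (fun x hx =>
    Set.disjoint_left.1 h ⟨x.1, rfl⟩ ⟨x.2, (sub_eq_zero.1 hx).symm⟩)
  simp only [ContinuousMap.coe_mk] at hG
  have e1 := Theta_eq γ w ⟨fun t => G (t, 1), by fun_prop⟩ (fun t => by
    have := hG (t, 1); simpa using this)
  have e2 := Theta_eq γ z ⟨fun t => G (t, 0), by fun_prop⟩ (fun t => by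
    have := hG (t, 0); simpa using this)
  have e3 := Theta_eq δ v ⟨fun t => G (1, t) + Real.pi * Complex.I, by fun_prop⟩ (fun t => by
    have := hG (1, t); simp [Complex.exp_add, this])
  have e4 := Theta_eq δ u ⟨fun t => G (0, t) + Real.pi * Complex.I, by fun_prop⟩ (fun t => by
    have := hG (0, t); simp [Complex.exp_add, this])
  rw [e1, e2, e3, e4]
  simp
  ring

/-- Sides lemma: winding form of nonplanarity of `K_{3,3}`. -/
theorem sides {a b q m m' k : ℂ}
    (am : Path a m) (am' : Path a m') (ak : Path a k) (bm : Path b m) (bm' : Path b m')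
    (bk : Path b k) (qm : Path q m) (qm' : Path q m')
    (h1 : Disjoint (range am) (range bm')) (h2 : Disjoint (range am') (range bm))
    (h3 : Disjoint (range am) (range bk)) (h4 : Disjoint (range am') (range bk))
    (h5 : Disjoint (range bm) (range ak)) (h6 : Disjoint (range bm') (range ak))
    (h7 : Disjoint (range am) (range qm')) (h8 : Disjoint (range bm) (range qm'))
    (h9 : Disjoint (range bm') (range qm)) (h10 : Disjoint (range am') (range qm))
    (h11 : Disjoint (range bk) (range qm)) (h12 : Disjoint (range bk) (range qm'))
    (h13 : Disjoint (range ak) (range qm)) (h14 : Disjoint (range ak) (range qm')) :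
    ∃ n : ℤ, (Theta am q - Theta bm q + Theta bm' q - Theta am' q) -
      (Theta am k - Theta bm k + Theta bm' k - Theta am' k) = 2 * Real.pi + n * (4 * Real.pi) := by
  have s1 := Theta_square am bm' h1
  have s2 := Theta_square am' bm h2
  have s3 := Theta_square am bk h3
  have s4 := Theta_square am' bk h4
  have s5 := Theta_square bm ak h5
  have s6 := Theta_square bm' ak h6
  have s7 := Theta_square am qm' h7
  have s8 := Theta_square bm qm' h8
  have s9 := Theta_square bm' qm h9
  have s10 := Theta_square am' qm h10
  have s11 := Theta_square bk qm h11
  have s12 := Theta_square bk qm' h12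
  have s13 := Theta_square ak qm h13
  have s14 := Theta_square ak qm' h14
  have key : (Theta am q - Theta bm q + Theta bm' q - Theta am' q) -
      (Theta am k - Theta bm k + Theta bm' k - Theta am' k) =
      2 * (Theta am m' - Theta am b - Theta am' m + Theta am' b + Theta qm' a - Theta qm' b
        + Theta qm b - Theta qm a) := by linarith
  have L : ∀ {x y z w : ℂ} {γ : Path x y} {δ : Path z w}, Disjoint (range γ) (range δ) →
      z ∉ range γ ∧ w ∉ range γ ∧ x ∉ range δ ∧ y ∉ range δ := by
    intro x y z w γ δ h
    exact ⟨fun h' => Set.disjoint_left.1 h h' ⟨0, δ.source⟩,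
      fun h' => Set.disjoint_left.1 h h' ⟨1, δ.target⟩,
      fun h' => Set.disjoint_left.1 h ⟨0, γ.source⟩ h',
      fun h' => Set.disjoint_left.1 h ⟨1, γ.target⟩ h'⟩
  obtain ⟨n1, e1⟩ := Theta_arg am m' (L h1).2.1
  obtain ⟨n2, e2⟩ := Theta_arg am b (L h1).1
  obtain ⟨n3, e3⟩ := Theta_arg am' m (L h2).2.1
  obtain ⟨n4, e4⟩ := Theta_arg am' b (L h2).1
  obtain ⟨n5, e5⟩ := Theta_arg qm' a (L h7).2.2.1
  obtain ⟨n6, e6⟩ := Theta_arg qm' b (L h8).2.2.1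
  obtain ⟨n7, e7⟩ := Theta_arg qm b (L h9).2.2.1
  obtain ⟨n8, e8⟩ := Theta_arg qm a (L h10).2.2.1
  have N : ∀ {x y z : ℂ} {γ : Path x y}, z ∉ range γ → x ≠ z ∧ y ≠ z := by
    intro x y z γ h
    exact ⟨fun e => h (e ▸ ⟨0, γ.source⟩), fun e => h (e ▸ ⟨1, γ.target⟩)⟩
  obtain ⟨r1, f1⟩ := arg_swap (N (L h1).2.1).2
  obtain ⟨r2, f2⟩ := arg_swap (N (L h1).2.1).1
  obtain ⟨r3, f3⟩ := arg_swap (N (L h2).2.1).1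
  refine ⟨r1 - r2 + r3 + n1 - n2 - n3 + n4 + n5 - n6 + n7 - n8, ?_⟩
  rw [key, e1, e2, e3, e4, e5, e6, e7, e8, f1, f2, f3]
  push_cast
  ring

theorem k33_path (p q : Fin 3 → ℂ) (P : ∀ i j, Path (p i) (q j)) :
    ∃ i i' j j', i ≠ i' ∧ j ≠ j' ∧ ¬ Disjoint (range (P i j)) (range (P i' j')) := by
  by_contra hcon
  push Not at hcon
  have D : ∀ i i' j j', i ≠ i' → j ≠ j' → Disjoint (range (P i j)) (range (P i' j')) :=
    fun i i' j j' h h' => hcon i i' j j' h h'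
  obtain ⟨n, hn⟩ := sides (P 0 0) (P 0 1) (P 0 2) (P 1 0) (P 1 1) (P 1 2) (P 2 0) (P 2 1)
    (D _ _ _ _ (by decide) (by decide)) (D _ _ _ _ (by decide) (by decide))
    (D _ _ _ _ (by decide) (by decide)) (D _ _ _ _ (by decide) (by decide))
    (D _ _ _ _ (by decide) (by decide)) (D _ _ _ _ (by decide) (by decide))
    (D _ _ _ _ (by decide) (by decide)) (D _ _ _ _ (by decide) (by decide))
    (D _ _ _ _ (by decide) (by decide)) (D _ _ _ _ (by decide) (by decide))
    (D _ _ _ _ (by decide) (by decide)) (D _ _ _ _ (by decide) (by decide))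
    (D _ _ _ _ (by decide) (by decide)) (D _ _ _ _ (by decide) (by decide))
  have s1 := Theta_square (P 0 0) (P 2 2) (D _ _ _ _ (by decide) (by decide))
  have s2 := Theta_square (P 0 1) (P 2 2) (D _ _ _ _ (by decide) (by decide))
  have s3 := Theta_square (P 1 0) (P 2 2) (D _ _ _ _ (by decide) (by decide))
  have s4 := Theta_square (P 1 1) (P 2 2) (D _ _ _ _ (by decide) (by decide))
  have : 2 * Real.pi * (1 + 2 * n) = 0 := by linarith
  have h2 : (1 + 2 * n : ℝ) = 0 := by
    rcases mul_eq_zero.1 this with h | h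
    · exact absurd h (by positivity)
    · exact h
  have h3 : 1 + 2 * n = 0 := by exact_mod_cast h2
  omega

theorem k33 (p q : Fin 3 → ℂ) (S : Fin 3 → Fin 3 → Set ℂ)
    (h : ∀ i j, JoinedIn (S i j) (p i) (q j)) :
    ∃ i i' j j', i ≠ i' ∧ j ≠ j' ∧ (S i j ∩ S i' j').Nonempty := by
  obtain ⟨i, i', j, j', h1, h2, h3⟩ := k33_path p q (fun i j => (h i j).somePath)
  refine ⟨i, i', j, j', h1, h2, ?_⟩
  obtain ⟨x, hx, hx'⟩ := Set.not_disjoint_iff.1 h3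
  obtain ⟨t, rfl⟩ := hx
  obtain ⟨t', e⟩ := hx'
  exact ⟨_, (h i j).somePath_mem t, e ▸ (h i' j').somePath_mem t'⟩

end QP

namespace QP
open Set Complex
open scoped unitInterval

/-- A piece of curve. -/
structure Pc where
  f : ℝ → ℂ
  cont : Continuous f
  l : ℝ
  hl : 0 ≤ l

namespace Pc
/-- The point set of a piece. -/
def s (p : Pc) : Set ℂ := p.f '' Icc 0 p.l
/-- The open point set of a piece. -/
def o (p : Pc) : Set ℂ := p.f '' Ioo 0 p.l
/-- Mid point. -/
noncomputable def mid (p : Pc) : ℂ := p.f (p.l / 2)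

theorem o_sub_s (p : Pc) : p.o ⊆ p.s := image_mono Ioo_subset_Icc_self
theorem s_compact (p : Pc) : IsCompact p.s := isCompact_Icc.image p.cont
theorem s_closed (p : Pc) : IsClosed p.s := p.s_compact.isClosed
theorem s_pc (p : Pc) : IsPathConnected p.s :=
  ((convex_Icc 0 p.l).isPathConnected ⟨0, by simp [p.hl]⟩).image p.cont
theorem o_pc (p : Pc) (h : 0 < p.l) : IsPathConnected p.o :=
  ((convex_Ioo 0 p.l).isPathConnected ⟨p.l/2, by constructor <;> linarith⟩).image p.cont
theorem mid_mem (p : Pc) (h : 0 < p.l) : p.mid ∈ p.o :=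
  ⟨p.l/2, by constructor <;> linarith, rfl⟩
theorem f0_mem (p : Pc) : p.f 0 ∈ p.s := ⟨0, by simp [p.hl], rfl⟩
theorem fl_mem (p : Pc) : p.f p.l ∈ p.s := ⟨p.l, by simp [p.hl], rfl⟩
end Pc

/-- A rung between two disjoint rails. -/
structure Rung (A B : Set ℂ) (p : Pc) : Prop where
  pos : 0 < p.l
  left : p.f 0 ∈ A
  right : p.f p.l ∈ B
  avA : Disjoint p.o A
  avB : Disjoint p.o B

theorem Rung.s_sub {A B : Set ℂ} {p : Pc} (h : Rung A B p) : p.s ⊆ A ∪ B ∪ p.o := by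
  rintro _ ⟨t, ⟨h0, h1⟩, rfl⟩
  rcases h0.eq_or_lt with rfl | h0
  · exact Or.inl (Or.inl h.left)
  rcases h1.eq_or_lt with rfl | h1
  · exact Or.inl (Or.inr h.right)
  · exact Or.inr ⟨t, ⟨h0, h1⟩, rfl⟩

theorem Rung.joinA {A B : Set ℂ} {p : Pc} (h : Rung A B p) (hA : IsPathConnected A) {a : ℂ}
    (ha : a ∈ A) : JoinedIn (A ∪ p.o) a p.mid := by
  refine ((hA.joinedIn a ha _ h.left).mono subset_union_left).trans ?_
  have hp := h.pos
  have : IsPathConnected (p.f '' Icc 0 (p.l/2)) :=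
    ((convex_Icc 0 (p.l/2)).isPathConnected ⟨0, by constructor <;> linarith⟩).image p.cont
  refine (this.joinedIn _ ⟨0, by constructor <;> linarith, rfl⟩ _
    ⟨p.l/2, by constructor <;> linarith, rfl⟩).mono ?_
  rintro _ ⟨t, ⟨h0, h1⟩, rfl⟩
  rcases h0.eq_or_lt with rfl | h0
  · exact Or.inl h.left
  · exact Or.inr ⟨t, ⟨h0, by linarith⟩, rfl⟩

theorem Rung.joinB {A B : Set ℂ} {p : Pc} (h : Rung A B p) (hB : IsPathConnected B) {a : ℂ}
    (ha : a ∈ B) : JoinedIn (B ∪ p.o) a p.mid := by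
  refine ((hB.joinedIn a ha _ h.right).mono subset_union_left).trans ?_
  have hp := h.pos
  have : IsPathConnected (p.f '' Icc (p.l/2) p.l) :=
    ((convex_Icc (p.l/2) p.l).isPathConnected ⟨p.l, by constructor <;> linarith⟩).image p.cont
  refine (this.joinedIn _ ⟨p.l, by constructor <;> linarith, rfl⟩ _
    ⟨p.l/2, by constructor <;> linarith, rfl⟩).mono ?_
  rintro _ ⟨t, ⟨h0, h1⟩, rfl⟩
  rcases h1.eq_or_lt with rfl | h1
  · exact Or.inl h.right
  · exact Or.inr ⟨t, ⟨by linarith, h1⟩, rfl⟩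

theorem joined_init {q y : ℂ} (γ : Path q y) (t : I) :
    JoinedIn (γ '' {r | r ≤ t}) q (γ t) := by
  have h : IsPathConnected (γ.extend '' Icc 0 (t:ℝ)) :=
    ((convex_Icc 0 (t:ℝ)).isPathConnected ⟨0, by simp [t.2.1]⟩).image γ.continuous_extend
  have h2 := h.joinedIn q ⟨0, by simp [t.2.1], by simp⟩ (γ t) ⟨t, by simp [t.2.1], by simp⟩
  refine h2.mono ?_
  rintro _ ⟨z, ⟨h0, h1⟩, rfl⟩
  exact ⟨⟨z, h0, h1.trans t.2.2⟩, h1, (Path.extend_apply γ ⟨h0, h1.trans t.2.2⟩).symm⟩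

/-- Truncation: if a path in `S` from `q` to `y` cannot avoid `T`, then it reaches `T` in `S`. -/
theorem joined_hit {S T : Set ℂ} {q y : ℂ} (h : JoinedIn S q y) (h' : ¬ JoinedIn (S \ T) q y) :
    ∃ x ∈ T, JoinedIn S q x := by
  obtain ⟨γ, hγ⟩ := h
  by_contra hc
  push Not at hc
  refine h' ⟨γ, fun t => ⟨hγ t, fun ht => hc _ ht ?_⟩⟩
  refine (joined_init γ t).mono ?_
  rintro _ ⟨r, -, rfl⟩
  exact hγ r

/-- First-hit version: reach the closed set `T` with everything before outside `T`. -/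
theorem joined_first {S T : Set ℂ} {q y : ℂ} (hT : IsClosed T) (h : JoinedIn S q y) (hy : y ∈ T) :
    ∃ x ∈ T, JoinedIn (insert x (S \ T)) q x ∧ x ∈ S := by
  obtain ⟨γ, hγ⟩ := h
  let Z : Set I := γ ⁻¹' T
  have hZ : IsCompact Z := (hT.preimage γ.continuous).isCompact
  obtain ⟨t, ht, hmin⟩ := hZ.exists_isLeast ⟨1, by simpa [Z] using hy⟩
  refine ⟨γ t, ht, (joined_init γ t).mono ?_, hγ t⟩
  rintro _ ⟨r, hr, rfl⟩
  by_cases hin : γ r ∈ T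
  · have : t ≤ r := hmin hin
    have e : t = r := le_antisymm this hr
    rw [← e]; exact Or.inl rfl
  · exact Or.inr ⟨hγ _, hin⟩

section Frame
variable {A B : Set ℂ} {k : Pc} {ι : Type*} (P : ι → Pc)

/-- Reaching `P a` from `q` while avoiding the frame and `P b`. -/
def Rch (A B : Set ℂ) (k : Pc) (P : ι → Pc) (q : ℂ) (b a : ι) : Prop :=
  JoinedIn (A ∪ B ∪ k.s ∪ (P b).s)ᶜ q (P a).mid

/-- local order -/
def Prec (A B : Set ℂ) (k : Pc) (P : ι → Pc) (q : ℂ) (a b : ι) : Prop :=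
  Disjoint (P a).o (P b).o ∧ Rch A B k P q b a ∧ ¬ Rch A B k P q a b

variable {P} (hk : Rung A B k) (hP : ∀ i, Rung A B (P i))
  (hPk : ∀ i, Disjoint (P i).o k.o)
include hk hP hPk

theorem o_sub_K (i : ι) : (P i).o ⊆ (A ∪ B ∪ k.s)ᶜ := by
  intro x hx hx'
  have h1 := Set.disjoint_left.1 (hP i).avA hx
  have h2 := Set.disjoint_left.1 (hP i).avB hx
  have h3 := Set.disjoint_left.1 (hPk i) hx
  rcases hx' with h | h
  · exact h.elim h1 h2
  · rcases hk.s_sub h with h | h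
    · exact h.elim h1 h2
    · exact h3 h

theorem mem_o_of {i : ι} {x : ℂ} (hx : x ∈ (P i).s) (hK : x ∉ A ∪ B ∪ k.s) : x ∈ (P i).o := by
  rcases (hP i).s_sub hx with h | h
  · exact absurd (Or.inl h) hK
  · exact h

theorem o_sub_Kb {a b : ι} (h : Disjoint (P a).o (P b).o) :
    (P a).o ⊆ (A ∪ B ∪ k.s ∪ (P b).s)ᶜ := by
  rintro x hx (h1 | h1)
  · exact o_sub_K hk hP hPk a hx h1
  · exact Set.disjoint_left.1 h hx (mem_o_of hk hP hPk h1 (o_sub_K hk hP hPk a hx))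

/-- Extending a connection along a rung. -/
theorem along {q x : ℂ} {a b : ι} (h : Disjoint (P a).o (P b).o)
    (hq : JoinedIn (A ∪ B ∪ k.s ∪ (P b).s)ᶜ q x) (hx : x ∈ (P a).s) : Rch A B k P q b a := by
  have hx' : x ∈ (P a).o := mem_o_of hk hP hPk hx (fun h' => hq.target_mem (Or.inl h'))
  exact hq.trans ((((P a).o_pc (hP a).pos).joinedIn x hx' _ ((P a).mid_mem (hP a).pos)).mono
    (o_sub_Kb hk hP hPk h))

theorem along' {q x : ℂ} {a b : ι} (h : Disjoint (P a).o (P b).o)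
    (hq : Rch A B k P q b a) (hx : x ∈ (P a).o) : JoinedIn (A ∪ B ∪ k.s ∪ (P b).s)ᶜ q x :=
  hq.trans ((((P a).o_pc (hP a).pos).joinedIn _ ((P a).mid_mem (hP a).pos) x hx).mono
    (o_sub_Kb hk hP hPk h))

theorem prec_irrefl (q : ℂ) (a : ι) : ¬ Prec A B k P q a a := fun h =>
  Set.disjoint_left.1 h.1 ((P a).mid_mem (hP a).pos) ((P a).mid_mem (hP a).pos)

theorem prec_conv {q : ℂ} {a b c : ι} (h1 : Prec A B k P q a b) (h2 : Prec A B k P q b c)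
    {w : Set ℂ} (hw : IsPathConnected w) (hwK : w ⊆ (A ∪ B ∪ k.s)ᶜ)
    (ha : (w ∩ (P a).s).Nonempty) (hc : (w ∩ (P c).s).Nonempty) : (w ∩ (P b).o).Nonempty := by
  by_contra hcon
  obtain ⟨x, hxw, hxa⟩ := ha
  obtain ⟨y, hyw, hyc⟩ := hc
  have hwb : w ⊆ (A ∪ B ∪ k.s ∪ (P b).s)ᶜ := by
    rintro z hz (h | h)
    · exact hwK hz h
    · exact hcon ⟨z, hz, mem_o_of hk hP hPk h (hwK hz)⟩
  have j1 := along' hk hP hPk h1.1 h1.2.1 (mem_o_of hk hP hPk hxa (hwK hxw))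
  have j2 := j1.trans ((hw.joinedIn x hxw y hyw).mono hwb)
  exact h2.2.2 (along hk hP hPk h2.1.symm j2 hyc)

theorem prec_trans {q : ℂ} {a b c : ι} (h1 : Prec A B k P q a b) (h2 : Prec A B k P q b c) :
    Prec A B k P q a c := by
  refine ⟨?_, ?_, ?_⟩
  · by_contra hd
    obtain ⟨x, hxa, hxc⟩ := Set.not_disjoint_iff.1 hd
    have j1 := along' hk hP hPk h1.1 h1.2.1 hxa
    exact h2.2.2 (along hk hP hPk h2.1.symm j1 ((P c).o_sub_s hxc))
  · by_contra hd
    have hd' : ¬ JoinedIn ((A ∪ B ∪ k.s ∪ (P b).s)ᶜ \ (P c).s) q (P a).mid := fun h =>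
      hd (h.mono (by
        rintro x ⟨hx1, hx2⟩ (h | h)
        · exact hx1 (Or.inl h)
        · exact hx2 h))
    obtain ⟨x, hx, hj⟩ := joined_hit h1.2.1 hd'
    exact h2.2.2 (along hk hP hPk h2.1.symm hj hx)
  · intro hd
    have hd' : ¬ JoinedIn ((A ∪ B ∪ k.s ∪ (P a).s)ᶜ \ (P b).s) q (P c).mid := fun h =>
      h2.2.2 (h.mono (by
        rintro x ⟨hx1, hx2⟩ (h | h)
        · exact hx1 (Or.inl h)
        · exact hx2 h))
    obtain ⟨x, hx, hj⟩ := joined_hit hd hd'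
    exact h1.2.2 (along hk hP hPk h1.1.symm hj hx)

theorem rch_or {q : ℂ} {a b : ι} (h : Disjoint (P a).o (P b).o)
    (ha : JoinedIn (A ∪ B ∪ k.s)ᶜ q (P a).mid) : Rch A B k P q b a ∨ Rch A B k P q a b := by
  obtain ⟨x, hx, hj, hxK⟩ := joined_first ((P a).s_closed.union (P b).s_closed) ha
    (Or.inl ((P a).o_sub_s ((P a).mid_mem (hP a).pos)))
  rcases hx with hx | hx
  · left
    have hxo := mem_o_of hk hP hPk hx hxK
    refine along hk hP hPk h (hj.mono ?_) hx
    rintro y (rfl | ⟨hy, hy'⟩)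
    · exact o_sub_Kb hk hP hPk h hxo
    · rintro (h' | h')
      · exact hy h'
      · exact hy' (Or.inr h')
  · right
    have hxo := mem_o_of hk hP hPk hx hxK
    refine along hk hP hPk h.symm (hj.mono ?_) hx
    rintro y (rfl | ⟨hy, hy'⟩)
    · exact o_sub_Kb hk hP hPk h.symm hxo
    · rintro (h' | h')
      · exact hy h'
      · exact hy' (Or.inl h')

end Frame

end QP

namespace QP
open Set Complex

open Classical in
/-- A representative point of a set. -/
noncomputable def repPt (S : Set ℂ) : ℂ := if h : S.Nonempty then h.some else 0

theorem repPt_mem {S : Set ℂ} (h : S.Nonempty) : repPt S ∈ S := by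
  rw [repPt, dif_pos h]; exact h.some_mem

/-- Linear order key on points. -/
def key (z : ℂ) : ℝ ×ₗ ℝ := toLex (z.re, z.im)

theorem key_inj {z w : ℂ} (h : key z = key w) : z = w := by
  have := toLex_inj.1 h
  simp at this
  exact Complex.ext this.1 this.2

theorem rng_disj {S T : Set ℂ} {x y z w : ℂ} (h : JoinedIn S x y) (h' : JoinedIn T z w)
    (hd : Disjoint S T) : Disjoint (range h.somePath) (range h'.somePath) := by
  refine hd.mono ?_ ?_
  · rintro _ ⟨t, rfl⟩; exact h.somePath_mem t
  · rintro _ ⟨t, rfl⟩; exact h'.somePath_mem t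

theorem frame0 {A B : Set ℂ} {k : Pc} {ι : Type*} {P : ι → Pc} (hA : IsPathConnected A)
    (hB : IsPathConnected B) (hAB : Disjoint A B) (hk : Rung A B k) (hP : ∀ i, Rung A B (P i))
    (hPk : ∀ i, Disjoint (P i).o k.o) :
    ∃ (lt : ι → ι → Prop) (side : ι → Prop), (∀ a, ¬ lt a a) ∧
      (∀ a b c, lt a b → lt b c → lt a c) ∧
      (∀ a b, Disjoint (P a).o (P b).o → (side a ↔ side b) → lt a b ∨ lt b a) ∧
      (∀ w : Set ℂ, IsPathConnected w → w ⊆ (A ∪ B ∪ k.s)ᶜ → ∀ a b c, lt a b → lt b c →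
        (w ∩ (P a).s).Nonempty → (w ∩ (P c).s).Nonempty → (w ∩ (P b).o).Nonempty) := by
  obtain ⟨a0, ha0⟩ := hA.nonempty
  obtain ⟨b0, hb0⟩ := hB.nonempty
  set K := A ∪ B ∪ k.s with hK
  let q : ι → ℂ := fun i => repPt (pathComponentIn Kᶜ (P i).mid)
  have hmidK : ∀ i, (P i).mid ∈ Kᶜ := fun i =>
    o_sub_K hk hP hPk i ((P i).mid_mem (hP i).pos)
  have hqj : ∀ i, JoinedIn Kᶜ (q i) (P i).mid := fun i => by
    have : q i ∈ pathComponentIn Kᶜ (P i).mid := repPt_mem ⟨_, mem_pathComponentIn_self (hmidK i)⟩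
    exact JoinedIn.symm this
  have hqe : ∀ i j, JoinedIn Kᶜ (P i).mid (P j).mid → q i = q j := fun i j h => by
    simp only [q]; rw [pathComponentIn_congr (show (P i).mid ∈ _ from h.symm)]
  let am := fun i => ((hP i).joinA hA ha0).somePath
  let bm := fun i => ((hP i).joinB hB hb0).somePath
  let ak := (hk.joinA hA ha0).somePath
  let bk := (hk.joinB hB hb0).somePath
  let G : ι → ℝ := fun i => Theta (am i) (q i) - Theta (bm i) (q i) - Theta (am i) k.mid
    + Theta (bm i) k.mid
  let lt : ι → ι → Prop := fun i j => key (q i) < key (q j) ∨ (q i = q j ∧ Prec A B k P (q i) i j)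
  have hcross : ∀ a c (w : Set ℂ), IsPathConnected w → w ⊆ Kᶜ → (w ∩ (P a).s).Nonempty →
      (w ∩ (P c).s).Nonempty → q a = q c := by
    rintro a c w hw hwK ⟨x, hxw, hxa⟩ ⟨y, hyw, hyc⟩
    apply hqe
    have hx := mem_o_of hk hP hPk hxa (hwK hxw)
    have hy := mem_o_of hk hP hPk hyc (hwK hyw)
    have j1 := (((P a).o_pc (hP a).pos).joinedIn _ ((P a).mid_mem (hP a).pos) x hx).mono
      (o_sub_K hk hP hPk a)
    have j2 := (((P c).o_pc (hP c).pos).joinedIn y hy _ ((P c).mid_mem (hP c).pos)).mono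
      (o_sub_K hk hP hPk c)
    exact (j1.trans ((hw.joinedIn x hxw y hyw).mono hwK)).trans j2
  refine ⟨lt, fun i => Even ⌊G i / (2 * Real.pi)⌋, ?_, ?_, ?_, ?_⟩
  · rintro a (h | h)
    · exact lt_irrefl _ h
    · exact prec_irrefl hk hP hPk _ _ h.2
  · rintro a b c (h1 | ⟨h1, h1'⟩) (h2 | ⟨h2, h2'⟩)
    · exact Or.inl (h1.trans h2)
    · exact Or.inl (h2 ▸ h1)
    · exact Or.inl (h1 ▸ h2)
    · refine Or.inr ⟨h1.trans h2, prec_trans hk hP hPk h1' (h1.symm ▸ h2')⟩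
  · intro a b hab hs
    rcases lt_trichotomy (key (q a)) (key (q b)) with h | h | h
    · exact Or.inl (Or.inl h)
    · have e : q a = q b := key_inj h
      by_contra hcon
      have h1 : ¬ Prec A B k P (q a) a b := fun h' => hcon (Or.inl (Or.inr ⟨e, h'⟩))
      have h2 : ¬ Prec A B k P (q a) b a := fun h' => hcon (Or.inr (Or.inr ⟨e.symm, e ▸ h'⟩))
      have h3 := rch_or hk hP hPk hab (hqj a)
      have r1 : Rch A B k P (q a) b a := by
        by_contra hr
        exact h2 ⟨hab.symm, h3.resolve_left hr, hr⟩
      have r2 : Rch A B k P (q a) a b := by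
        by_contra hr
        exact h1 ⟨hab, r1, hr⟩
      have dAo := fun i => (hP i).avA
      have dBo := fun i => (hP i).avB
      have D1 : ∀ i j, Disjoint (P i).o (P j).o → Disjoint (A ∪ (P i).o) (B ∪ (P j).o) := by
        intro i j hij
        simp only [Set.disjoint_union_left, Set.disjoint_union_right]
        exact ⟨⟨hAB, dBo i⟩, ⟨(dAo j).symm, hij⟩⟩
      have D2 : ∀ i, Disjoint (A ∪ (P i).o) (B ∪ k.o) := by
        intro i
        simp only [Set.disjoint_union_left, Set.disjoint_union_right]
        exact ⟨⟨hAB, dBo i⟩, ⟨hk.avA.symm, hPk i⟩⟩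
      have D3 : ∀ i, Disjoint (B ∪ (P i).o) (A ∪ k.o) := by
        intro i
        simp only [Set.disjoint_union_left, Set.disjoint_union_right]
        exact ⟨⟨hAB.symm, dAo i⟩, ⟨hk.avB.symm, hPk i⟩⟩
      have D4 : ∀ i (X : Set ℂ), X ⊆ K ∪ (P i).s → Disjoint X (K ∪ (P i).s)ᶜ := fun i X hX =>
        Set.disjoint_left.2 fun x hx hx' => hx' (hX hx)
      have SA : ∀ i, A ∪ (P i).o ⊆ K ∪ (P i).s := fun i =>
        union_subset_union (fun x hx => Or.inl (Or.inl hx)) (P i).o_sub_s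
      have SB : ∀ i, B ∪ (P i).o ⊆ K ∪ (P i).s := fun i =>
        union_subset_union (fun x hx => Or.inl (Or.inr hx)) (P i).o_sub_s
      have SAk : ∀ i, A ∪ k.o ⊆ K ∪ (P i).s := fun i =>
        union_subset (fun x hx => Or.inl (Or.inl (Or.inl hx)))
          (fun x hx => Or.inl (Or.inr (k.o_sub_s hx)))
      have SBk : ∀ i, B ∪ k.o ⊆ K ∪ (P i).s := fun i =>
        union_subset (fun x hx => Or.inl (Or.inl (Or.inr hx)))
          (fun x hx => Or.inl (Or.inr (k.o_sub_s hx)))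
      obtain ⟨n, hn⟩ := sides (am a) (am b) ak (bm a) (bm b) bk
        (JoinedIn.somePath r1) (JoinedIn.somePath r2)
        (rng_disj _ _ (D1 a b hab)) (rng_disj _ _ (D1 b a hab.symm))
        (rng_disj _ _ (D2 a)) (rng_disj _ _ (D2 b))
        (rng_disj _ _ (D3 a)) (rng_disj _ _ (D3 b))
        (rng_disj _ _ (D4 a _ (SA a))) (rng_disj _ _ (D4 a _ (SB a)))
        (rng_disj _ _ (D4 b _ (SB b))) (rng_disj _ _ (D4 b _ (SA b)))
        (rng_disj _ _ (D4 b _ (SBk b))) (rng_disj _ _ (D4 a _ (SBk a)))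
        (rng_disj _ _ (D4 b _ (SAk b))) (rng_disj _ _ (D4 a _ (SAk a)))
      have hG : G a = G b + 2 * Real.pi + n * (4 * Real.pi) := by
        simp only [G]; rw [← e]; linarith
      have hfl : ⌊G a / (2 * Real.pi)⌋ = ⌊G b / (2 * Real.pi)⌋ + (1 + 2 * n) := by
        rw [← Int.floor_add_intCast]
        congr 1
        rw [hG]
        have := Real.pi_ne_zero
        field_simp
        push_cast
        ring
      beta_reduce at hs
      rw [hfl, Int.even_add] at hs
      have : ¬ Even (1 + 2 * n) := by
        rw [Int.not_even_iff_odd]; exact ⟨n, by ring⟩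
      tauto
    · exact Or.inr (Or.inl h)
  · intro w hw hwK a b c h1 h2 ha hc
    have e := hcross a c w hw hwK ha hc
    rcases h1 with h1 | ⟨h1, h1'⟩
    · exfalso
      rcases h2 with h2 | ⟨h2, -⟩
      · exact lt_irrefl _ ((h1.trans h2).trans_eq (by rw [e]))
      · rw [h2, ← e] at h1; exact lt_irrefl _ h1
    · rcases h2 with h2 | ⟨h2, h2'⟩
      · rw [← h1, ← e] at h2; exact absurd h2 (lt_irrefl _)
      · exact prec_conv hk hP hPk h1' (h1.symm ▸ h2') hw hwK ha hc

theorem frame {A B : Set ℂ} {k : Pc} {ι : Type*} {P : ι → Pc} (I : Set ι) (hA : IsPathConnected A)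
    (hB : IsPathConnected B) (hAB : Disjoint A B) (hk : Rung A B k)
    (hP : ∀ i ∈ I, Rung A B (P i))
    (hPk : ∀ i ∈ I, Disjoint (P i).o k.o) :
    ∃ (lt : ι → ι → Prop) (side : ι → Prop), (∀ a, ¬ lt a a) ∧
      (∀ a b c, lt a b → lt b c → lt a c) ∧
      (∀ a ∈ I, ∀ b ∈ I, Disjoint (P a).o (P b).o → (side a ↔ side b) → lt a b ∨ lt b a) ∧
      (∀ w : Set ℂ, IsPathConnected w → w ⊆ (A ∪ B ∪ k.s)ᶜ → ∀ a b c, lt a b → lt b c →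
        (w ∩ (P a).s).Nonempty → (w ∩ (P c).s).Nonempty → (w ∩ (P b).o).Nonempty) := by
  obtain ⟨lt, side, h1, h2, h3, h4⟩ := frame0 (ι := I) (P := fun i => P i) hA hB hAB hk
    (fun i => hP i i.2) (fun i => hPk i i.2)
  refine ⟨fun a b => ∃ (ha : a ∈ I) (hb : b ∈ I), lt ⟨a, ha⟩ ⟨b, hb⟩,
    fun a => ∃ ha : a ∈ I, side ⟨a, ha⟩, ?_, ?_, ?_, ?_⟩
  · rintro a ⟨ha, _, h⟩
    exact h1 _ h
  · rintro a b c ⟨ha, hb, h⟩ ⟨_, hc, h'⟩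
    exact ⟨ha, hc, h2 _ _ _ h h'⟩
  · intro a ha b hb hab hs
    have := h3 ⟨a, ha⟩ ⟨b, hb⟩ hab ⟨fun h => (hs.1 ⟨ha, h⟩).2, fun h => (hs.2 ⟨hb, h⟩).2⟩
    exact this.imp (fun h => ⟨ha, hb, h⟩) (fun h => ⟨hb, ha, h⟩)
  · rintro w hw hwK a b c ⟨ha, hb, h⟩ ⟨_, hc, h'⟩ haw hcw
    exact h4 w hw hwK _ _ _ h h' haw hcw

end QP

namespace QP

set_option linter.all false
open Finset

section Comb
variable {V : Type*} [Fintype V]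

/-- No biclique with both sides of size at least `s`. -/
def NoBic (R : V → V → Prop) (s : ℕ) : Prop :=
  ∀ X Y : Finset V, (∀ x ∈ X, ∀ y ∈ Y, R x y) → X.card < s ∨ Y.card < s

theorem NoBic.pos {R : V → V → Prop} {s : ℕ} (h : NoBic R s) : 0 < s := by
  rcases h ∅ ∅ (by simp) with h | h <;> simpa using h

open Classical in
theorem exists_pos (lt : V → V → Prop) (hirr : ∀ a, ¬ lt a a)
    (htr : ∀ a b c, lt a b → lt b c → lt a c) : ∀ (N : ℕ) (S : Finset V), S.card = N →
    ∃ pos : V → ℕ, Set.InjOn pos S ∧ (∀ a ∈ S, pos a < N) ∧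
      (∀ a ∈ S, ∀ b ∈ S, lt a b → pos a < pos b) := by
  intro N
  induction N with
  | zero =>
    intro S hS
    rw [Finset.card_eq_zero] at hS
    subst hS
    exact ⟨fun _ => 0, by simp⟩
  | succ N ih =>
    intro S hS
    have hne : S.Nonempty := Finset.card_pos.1 (by omega)
    haveI : IsTrans V (fun a b => lt b a) := ⟨fun a b c h h' => htr _ _ _ h' h⟩
    haveI : Std.Irrefl (fun a b : V => lt b a) := ⟨hirr⟩
    have wf := Finite.wellFounded_of_trans_of_irrefl (fun a b : V => lt b a)
    obtain ⟨m, hm, hmax⟩ := wf.has_min (S : Set V) hne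
    obtain ⟨pos, h1, h2, h3⟩ := ih (S.erase m) (by rw [Finset.card_erase_of_mem hm, hS]; rfl)
    refine ⟨fun x => if x = m then N else pos x, ?_, ?_, ?_⟩
    · intro a ha b hb hab
      by_cases e1 : a = m <;> by_cases e2 : b = m
      · rw [e1, e2]
      · have := h2 b (Finset.mem_erase.2 ⟨e2, hb⟩)
        simp [e1, e2] at hab; omega
      · have := h2 a (Finset.mem_erase.2 ⟨e1, ha⟩)
        simp [e1, e2] at hab; omega
      · simp only [e1, e2, if_false] at hab
        exact h1 (Finset.mem_coe.2 (Finset.mem_erase.2 ⟨e1, ha⟩))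
          (Finset.mem_coe.2 (Finset.mem_erase.2 ⟨e2, hb⟩)) hab
    · intro a ha
      by_cases e1 : a = m
      · simp [e1]
      · have := h2 a (Finset.mem_erase.2 ⟨e1, ha⟩)
        simp [e1]; omega
    · intro a ha b hb hab
      by_cases e1 : a = m
      · exact absurd (e1 ▸ hab) (hmax b hb)
      · by_cases e2 : b = m
        · have := h2 a (Finset.mem_erase.2 ⟨e1, ha⟩)
          simp [e1, e2]; omega
        · simp only [e1, e2, if_false]
          exact h3 a (Finset.mem_erase.2 ⟨e1, ha⟩) b (Finset.mem_erase.2 ⟨e2, hb⟩) hab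

open Classical in
/-- The poset lemma: a strict order without large incomparability bicliques has few
incomparable pairs. -/
theorem poset_lemma {R : V → V → Prop} {s L k : ℕ} (hR : NoBic R s) (hsL : s ≤ 2 ^ L) (hk : 3 ≤ k)
    (lt : V → V → Prop) (hirr : ∀ a, ¬ lt a a)
    (htr : ∀ a b c, lt a b → lt b c → lt a c) (S : Finset V)
    (hinc : ∀ a ∈ S, ∀ b ∈ S, ¬ lt a b → ¬ lt b a → R a b) :
    k * ((S ×ˢ S).filter fun p => ¬ lt p.1 p.2 ∧ ¬ lt p.2 p.1).card ≤
      2 * S.card ^ 2 + 2 * k * S.card * ((L + 5) * (k * s)) := by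
  set N := S.card with hN
  obtain ⟨pos, hinj, hlt, hmono⟩ := exists_pos lt hirr htr N S rfl
  have hs := hR.pos
  set b := k * s with hb
  have hb0 : 0 < b := by positivity
  let B : ℕ → Finset V := fun i => S.filter fun x => pos x / b = i
  have himg : S.image pos = range N := by
    apply Finset.eq_of_subset_of_card_le
    · intro x hx
      obtain ⟨a, ha, rfl⟩ := Finset.mem_image.1 hx
      exact Finset.mem_range.2 (hlt a ha)
    · rw [Finset.card_image_of_injOn hinj, Finset.card_range]
  have hBcard : ∀ i, (i + 1) * b ≤ N → (B i).card = b := by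
    intro i hi
    have e : (B i).image pos = Finset.Ico (i * b) ((i + 1) * b) := by
      ext y
      simp only [B, Finset.mem_image, Finset.mem_filter, Finset.mem_Ico]
      constructor
      · rintro ⟨x, ⟨hx, rfl⟩, rfl⟩
        exact ⟨Nat.div_mul_le_self _ _, Nat.lt_mul_of_div_lt (Nat.lt_succ_self _) hb0⟩
      · rintro ⟨h1, h2⟩
        have : y ∈ S.image pos := by rw [himg]; exact Finset.mem_range.2 (by omega)
        obtain ⟨x, hx, rfl⟩ := Finset.mem_image.1 this
        exact ⟨x, ⟨hx, Nat.div_eq_of_lt_le h1 h2⟩, rfl⟩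
    have := congrArg Finset.card e
    rw [Finset.card_image_of_injOn (hinj.mono (Finset.coe_subset.2 (Finset.filter_subset _ _))), Nat.card_Ico] at this
    rw [this]
    have : (i+1)*b = i*b + b := by ring
    omega
  -- up sets
  let U : Finset V → ℕ → Finset V := fun X i => (B i).filter fun y => ∃ x ∈ X, lt x y
  -- propagation
  have prop1 : ∀ (X : Finset V) (i j : ℕ) (Y : Finset V), X ⊆ S → i < j → s ≤ (U X i).card →
      (∀ y ∈ Y, y ∈ S ∧ j ≤ pos y / b ∧ ∀ x ∈ X, ¬ lt x y) → Y.card < s := by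
    intro X i j Y hX hij hc hY
    have hbic : ∀ x ∈ U X i, ∀ y ∈ Y, R x y := by
      intro x hx y hy
      obtain ⟨hx1, x0, hx0, hx0x⟩ := Finset.mem_filter.1 hx
      obtain ⟨hxS, hxi⟩ := Finset.mem_filter.1 hx1
      obtain ⟨hyS, hyj, hyX⟩ := hY y hy
      refine hinc x hxS y hyS (fun h => hyX x0 hx0 (htr _ _ _ hx0x h)) (fun h => ?_)
      have h1 := hmono y hyS x hxS h
      have h2 : pos y / b ≤ pos x / b := Nat.div_le_div_right h1.le
      omega
    rcases hR (U X i) Y hbic with h | h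
    · omega
    · exact h
  have expand : ∀ (j : ℕ) (X : Finset V) (i : ℕ), X ⊆ S → X.card ≤ 2 ^ j → (i + j + 1) * b ≤ N →
      s ≤ (U X i).card → ∃ x ∈ X, s ≤ (U {x} (i + j)).card := by
    intro j
    induction j with
    | zero =>
      intro X i hX hXc _ hU
      have : X.card ≤ 1 := by simpa using hXc
      have hXne : X.Nonempty := by
        by_contra hne
        rw [Finset.not_nonempty_iff_eq_empty] at hne
        subst hne
        simp [U] at hU
        omega
      obtain ⟨x, rfl⟩ := Finset.card_eq_one.1 (le_antisymm this hXne.card_pos)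
      exact ⟨x, by simp, hU⟩
    | succ j ih =>
      intro X i hX hXc hN' hU
      have hfull : (i + 1 + 1) * b ≤ N := le_trans (Nat.mul_le_mul_right _ (by omega)) hN'
      have hBc := hBcard (i+1) hfull
      have hmiss : ((B (i+1)).filter fun y => ¬ ∃ x ∈ X, lt x y).card < s := by
        refine prop1 X i (i+1) _ hX (Nat.lt_succ_self _) hU ?_
        intro y hy
        obtain ⟨h1, h2⟩ := Finset.mem_filter.1 hy
        obtain ⟨h3, h4⟩ := Finset.mem_filter.1 h1
        push Not at h2
        exact ⟨h3, h4.ge, h2⟩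
      have hsum := Finset.card_filter_add_card_filter_not (s := B (i+1)) (fun y => ∃ x ∈ X, lt x y)
      have hbig : 2 * s ≤ (U X (i+1)).card := by
        have : 3 * s ≤ b := Nat.mul_le_mul_right _ hk
        simp only [U]
        omega
      obtain ⟨X1, hX1, hX1c⟩ := Finset.exists_subset_card_eq (s := X) (n := X.card / 2) (by omega)
      have hX2c : (X \ X1).card ≤ 2 ^ j := by
        rw [Finset.card_sdiff_of_subset hX1, hX1c]
        rw [pow_succ] at hXc; omega
      have hX1c' : X1.card ≤ 2 ^ j := by
        rw [pow_succ] at hXc; omega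
      have hcov : U X (i+1) ⊆ U X1 (i+1) ∪ U (X \ X1) (i+1) := by
        intro y hy
        obtain ⟨h1, x0, h2, h3⟩ := Finset.mem_filter.1 hy
        by_cases hx : x0 ∈ X1
        · exact Finset.mem_union_left _ (Finset.mem_filter.2 ⟨h1, x0, hx, h3⟩)
        · exact Finset.mem_union_right _ (Finset.mem_filter.2
            ⟨h1, x0, Finset.mem_sdiff.2 ⟨h2, hx⟩, h3⟩)
      have hc := (Finset.card_le_card hcov).trans (Finset.card_union_le _ _)
      have hN'' : (i + 1 + j + 1) * b ≤ N := by
        refine le_trans (Nat.mul_le_mul_right _ (by omega)) hN'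
      have hor : s ≤ (U X1 (i+1)).card ∨ s ≤ (U (X \ X1) (i+1)).card := by omega
      rcases hor with h | h
      · obtain ⟨x, hx, hx'⟩ := ih X1 (i+1) (hX1.trans hX) hX1c' hN'' h
        exact ⟨x, hX1 hx, by rwa [show i + 1 + j = i + (j + 1) by ring] at hx'⟩
      · obtain ⟨x, hx, hx'⟩ := ih (X \ X1) (i+1) (Finset.sdiff_subset.trans hX) hX2c hN'' h
        exact ⟨x, (Finset.mem_sdiff.1 hx).1, by rwa [show i + 1 + j = i + (j + 1) by ring] at hx'⟩
  -- bad elements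
  let bad : Finset V := S.filter fun x => (pos x / b + L + 2) * b ≤ N ∧
    (U {x} (pos x / b + 1 + L)).card < s
  have hbadblk : ∀ i, (bad.filter fun x => pos x / b = i).card ≤ s := by
    intro i
    by_contra hcon
    push Not at hcon
    obtain ⟨X, hXsub, hXc⟩ := Finset.exists_subset_card_eq hcon.le
    have hXB : ∀ x ∈ X, x ∈ S ∧ pos x / b = i ∧ (i + L + 2) * b ≤ N ∧
        (U {x} (i + 1 + L)).card < s := by
      intro x hx
      obtain ⟨h1, h2⟩ := Finset.mem_filter.1 (hXsub hx)
      obtain ⟨h3, h4, h5⟩ := Finset.mem_filter.1 h1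
      rw [h2] at h4 h5
      exact ⟨h3, h2, h4, h5⟩
    have hXS : X ⊆ S := fun x hx => (hXB x hx).1
    obtain ⟨x0, hx0⟩ : X.Nonempty := Finset.card_pos.1 (by omega)
    have hN1 := (hXB x0 hx0).2.2.1
    have hU : s ≤ (U X (i+1)).card := by
      have hBc := hBcard (i+1) (le_trans (Nat.mul_le_mul_right _ (by omega)) hN1)
      have hsum := Finset.card_filter_add_card_filter_not (s := B (i+1)) (fun y => ∃ x ∈ X, lt x y)
      have hmiss : ((B (i+1)).filter fun y => ¬ ∃ x ∈ X, lt x y).card < s := by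
        have hbic : ∀ x ∈ X, ∀ y ∈ ((B (i+1)).filter fun y => ¬ ∃ x ∈ X, lt x y), R x y := by
          intro x hx y hy
          obtain ⟨h1, h2⟩ := Finset.mem_filter.1 hy
          obtain ⟨h3, h4⟩ := Finset.mem_filter.1 h1
          push Not at h2
          refine hinc x (hXS hx) y h3 (h2 x hx) (fun h => ?_)
          have h5 := hmono y h3 x (hXS hx) h
          have h6 : pos y / b ≤ pos x / b := Nat.div_le_div_right h5.le
          have := (hXB x hx).2.1
          omega
        rcases hR X _ hbic with h | h
        · omega
        · exact h
      have : 3 * s ≤ b := Nat.mul_le_mul_right _ hk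
      simp only [U]
      omega
    obtain ⟨x, hx, hx'⟩ := expand L X (i+1) hXS (by omega)
      (le_trans (Nat.mul_le_mul_right _ (by omega)) hN1) hU
    have := (hXB x hx).2.2.2
    omega
  have hbad : k * bad.card ≤ N := by
    have h1 : bad.card = ∑ i ∈ range (N / b), (bad.filter fun x => pos x / b = i).card := by
      apply Finset.card_eq_sum_card_fiberwise
      intro x hx
      obtain ⟨h3, h4, h5⟩ := Finset.mem_filter.1 hx
      simp only [Finset.coe_range, Set.mem_Iio]
      have : (pos x / b + 1) * b ≤ N := le_trans (Nat.mul_le_mul_right _ (by omega)) h4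
      have := (Nat.le_div_iff_mul_le hb0).2 this
      omega
    have h2 : bad.card ≤ (N / b) * s := by
      rw [h1]
      calc _ ≤ ∑ i ∈ range (N / b), s := Finset.sum_le_sum fun i _ => hbadblk i
        _ = _ := by simp
    calc k * bad.card ≤ k * ((N / b) * s) := Nat.mul_le_mul_left _ h2
      _ = (N / b) * b := by rw [hb]; ring
      _ ≤ N := Nat.div_mul_le_self _ _
  -- counting
  let I : V → Finset V := fun x => S.filter fun y => pos x ≤ pos y ∧ ¬ lt x y
  have hIgood : ∀ x ∈ S, x ∉ bad → (I x).card ≤ (L + 4) * b := by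
    intro x hx hxb
    have hnear : ∀ m : ℕ, (S.filter fun y => pos x ≤ pos y ∧ pos y < (pos x / b + m) * b).card
        ≤ m * b := by
      intro m
      have : (S.filter fun y => pos x ≤ pos y ∧ pos y < (pos x / b + m) * b).image pos ⊆
          Finset.Ico ((pos x / b) * b) ((pos x / b + m) * b) := by
        intro z hz
        obtain ⟨y, hy, rfl⟩ := Finset.mem_image.1 hz
        obtain ⟨h1, h2, h3⟩ := Finset.mem_filter.1 hy
        exact Finset.mem_Ico.2 ⟨(Nat.div_mul_le_self _ _).trans h2, h3⟩
      have h := Finset.card_le_card this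
      rw [Finset.card_image_of_injOn (hinj.mono (Finset.coe_subset.2 (Finset.filter_subset _ _))), Nat.card_Ico] at h
      have : (pos x / b + m) * b = pos x / b * b + m * b := by ring
      omega
    by_cases hend : (pos x / b + L + 2) * b ≤ N
    · have hgood : s ≤ (U {x} (pos x / b + 1 + L)).card := by
        by_contra hc
        exact hxb (Finset.mem_filter.2 ⟨hx, hend, by omega⟩)
      have hfar : ((I x).filter fun y => pos x / b + 2 + L ≤ pos y / b).card < s := by
        refine prop1 {x} _ (pos x / b + 2 + L) _ (by simpa using hx) (by omega) hgood ?_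
        intro y hy
        obtain ⟨h1, h2⟩ := Finset.mem_filter.1 hy
        obtain ⟨h3, h4, h5⟩ := Finset.mem_filter.1 h1
        exact ⟨h3, h2, by simpa using h5⟩
      have hsum := Finset.card_filter_add_card_filter_not (s := I x)
        (fun y => pos x / b + 2 + L ≤ pos y / b)
      have hle : ((I x).filter fun y => ¬ pos x / b + 2 + L ≤ pos y / b).card ≤ (2 + L) * b := by
        refine (Finset.card_le_card ?_).trans (hnear (2 + L))
        intro y hy
        obtain ⟨h1, h2⟩ := Finset.mem_filter.1 hy
        obtain ⟨h3, h4, h5⟩ := Finset.mem_filter.1 h1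
        refine Finset.mem_filter.2 ⟨h3, h4, ?_⟩
        push Not at h2
        have := Nat.lt_mul_of_div_lt h2 hb0
        rwa [show pos x / b + 2 + L = pos x / b + (2 + L) by ring] at this
      have hsb : s ≤ b := Nat.le_mul_of_pos_left _ (by omega)
      have : (L + 4) * b = (2 + L) * b + 2 * b := by ring
      omega
    · refine (Finset.card_le_card ?_).trans ((hnear (L + 2)).trans
        (Nat.mul_le_mul_right _ (by omega)))
      intro y hy
      obtain ⟨h3, h4, h5⟩ := Finset.mem_filter.1 hy
      have := hlt y h3
      refine Finset.mem_filter.2 ⟨h3, h4, ?_⟩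
      rw [show pos x / b + (L + 2) = pos x / b + L + 2 by ring]
      omega
  have hIsum : k * ∑ x ∈ S, (I x).card ≤ N ^ 2 + k * N * ((L + 4) * b) := by
    have h1 : ∑ x ∈ S, (I x).card ≤ ∑ x ∈ S, ((if x ∈ bad then N else 0) + (L + 4) * b) := by
      refine Finset.sum_le_sum fun x hx => ?_
      by_cases hxb : x ∈ bad
      · have : (I x).card ≤ N := Finset.card_le_card (Finset.filter_subset _ _)
        simp [hxb]; omega
      · simp [hxb]; exact hIgood x hx hxb
    have h2 : ∑ x ∈ S, ((if x ∈ bad then N else 0) + (L + 4) * b) =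
        bad.card * N + N * ((L + 4) * b) := by
      rw [Finset.sum_add_distrib, Finset.sum_ite_mem,
        Finset.inter_eq_right.2 (show bad ⊆ S from Finset.filter_subset _ _), Finset.sum_const,
        Finset.sum_const, smul_eq_mul, smul_eq_mul]
    calc k * ∑ x ∈ S, (I x).card ≤ k * (bad.card * N + N * ((L + 4) * b)) :=
          Nat.mul_le_mul_left _ (h1.trans_eq h2)
      _ = (k * bad.card) * N + k * N * ((L + 4) * b) := by ring
      _ ≤ N * N + k * N * ((L + 4) * b) := by gcongr
      _ = _ := by ring
  have hpairs : ((S ×ˢ S).filter fun p => ¬ lt p.1 p.2 ∧ ¬ lt p.2 p.1).card ≤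
      2 * ∑ x ∈ S, (I x).card := by
    have h1 : ((S ×ˢ S).filter fun p => ¬ lt p.1 p.2 ∧ ¬ lt p.2 p.1) ⊆
        (S.sigma I).image (fun q => (q.1, q.2)) ∪ (S.sigma I).image (fun q => (q.2, q.1)) := by
      rintro ⟨x, y⟩ hp
      obtain ⟨h1, h2, h3⟩ := Finset.mem_filter.1 hp
      obtain ⟨hx, hy⟩ := Finset.mem_product.1 h1
      simp only at h2 h3 hx hy
      rcases le_total (pos x) (pos y) with h | h
      · refine Finset.mem_union_left _ (Finset.mem_image.2 ⟨⟨x, y⟩, ?_, rfl⟩)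
        exact Finset.mem_sigma.2 ⟨hx, Finset.mem_filter.2 ⟨hy, h, h2⟩⟩
      · refine Finset.mem_union_right _ (Finset.mem_image.2 ⟨⟨y, x⟩, ?_, rfl⟩)
        exact Finset.mem_sigma.2 ⟨hy, Finset.mem_filter.2 ⟨hx, h, h3⟩⟩
    have h2 := (Finset.card_le_card h1).trans (Finset.card_union_le _ _)
    have h3 : ((S.sigma I).image (fun q => (q.1, q.2))).card ≤ (S.sigma I).card :=
      Finset.card_image_le
    have h4 : ((S.sigma I).image (fun q => (q.2, q.1))).card ≤ (S.sigma I).card :=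
      Finset.card_image_le
    rw [Finset.card_sigma] at h3 h4
    omega
  calc _ ≤ k * (2 * ∑ x ∈ S, (I x).card) := Nat.mul_le_mul_left _ hpairs
    _ = 2 * (k * ∑ x ∈ S, (I x).card) := by ring
    _ ≤ 2 * (N ^ 2 + k * N * ((L + 4) * b)) := Nat.mul_le_mul_left _ hIsum
    _ = 2 * N ^ 2 + 2 * k * N * ((L + 4) * b) := by ring
    _ ≤ _ := by gcongr; omega

end Comb
end QP

namespace QP

set_option linter.all false
open Finset

section Comb
variable {V : Type*} [Fintype V]

open Classical in
theorem triple_lemma (H : Finset V) (E : V → V → Prop) (M : V → V → V → Prop)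
    (hM : ∀ a ∈ H, ∀ b ∈ H, ∀ c ∈ H, ¬ E a b → ¬ E b c → ¬ E a c →
      M a b c ∨ M a c b ∨ M b a c ∨ M b c a ∨ M c a b ∨ M c b a) :
    H.card ^ 3 ≤ 3 * H.card * ((H ×ˢ H).filter fun p => E p.1 p.2).card +
      6 * ((H ×ˢ H ×ˢ H).filter fun p => M p.1 p.2.1 p.2.2).card := by
  let T : (V → V → V → ℕ) → ℕ := fun f => ∑ a ∈ H, ∑ b ∈ H, ∑ c ∈ H, f a b c
  let e : V → V → ℕ := fun a b => if E a b then 1 else 0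
  let m : V → V → V → ℕ := fun a b c => if M a b c then 1 else 0
  have T1 : ∀ f, T (fun a b c => f a c b) = T f := fun f =>
    Finset.sum_congr rfl fun a _ => Finset.sum_comm
  have T2 : ∀ f, T (fun a b c => f b a c) = T f := fun f => Finset.sum_comm
  have he : ∑ a ∈ H, ∑ b ∈ H, e a b = ((H ×ˢ H).filter fun p => E p.1 p.2).card := by
    rw [Finset.card_filter, Finset.sum_product]
  have hm : T m = ((H ×ˢ H ×ˢ H).filter fun p => M p.1 p.2.1 p.2.2).card := by
    rw [Finset.card_filter, Finset.sum_product]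
    refine Finset.sum_congr rfl fun a _ => ?_
    rw [Finset.sum_product]
  have hTe : T (fun a b c => e a b) = H.card * ∑ a ∈ H, ∑ b ∈ H, e a b := by
    simp only [T, Finset.sum_const, smul_eq_mul, Finset.mul_sum]
  have hTadd : ∀ f g, T (fun a b c => f a b c + g a b c) = T f + T g := by
    intro f g; simp only [T, Finset.sum_add_distrib]
  have h1 : T (fun _ _ _ => 1) = H.card ^ 3 := by
    simp only [T, Finset.sum_const, smul_eq_mul]; ring
  have hle : T (fun _ _ _ => 1) ≤ T (fun a b c => e a b + (e a c + (e b c + (m a b c + (m a c b +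
      (m b a c + (m b c a + (m c a b + m c b a)))))))) := by
    refine Finset.sum_le_sum fun a ha => Finset.sum_le_sum fun b hb => Finset.sum_le_sum
      fun c hc => ?_
    beta_reduce
    by_cases h1 : E a b
    · have : e a b = 1 := if_pos h1
      omega
    by_cases h2 : E b c
    · have : e b c = 1 := if_pos h2
      omega
    by_cases h3 : E a c
    · have : e a c = 1 := if_pos h3
      omega
    rcases hM a ha b hb c hc h1 h2 h3 with h | h | h | h | h | h
    · have : m a b c = 1 := if_pos h
      omega
    · have : m a c b = 1 := if_pos h
      omega
    · have : m b a c = 1 := if_pos h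
      omega
    · have : m b c a = 1 := if_pos h
      omega
    · have : m c a b = 1 := if_pos h
      omega
    · have : m c b a = 1 := if_pos h
      omega
  simp only [hTadd] at hle
  have q1 : T (fun a b c => e a c) = T (fun a b c => e a b) := T1 (fun a b c => e a b)
  have q2 : T (fun a b c => e b c) = T (fun a b c => e a c) := T2 (fun a b c => e a c)
  have r1 : T (fun a b c => m a c b) = T m := T1 m
  have r2 : T (fun a b c => m b a c) = T m := T2 m
  have r3 : T (fun a b c => m b c a) = T (fun a b c => m a c b) := T2 (fun a b c => m a c b)
  have r4 : T (fun a b c => m c a b) = T (fun a b c => m b a c) := T1 (fun a b c => m b a c)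
  have r5 : T (fun a b c => m c b a) = T (fun a b c => m b c a) := T1 (fun a b c => m b c a)
  rw [h1, q2, q1, r5, r4, r3, r2, r1, hTe, he] at hle
  have r6 : T (fun a b c => m a b c) = T m := rfl
  rw [r6, hm] at hle
  nlinarith [hle]

theorem cube_sum {ι : Type*} (J : Finset ι) (f : ι → ℕ) :
    (∑ j ∈ J, f j) ^ 3 ≤ J.card ^ 2 * ∑ j ∈ J, f j ^ 3 := by
  rcases J.eq_empty_or_nonempty with rfl | hJ
  · simp
  have h := pow_sum_div_card_le_sum_pow (s := J) (f := fun j => (f j : ℝ)) (n := 2)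
    (fun i _ => Nat.cast_nonneg _)
  have hc : (0:ℝ) < (J.card : ℝ) ^ 2 := by
    have : 0 < J.card := hJ.card_pos
    positivity
  rw [div_le_iff₀ hc] at h
  have h' : ((∑ j ∈ J, f j : ℕ) : ℝ) ^ 3 ≤ (J.card : ℝ) ^ 2 * ((∑ j ∈ J, f j ^ 3 : ℕ) : ℝ) := by
    push_cast
    simpa [mul_comm] using h
  exact_mod_cast h'

open Classical in
theorem triple_sum (J : Finset V) (H : V → Finset V) (E : V → V → Prop)
    (M : V → V → V → V → Prop) (e m : ℕ)
    (he : ∀ j ∈ J, ((H j ×ˢ H j).filter fun p => E p.1 p.2).card ≤ e)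
    (hm : ∑ j ∈ J, ((H j ×ˢ H j ×ˢ H j).filter fun p => M j p.1 p.2.1 p.2.2).card ≤ m)
    (hM : ∀ j ∈ J, ∀ a ∈ H j, ∀ b ∈ H j, ∀ c ∈ H j, ¬ E a b → ¬ E b c → ¬ E a c →
      M j a b c ∨ M j a c b ∨ M j b a c ∨ M j b c a ∨ M j c a b ∨ M j c b a) :
    (∑ j ∈ J, (H j).card) ^ 3 ≤
      3 * (Fintype.card V) ^ 4 * e + 6 * (Fintype.card V) ^ 2 * m := by
  set n := Fintype.card V
  have hJ : J.card ≤ n := Finset.card_le_univ J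
  have hH : ∀ j, (H j).card ≤ n := fun j => Finset.card_le_univ _
  have h1 : ∑ j ∈ J, (H j).card ^ 3 ≤ 3 * n ^ 2 * e + 6 * m := by
    calc ∑ j ∈ J, (H j).card ^ 3 ≤ ∑ j ∈ J, (3 * n * e + 6 *
          ((H j ×ˢ H j ×ˢ H j).filter fun p => M j p.1 p.2.1 p.2.2).card) := by
          refine Finset.sum_le_sum fun j hj => (triple_lemma (H j) E (M j) (hM j hj)).trans ?_
          have := he j hj
          have := hH j
          gcongr
      _ = J.card * (3 * n * e) + 6 *
          ∑ j ∈ J, ((H j ×ˢ H j ×ˢ H j).filter fun p => M j p.1 p.2.1 p.2.2).card := by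
          rw [Finset.sum_add_distrib, Finset.sum_const, smul_eq_mul, Finset.mul_sum]
      _ ≤ n * (3 * n * e) + 6 * m := by gcongr
      _ = _ := by ring
  calc _ ≤ J.card ^ 2 * ∑ j ∈ J, (H j).card ^ 3 := cube_sum _ _
    _ ≤ n ^ 2 * (3 * n ^ 2 * e + 6 * m) := by gcongr
    _ = _ := by ring

open Classical in
/-- Convex triples lemma. -/
theorem convex_lemma0 {R : V → V → Prop} {s : ℕ} (hR : NoBic R s)
    (lt : V → V → Prop) (S J : Finset V) (H : V → Finset V) (hHS : ∀ j ∈ J, H j ⊆ S)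
    (htr : ∀ a b c, lt a b → lt b c → lt a c) (hirr : ∀ a, ¬ lt a a)
    (hconv : ∀ j ∈ J, ∀ a ∈ H j, ∀ c ∈ H j, ∀ b ∈ S, lt a b → lt b c → R b j) :
    (∑ j ∈ J, (H j).card) ^ 3 ≤ 3 * (Fintype.card V) ^ 4 *
      ((S ×ˢ S).filter fun p => ¬ lt p.1 p.2 ∧ ¬ lt p.2 p.1).card +
      6 * (Fintype.card V) ^ 5 * s := by
  set n := Fintype.card V with hn
  have hcard : ∀ X : Finset V, X.card ≤ n := fun X => Finset.card_le_univ X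
  have := triple_sum J H (fun a b => ¬ lt a b ∧ ¬ lt b a) (fun j a b c => lt a b ∧ lt b c)
    ((S ×ˢ S).filter fun p => ¬ lt p.1 p.2 ∧ ¬ lt p.2 p.1).card (n ^ 3 * s) ?_ ?_ ?_
  · refine this.trans_eq ?_
    ring
  · intro j hj
    refine Finset.card_le_card (fun x hx => ?_)
    simp only [Finset.mem_filter, Finset.mem_product] at hx ⊢
    exact ⟨⟨hHS j hj hx.1.1, hHS j hj hx.1.2⟩, hx.2⟩
  · have h1 : ∑ j ∈ J, ((H j ×ˢ H j ×ˢ H j).filter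
        fun p => lt p.1 p.2.1 ∧ lt p.2.1 p.2.2).card ≤
        ∑ j ∈ J, ∑ a : V, ∑ c : V, if a ∈ H j ∧ c ∈ H j then
          (S.filter fun b => lt a b ∧ lt b c).card else 0 := by
      refine Finset.sum_le_sum fun j hj => ?_
      have : ((H j ×ˢ H j ×ˢ H j).filter fun p => lt p.1 p.2.1 ∧ lt p.2.1 p.2.2).card =
          ∑ a ∈ H j, ∑ b ∈ H j, ∑ c ∈ H j, if lt a b ∧ lt b c then 1 else 0 := by
        rw [Finset.card_filter, Finset.sum_product]
        refine Finset.sum_congr rfl fun a _ => ?_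
        rw [Finset.sum_product]
      rw [this]
      calc _ = ∑ a ∈ H j, ∑ c ∈ H j, ∑ b ∈ H j, (if lt a b ∧ lt b c then 1 else 0) :=
            Finset.sum_congr rfl fun a _ => Finset.sum_comm
        _ ≤ ∑ a ∈ H j, ∑ c ∈ H j, (S.filter fun b => lt a b ∧ lt b c).card := by
            refine Finset.sum_le_sum fun a _ => Finset.sum_le_sum fun c _ => ?_
            rw [Finset.card_filter]
            exact Finset.sum_le_sum_of_subset (hHS j hj)
        _ = ∑ a ∈ H j, ∑ c : V, if c ∈ H j then
              (S.filter fun b => lt a b ∧ lt b c).card else 0 := by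
            refine Finset.sum_congr rfl fun a _ => ?_
            rw [Finset.sum_ite_mem, Finset.univ_inter]
        _ = ∑ a : V, if a ∈ H j then ∑ c : V, (if c ∈ H j then
              (S.filter fun b => lt a b ∧ lt b c).card else 0) else 0 := by
            rw [Finset.sum_ite_mem, Finset.univ_inter]
        _ ≤ _ := by
            refine Finset.sum_le_sum fun a _ => ?_
            by_cases h : a ∈ H j
            · simp [h]
            · simp [h]
    refine (le_of_eq ?_).trans (h1.trans ?_)
    · refine Finset.sum_congr rfl fun j _ => ?_
      congr!
    rw [Finset.sum_comm]
    have h2 : ∀ a c : V, ∑ j ∈ J, (if a ∈ H j ∧ c ∈ H j then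
          (S.filter fun b => lt a b ∧ lt b c).card else 0) ≤ n * s := by
      intro a c
      rw [← Finset.sum_filter, Finset.sum_const, smul_eq_mul]
      rcases hR (S.filter fun b => lt a b ∧ lt b c) (J.filter fun j => a ∈ H j ∧ c ∈ H j)
        (by
          intro b hb j hj
          obtain ⟨h1, h2, h3⟩ := Finset.mem_filter.1 hb
          obtain ⟨h4, h5, h6⟩ := Finset.mem_filter.1 hj
          exact hconv j h4 a h5 c h6 b h1 h2 h3) with h | h
      · exact Nat.mul_le_mul (hcard _) h.le
      · rw [mul_comm n s]
        exact Nat.mul_le_mul h.le (hcard _)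
    calc _ = ∑ a : V, ∑ c : V, ∑ j ∈ J, (if a ∈ H j ∧ c ∈ H j then
          (S.filter fun b => lt a b ∧ lt b c).card else 0) :=
          Finset.sum_congr rfl fun a _ => Finset.sum_comm
      _ ≤ ∑ a : V, ∑ c : V, n * s :=
          Finset.sum_le_sum fun a _ => Finset.sum_le_sum fun c _ => h2 a c
      _ = n ^ 3 * s := by simp [← hn]; ring
  · intro j hj a ha b hb c hc h1 h2 h3
    have h1' : lt a b ∨ lt b a := by tauto
    have h2' : lt b c ∨ lt c b := by tauto
    have h3' : lt a c ∨ lt c a := by tauto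
    have t1 := htr a b c
    have t2 := htr a c b
    tauto

open Classical in
/-- Convex triples lemma, normalized form. -/
theorem convex_lemma {R : V → V → Prop} {s L : ℕ} (hR : NoBic R s) {δ : ℝ} (hδ : 0 < δ)
    (hδ1 : δ ≤ 1) (hsL : s ≤ 2 ^ L)
    (hs : 3600 * (L + 5) * (s : ℝ) ≤ δ ^ 6 * Fintype.card V)
    (lt : V → V → Prop) (S J : Finset V) (H : V → Finset V) (hHS : ∀ j ∈ J, H j ⊆ S)
    (htr : ∀ a b c, lt a b → lt b c → lt a c) (hirr : ∀ a, ¬ lt a a)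
    (hinc : ∀ a ∈ S, ∀ b ∈ S, ¬ lt a b → ¬ lt b a → R a b)
    (hconv : ∀ j ∈ J, ∀ a ∈ H j, ∀ c ∈ H j, ∀ b ∈ S, lt a b → lt b c → R b j) :
    ((∑ j ∈ J, (H j).card : ℕ) : ℝ) ≤ δ * (Fintype.card V : ℝ) ^ 2 := by
  set n := Fintype.card V with hn
  have h0 := convex_lemma0 hR lt S J H hHS htr hirr hconv
  rw [← hn] at h0
  set inc := ((S ×ˢ S).filter fun p => ¬ lt p.1 p.2 ∧ ¬ lt p.2 p.1).card with hinc'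
  have hs0 := hR.pos
  have hs1 : (1:ℝ) ≤ s := by exact_mod_cast hs0
  set δ' := δ ^ 3 / 6 with hδ'
  have hδ'0 : 0 < δ' := by positivity
  have hδ31 : δ ^ 3 ≤ 1 := pow_le_one₀ hδ.le hδ1
  set k := ⌈4 / δ'⌉₊ with hk
  have hk1 : 4 / δ' ≤ k := Nat.le_ceil _
  have hk2 : (k:ℝ) < 4 / δ' + 1 := Nat.ceil_lt_add_one (by positivity)
  have h4d : 24 ≤ 4 / δ' := by
    rw [le_div_iff₀ hδ'0]; rw [hδ']; linarith
  have hk3 : 3 ≤ k := by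
    have : (24:ℝ) ≤ k := h4d.trans hk1
    have : 24 ≤ k := by exact_mod_cast this
    omega
  have hk5 : (k:ℝ) ≤ 5 / δ' := by
    have : 1 ≤ 1 / δ' := by rw [le_div_iff₀ hδ'0]; rw [hδ']; linarith
    have e : 5 / δ' = 4 / δ' + 1 / δ' := by ring
    linarith
  have hp := poset_lemma hR hsL hk3 lt hirr htr S hinc
  have hSn : (S.card : ℝ) ≤ n := by exact_mod_cast Finset.card_le_univ S
  have hn0 : (0:ℝ) ≤ n := Nat.cast_nonneg _
  have hk0 : (0:ℝ) < k := by linarith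
  have hp' : (k:ℝ) * inc ≤ 2 * (n:ℝ) ^ 2 + 2 * k * n * ((L + 5) * (k * s)) := by
    have : ((k * inc : ℕ) : ℝ) ≤ ((2 * S.card ^ 2 + 2 * k * S.card * ((L + 5) * (k * s)) : ℕ) : ℝ) :=
      by exact_mod_cast hp
    push_cast at this
    refine this.trans ?_
    gcongr
  have hincb : (inc : ℝ) ≤ δ' * n ^ 2 := by
    have h1 : (inc : ℝ) ≤ 2 * (n:ℝ) ^ 2 / k + 2 * n * ((L + 5) * (k * s)) := by
      rw [← sub_nonneg]
      have : 0 ≤ (k:ℝ) * (2 * (n:ℝ) ^ 2 / k + 2 * n * ((L + 5) * (k * s)) - inc) := by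
        have e : (k:ℝ) * (2 * (n:ℝ) ^ 2 / k + 2 * n * ((L + 5) * (k * s)) - inc) =
          2 * (n:ℝ) ^ 2 + 2 * k * n * ((L + 5) * (k * s)) - k * inc := by
          field_simp
        rw [e]; linarith
      exact nonneg_of_mul_nonneg_right this hk0
    have h2 : 2 * (n:ℝ) ^ 2 / k ≤ δ' * n ^ 2 / 2 := by
      rw [div_le_iff₀ hk0]
      have : 4 ≤ k * δ' := by rwa [div_le_iff₀ hδ'0] at hk1
      nlinarith [sq_nonneg (n:ℝ)]
    have h3 : 2 * (n:ℝ) * ((L + 5) * (k * s)) ≤ δ' * n ^ 2 / 2 := by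
      have h36 : 100 * (L + 5) * (s:ℝ) ≤ δ' ^ 2 * n := by
        rw [hδ']
        have : (δ ^ 3 / 6) ^ 2 * (n:ℝ) = δ ^ 6 * n / 36 := by ring
        rw [this]; linarith
      have h37 : (k:ℝ) * (100 * (L + 5) * (s:ℝ)) ≤ 5 * δ' * n := by
        calc (k:ℝ) * (100 * (L + 5) * (s:ℝ)) ≤ 5 / δ' * (δ' ^ 2 * n) := by gcongr
          _ = 5 * δ' * n := by field_simp
      nlinarith
    linarith
  have hfin : ((∑ j ∈ J, (H j).card : ℕ) : ℝ) ^ 3 ≤ (δ * (n:ℝ) ^ 2) ^ 3 := by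
    have h1 : ((∑ j ∈ J, (H j).card : ℕ) : ℝ) ^ 3 ≤ 3 * (n:ℝ) ^ 4 * inc + 6 * (n:ℝ) ^ 5 * s := by
      exact_mod_cast h0
    have h2 : 12 * (s:ℝ) ≤ δ ^ 3 * n := by
      have : δ ^ 6 ≤ δ ^ 3 := pow_le_pow_of_le_one hδ.le hδ1 (by norm_num)
      have h4 : δ ^ 6 * n ≤ δ ^ 3 * n := by gcongr
      have h5 : (0:ℝ) ≤ L * s := by positivity
      nlinarith
    calc _ ≤ _ := h1
      _ ≤ 3 * (n:ℝ) ^ 4 * (δ' * n ^ 2) + (n:ℝ) ^ 5 * (δ ^ 3 * n / 2) := by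
          have : 6 * (n:ℝ) ^ 5 * s = (n:ℝ)^5 * (12 * s / 2) := by ring
          rw [this]
          gcongr
      _ = (δ * (n:ℝ) ^ 2) ^ 3 := by rw [hδ']; ring
  exact le_of_pow_le_pow_left₀ (by norm_num) (by positivity) hfin

end Comb
end QP

namespace QP

set_option linter.all false
open Finset Set

namespace Pc
/-- initial part of a piece -/
noncomputable def pre (p : Pc) (t : ℝ) : Pc := ⟨p.f, p.cont, max t 0, le_max_right _ _⟩
/-- subpiece -/
noncomputable def sub (p : Pc) (a b : ℝ) : Pc :=
  ⟨fun u => p.f (a + u), p.cont.comp (continuous_const.add continuous_id), max (b - a) 0,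
    le_max_right _ _⟩
/-- reversed piece -/
def rev (p : Pc) : Pc :=
  ⟨fun u => p.f (p.l - u), p.cont.comp (continuous_const.sub continuous_id), p.l, p.hl⟩

theorem pre_s (p : Pc) {t : ℝ} (h : 0 ≤ t) : (p.pre t).s = p.f '' Set.Icc 0 t := by
  simp [pre, s, h]

theorem pre_s_sub (p : Pc) {t : ℝ} (h : t ≤ p.l) : (p.pre t).s ⊆ p.s :=
  image_mono (Set.Icc_subset_Icc le_rfl (max_le h p.hl))

theorem sub_s (p : Pc) {a b : ℝ} (h : a ≤ b) : (p.sub a b).s = p.f '' Set.Icc a b := by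
  have : (p.sub a b).s = p.f '' ((fun u => a + u) '' Set.Icc 0 (b - a)) := by
    rw [Set.image_image]; simp only [sub, s, max_eq_left (sub_nonneg.2 h)]
  rw [this]; simp

theorem sub_o (p : Pc) {a b : ℝ} (h : a ≤ b) : (p.sub a b).o = p.f '' Set.Ioo a b := by
  have : (p.sub a b).o = p.f '' ((fun u => a + u) '' Set.Ioo 0 (b - a)) := by
    rw [Set.image_image]; simp only [sub, o, max_eq_left (sub_nonneg.2 h)]
  rw [this]; simp

theorem sub_l (p : Pc) {a b : ℝ} (h : a ≤ b) : (p.sub a b).l = b - a := by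
  simp [sub, h]

theorem sub_f0 (p : Pc) (a b : ℝ) : (p.sub a b).f 0 = p.f a := by simp [sub]
theorem sub_fl (p : Pc) {a b : ℝ} (h : a ≤ b) : (p.sub a b).f (p.sub a b).l = p.f b := by
  rw [sub_l p h]; simp [sub]

theorem rev_s (p : Pc) : p.rev.s = p.s := by
  have : p.rev.s = p.f '' ((fun u => p.l - u) '' Set.Icc 0 p.l) := by
    rw [Set.image_image]; rfl
  rw [this]; simp [s]

/-- first visit -/
noncomputable def ft (p : Pc) (C : Set ℂ) : ℝ := sInf {t | t ∈ Set.Icc 0 p.l ∧ p.f t ∈ C}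
/-- last visit -/
noncomputable def lv (p : Pc) (A : Set ℂ) (b : ℝ) : ℝ := sSup {t | t ∈ Set.Icc 0 b ∧ p.f t ∈ A}

theorem ft_spec (p : Pc) {C : Set ℂ} (hC : IsClosed C) (h : (p.s ∩ C).Nonempty) :
    p.ft C ∈ Set.Icc 0 p.l ∧ p.f (p.ft C) ∈ C ∧ ∀ t, 0 ≤ t → t < p.ft C → p.f t ∉ C := by
  have hc : IsCompact {t | t ∈ Set.Icc 0 p.l ∧ p.f t ∈ C} :=
    (isCompact_Icc.inter_right (hC.preimage p.cont))
  obtain ⟨_, ⟨t, ht, rfl⟩, hx⟩ := h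
  have h1 := hc.sInf_mem ⟨t, ht, hx⟩
  refine ⟨h1.1, h1.2, fun u hu hu' hc' => ?_⟩
  have := csInf_le hc.bddBelow (show u ∈ {t | t ∈ Set.Icc 0 p.l ∧ p.f t ∈ C} from
    ⟨⟨hu, hu'.le.trans h1.1.2⟩, hc'⟩)
  exact absurd hu' (not_lt.2 this)

theorem lv_spec (p : Pc) {A : Set ℂ} (hA : IsClosed A) {b : ℝ}
    (h : ∃ t ∈ Set.Icc 0 b, p.f t ∈ A) :
    p.lv A b ∈ Set.Icc 0 b ∧ p.f (p.lv A b) ∈ A ∧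
      ∀ t, p.lv A b < t → t ≤ b → p.f t ∉ A := by
  have hc : IsCompact {t | t ∈ Set.Icc 0 b ∧ p.f t ∈ A} :=
    (isCompact_Icc.inter_right (hA.preimage p.cont))
  obtain ⟨t, ht, hx⟩ := h
  have h1 := hc.sSup_mem ⟨t, ht, hx⟩
  refine ⟨h1.1, h1.2, fun u hu hu' hc' => ?_⟩
  have := le_csSup hc.bddAbove (show u ∈ {t | t ∈ Set.Icc 0 b ∧ p.f t ∈ A} from
    ⟨⟨h1.1.1.trans hu.le, hu'⟩, hc'⟩)
  exact absurd hu (not_lt.2 this)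

/-- the rung of a piece between two walls -/
noncomputable def rung (p : Pc) (A C : Set ℂ) : Pc := p.sub (p.lv A (p.ft C)) (p.ft C)
/-- the rung exists -/
def HasR (p : Pc) (A C : Set ℂ) : Prop := (p.s ∩ C).Nonempty ∧ ∃ t ∈ Set.Icc 0 (p.ft C), p.f t ∈ A

theorem rung_lt (p : Pc) {A C : Set ℂ} (hA : IsClosed A) (hC : IsClosed C) (hAC : Disjoint A C)
    (h : p.HasR A C) : p.lv A (p.ft C) < p.ft C := by
  obtain ⟨h1, h2⟩ := h
  obtain ⟨c1, c2, c3⟩ := p.ft_spec hC h1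
  obtain ⟨a1, a2, a3⟩ := p.lv_spec hA h2
  refine lt_of_le_of_ne a1.2 (fun e => ?_)
  rw [e] at a2
  exact Set.disjoint_left.1 hAC a2 c2

theorem rung_rung (p : Pc) {A C : Set ℂ} (hA : IsClosed A) (hC : IsClosed C) (hAC : Disjoint A C)
    (h : p.HasR A C) : Rung A C (p.rung A C) := by
  have hlt := p.rung_lt hA hC hAC h
  obtain ⟨h1, h2⟩ := h
  obtain ⟨c1, c2, c3⟩ := p.ft_spec hC h1
  obtain ⟨a1, a2, a3⟩ := p.lv_spec hA h2
  refine ⟨?_, ?_, ?_, ?_, ?_⟩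
  · rw [rung, sub_l _ hlt.le]; linarith
  · rw [rung, sub_f0]; exact a2
  · rw [rung, sub_fl _ hlt.le]; exact c2
  · rw [rung, sub_o _ hlt.le, Set.disjoint_left]
    rintro _ ⟨t, ⟨ht1, ht2⟩, rfl⟩
    exact a3 t ht1 ht2.le
  · rw [rung, sub_o _ hlt.le, Set.disjoint_left]
    rintro _ ⟨t, ⟨ht1, ht2⟩, rfl⟩
    exact c3 t (a1.1.trans ht1.le) ht2

theorem rung_s_sub (p : Pc) {A C : Set ℂ} (hA : IsClosed A) (hC : IsClosed C)
    (h : p.HasR A C) : (p.rung A C).s ⊆ p.s := by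
  obtain ⟨h1, h2⟩ := h
  obtain ⟨c1, c2, c3⟩ := p.ft_spec hC h1
  obtain ⟨a1, a2, a3⟩ := p.lv_spec hA h2
  rw [rung, sub_s _ a1.2]
  exact image_mono (Set.Icc_subset_Icc a1.1 c1.2)

end Pc

/-- A rung inside a path connected set. -/
theorem exists_rung {A C Z : Set ℂ} (hA : IsClosed A) (hC : IsClosed C) (hAC : Disjoint A C)
    (hZ : IsPathConnected Z) (h1 : (Z ∩ A).Nonempty) (h2 : (Z ∩ C).Nonempty) :
    ∃ k : Pc, Rung A C k ∧ k.s ⊆ Z := by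
  obtain ⟨a, haZ, haA⟩ := h1
  obtain ⟨c, hcZ, hcC⟩ := h2
  obtain ⟨g, hg⟩ := hZ.joinedIn a haZ c hcZ
  let p : Pc := ⟨g.extend, g.continuous_extend, 1, zero_le_one⟩
  have hps : p.s ⊆ Z := by
    rintro _ ⟨t, ht, rfl⟩
    have : g.extend t = g ⟨t, ht⟩ := g.extend_apply ht
    show g.extend t ∈ Z
    rw [this]; exact hg _
  have hH : p.HasR A C := by
    have h1 : (p.s ∩ C).Nonempty := ⟨c, ⟨1, ⟨zero_le_one, le_rfl⟩, by simp [p]⟩, hcC⟩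
    refine ⟨h1, 0, ⟨le_rfl, (p.ft_spec hC h1).1.1⟩, by simpa [p] using haA⟩
  exact ⟨p.rung A C, p.rung_rung hA hC hAC hH, (p.rung_s_sub hA hC hH).trans hps⟩

section Strings
variable {V : Type*} [Fintype V]

/-- intersection relation -/
def Rel (F : V → Set ℂ) (i j : V) : Prop := (F i ∩ F j).Nonempty

open Classical in
theorem point_lt {F : V → Set ℂ} {s : ℕ} (hR : NoBic (Rel F) s) (x : ℂ) (B : Finset V)
    (h : ∀ b ∈ B, x ∈ F b) : B.card < s := by
  rcases hR B B (fun a ha b hb => ⟨x, h a ha, h b hb⟩) with h | h <;> exact h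

open Classical in
theorem initial_lemma {F : V → Set ℂ} {s : ℕ} (hR : NoBic (Rel F) s) (p : Pc) (B : Finset V)
    (Q : V → Set ℂ) (hQ : ∀ b ∈ B, IsClosed (Q b)) (hQF : ∀ b ∈ B, Q b ⊆ F b) (k : ℕ) (hk : 1 ≤ k)
    (hkB : k ≤ (B.filter fun b => (p.s ∩ Q b).Nonempty).card) :
    ∃ t ∈ Set.Icc 0 p.l, k ≤ (B.filter fun b => ((p.pre t).s ∩ Q b).Nonempty).card ∧
      (B.filter fun b => ((p.pre t).s ∩ Q b).Nonempty).card < k + s := by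
  set U := B.filter fun b => (p.s ∩ Q b).Nonempty with hU
  have hspec : ∀ b ∈ U, p.ft (Q b) ∈ Set.Icc 0 p.l ∧ p.f (p.ft (Q b)) ∈ Q b ∧
      ∀ t, 0 ≤ t → t < p.ft (Q b) → p.f t ∉ Q b := by
    intro b hb
    obtain ⟨h1, h2⟩ := Finset.mem_filter.1 hb
    exact p.ft_spec (hQ b h1) h2
  -- hit set description
  have hhit : ∀ t ∈ Set.Icc 0 p.l, (B.filter fun b => ((p.pre t).s ∩ Q b).Nonempty) =
      U.filter fun b => p.ft (Q b) ≤ t := by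
    intro t ht
    ext b
    simp only [Finset.mem_filter, hU]
    rw [Pc.pre_s p ht.1]
    constructor
    · rintro ⟨hb, _, ⟨u, hu, rfl⟩, hx⟩
      have hbU : (p.s ∩ Q b).Nonempty := ⟨p.f u, ⟨u, ⟨hu.1, hu.2.trans ht.2⟩, rfl⟩, hx⟩
      refine ⟨⟨hb, hbU⟩, ?_⟩
      by_contra hc
      push Not at hc
      exact (hspec b (Finset.mem_filter.2 ⟨hb, hbU⟩)).2.2 u hu.1 (hu.2.trans_lt hc) hx
    · rintro ⟨⟨hb, hbU⟩, hle⟩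
      obtain ⟨h1, h2, h3⟩ := hspec b (Finset.mem_filter.2 ⟨hb, hbU⟩)
      exact ⟨hb, _, ⟨_, ⟨h1.1, hle⟩, rfl⟩, h2⟩
  let g : V → ℝ := fun b => p.ft (Q b)
  let N : ℝ → ℕ := fun t => (U.filter fun b => g b ≤ t).card
  have hUne : U.Nonempty := Finset.card_pos.1 (by omega)
  obtain ⟨m, hm, hmax⟩ := Finset.exists_max_image U g hUne
  let G := U.filter fun b => k ≤ N (g b)
  have hG : G.Nonempty := by
    refine ⟨m, Finset.mem_filter.2 ⟨hm, ?_⟩⟩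
    have : (U.filter fun b => g b ≤ g m) = U := Finset.filter_true_of_mem hmax
    show k ≤ (U.filter fun b => g b ≤ g m).card
    rw [this]; exact hkB
  obtain ⟨c, hc, hcmin⟩ := Finset.exists_min_image G g hG
  obtain ⟨hcU, hck⟩ := Finset.mem_filter.1 hc
  refine ⟨g c, (hspec c hcU).1, ?_, ?_⟩
  · rw [hhit _ (hspec c hcU).1]; exact hck
  · rw [hhit _ (hspec c hcU).1]
    have h1 : (U.filter fun b => g b ≤ g c) ⊆
        (U.filter fun b => g b < g c) ∪ (U.filter fun b => g b = g c) := by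
      intro b hb
      obtain ⟨h1, h2⟩ := Finset.mem_filter.1 hb
      rcases h2.lt_or_eq with h | h
      · exact Finset.mem_union_left _ (Finset.mem_filter.2 ⟨h1, h⟩)
      · exact Finset.mem_union_right _ (Finset.mem_filter.2 ⟨h1, h⟩)
    have h2 : (U.filter fun b => g b = g c).card < s := by
      refine point_lt hR (p.f (g c)) _ ?_
      intro b hb
      obtain ⟨h1, h2⟩ := Finset.mem_filter.1 hb
      rw [← h2]
      exact hQF b (Finset.mem_filter.1 h1).1 (hspec b h1).2.1
    have h3 : (U.filter fun b => g b < g c).card < k := by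
      by_contra hcon
      push Not at hcon
      have hne : (U.filter fun b => g b < g c).Nonempty := Finset.card_pos.1 (by omega)
      obtain ⟨d, hd, hdmax⟩ := Finset.exists_max_image _ g hne
      obtain ⟨hdU, hdc⟩ := Finset.mem_filter.1 hd
      have : d ∈ G := by
        refine Finset.mem_filter.2 ⟨hdU, hcon.trans (Finset.card_le_card fun b hb => ?_)⟩
        exact Finset.mem_filter.2 ⟨(Finset.mem_filter.1 hb).1, hdmax b hb⟩
      exact absurd (hcmin d this) (not_le.2 hdc)
    have h4 := (Finset.card_le_card h1).trans (Finset.card_union_le _ _)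
    show (U.filter fun b => g b ≤ g c).card < k + s
    omega

/-- F1: interaction of rungs with connected sets avoiding the frame. -/
theorem frame_sparse [DecidableEq V] {F : V → Set ℂ} {s L : ℕ} (hR : NoBic (Rel F) s) {δ : ℝ}
    (hδ : 0 < δ) (hδ1 : δ ≤ 1) (hsL : s ≤ 2 ^ L)
    (hs : 3600 * (L + 5) * (s : ℝ) ≤ δ ^ 6 * Fintype.card V)
    {A B : Set ℂ} (hA : IsPathConnected A) (hB : IsPathConnected B) (hAB : Disjoint A B)
    {k : Pc} (hk : Rung A B k) (I J : Finset V) (P : V → Pc) (hP : ∀ i ∈ I, Rung A B (P i))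
    (hPF : ∀ i ∈ I, (P i).s ⊆ F i)
    (hPk : ∀ i ∈ I, Disjoint (P i).o k.o) (w : V → Set ℂ) (hw : ∀ j ∈ J, IsPathConnected (w j))
    (hwF : ∀ j ∈ J, w j ⊆ F j) (hwK : ∀ j ∈ J, w j ⊆ (A ∪ B ∪ k.s)ᶜ)
    (H : V → Finset V) (hH : ∀ j ∈ J, H j ⊆ I)
    (hHw : ∀ j ∈ J, ∀ i ∈ H j, (w j ∩ (P i).s).Nonempty) :
    ((∑ j ∈ J, (H j).card : ℕ) : ℝ) ≤ 2 * δ * (Fintype.card V : ℝ) ^ 2 := by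
  classical
  obtain ⟨lt, side, hirr, htr, hcomp, hconv⟩ :=
    frame (↑I : Set V) hA hB hAB hk (fun i hi => hP i hi) (fun i hi => hPk i hi)
  have key : ∀ (T : V → Prop), (∀ a b, T a → T b → (side a ↔ side b)) →
      ((∑ j ∈ J, ((H j).filter T).card : ℕ) : ℝ) ≤
      δ * (Fintype.card V : ℝ) ^ 2 := by
    intro T hT
    refine convex_lemma hR hδ hδ1 hsL hs lt (I.filter T) J _ ?_ htr hirr ?_ ?_
    · exact fun j hj => Finset.filter_subset_filter _ (hH j hj)
    · intro a ha b hb h1 h2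
      obtain ⟨ha1, ha2⟩ := Finset.mem_filter.1 ha
      obtain ⟨hb1, hb2⟩ := Finset.mem_filter.1 hb
      by_cases hd : Disjoint (P a).o (P b).o
      · rcases hcomp a ha1 b hb1 hd (hT a b ha2 hb2) with h | h
        · exact absurd h h1
        · exact absurd h h2
      · obtain ⟨x, hx1, hx2⟩ := Set.not_disjoint_iff.1 hd
        exact ⟨x, hPF a ha1 ((P a).o_sub_s hx1), hPF b hb1 ((P b).o_sub_s hx2)⟩
    · intro j hj a ha c hc b hb h1 h2
      obtain ⟨ha1, ha2⟩ := Finset.mem_filter.1 ha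
      obtain ⟨hc1, hc2⟩ := Finset.mem_filter.1 hc
      obtain ⟨hb1, hb2⟩ := Finset.mem_filter.1 hb
      obtain ⟨x, hx1, hx2⟩ := hconv (w j) (hw j hj) (hwK j hj) a b c h1 h2 (hHw j hj a ha1)
        (hHw j hj c hc1)
      exact ⟨x, hPF b hb1 ((P b).o_sub_s hx2), hwF j hj hx1⟩
  obtain ⟨T, hT⟩ : ∃ T : V → Prop, ∀ i, T i ↔ ¬ side i := ⟨_, fun _ => Iff.rfl⟩
  have h1 := key side (fun a b ha hb => by tauto)
  have h2 := key T (fun a b ha hb => by rw [hT] at ha hb; tauto)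
  have h3 : ∑ j ∈ J, (H j).card = ∑ j ∈ J, ((H j).filter side).card +
      ∑ j ∈ J, ((H j).filter T).card := by
    rw [← Finset.sum_add_distrib]
    refine Finset.sum_congr rfl fun j _ => ?_
    rw [← Finset.card_filter_add_card_filter_not side]
    congr 2
    exact Finset.filter_congr fun i _ => (hT i).symm
  rw [h3]
  push_cast at h1 h2 ⊢
  linarith

end Strings
end QP

namespace QP

set_option linter.all false
open Finset Set

section Cnt
variable {α β : Type*}
open Classical in
/-- classical filter -/
noncomputable def flt (S : Finset α) (P : α → Prop) : Finset α := S.filter P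
theorem mem_flt {S : Finset α} {P : α → Prop} {a : α} : a ∈ flt S P ↔ a ∈ S ∧ P a := by
  classical exact Finset.mem_filter
theorem flt_subset (S : Finset α) (P : α → Prop) : flt S P ⊆ S := fun _ h => (mem_flt.1 h).1
/-- counting -/
noncomputable def cnt (S : Finset α) (P : α → Prop) : ℕ := (flt S P).card
theorem cnt_le_card (S : Finset α) (P : α → Prop) : cnt S P ≤ S.card :=
  Finset.card_le_card (flt_subset S P)
theorem cnt_mono {S T : Finset α} {P Q : α → Prop} (h : ∀ a ∈ S, P a → a ∈ T ∧ Q a) :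
    cnt S P ≤ cnt T Q :=
  Finset.card_le_card fun a ha => mem_flt.2 (h a (mem_flt.1 ha).1 (mem_flt.1 ha).2)
theorem cnt_or {S : Finset α} {P Q T : α → Prop} (h : ∀ a ∈ S, P a → Q a ∨ T a) :
    cnt S P ≤ cnt S Q + cnt S T := by
  classical
  refine (Finset.card_le_card fun a ha => ?_).trans (Finset.card_union_le (flt S Q) (flt S T))
  obtain ⟨h1, h2⟩ := mem_flt.1 ha
  rcases h a h1 h2 with h | h
  · exact Finset.mem_union_left _ (mem_flt.2 ⟨h1, h⟩)
  · exact Finset.mem_union_right _ (mem_flt.2 ⟨h1, h⟩)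
open Classical in
theorem cnt_eq_sum (S : Finset α) (P : α → Prop) : cnt S P = ∑ a ∈ S, if P a then 1 else 0 := by
  rw [cnt, flt, Finset.card_filter]
theorem cnt_comm (S : Finset α) (T : Finset β) (P : α → β → Prop) :
    ∑ a ∈ S, cnt T (P a) = ∑ b ∈ T, cnt S (fun a => P a b) := by
  classical
  simp only [cnt_eq_sum]
  exact Finset.sum_comm
open Classical in
theorem sum_flt (S : Finset α) (P : α → Prop) (f : α → ℕ) :
    ∑ a ∈ flt S P, f a = ∑ a ∈ S, if P a then f a else 0 := by
  rw [flt, Finset.sum_filter]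
end Cnt

section Half
variable {V : Type*} [Fintype V]

theorem half_lemma {F : V → Set ℂ} {s : ℕ} (hR : NoBic (Rel F) s) (Y B : Finset V) (p : V → Pc)
    (Q : V → Set ℂ) (hQ : ∀ b ∈ B, IsClosed (Q b)) (hQF : ∀ b ∈ B, Q b ⊆ F b) :
    ∃ l' : V → ℝ, (∀ y, l' y ∈ Set.Icc 0 (p y).l) ∧ ∀ θ η : ℝ, 0 ≤ η →
      4 * θ * (Fintype.card V : ℝ) ^ 3 + 2 * s * (Fintype.card V : ℝ) ^ 2 ≤
        η ^ 2 * (Fintype.card V : ℝ) ^ 3 →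
      ((∑ b0 ∈ B, ∑ y ∈ flt Y (fun y => ((p y).s ∩ Q b0).Nonempty ∧
          ¬ (((p y).pre (l' y)).s ∩ Q b0).Nonempty),
          cnt B (fun b => (((p y).pre (l' y)).s ∩ Q b).Nonempty) : ℕ) : ℝ) ≤
          θ * (Fintype.card V : ℝ) ^ 3 →
      ((∑ y ∈ Y, cnt B (fun b => ((p y).s ∩ Q b).Nonempty) : ℕ) : ℝ) ≤
        η * (Fintype.card V : ℝ) ^ 2 := by
  classical
  let d : V → ℕ := fun y => cnt B (fun b => ((p y).s ∩ Q b).Nonempty)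
  have hd : ∀ y, d y = cnt B (fun b => ((p y).s ∩ Q b).Nonempty) := fun _ => rfl
  have hex : ∀ y, ∃ t ∈ Set.Icc 0 (p y).l,
      d y ≤ 2 * cnt B (fun b => (((p y).pre t).s ∩ Q b).Nonempty) ∧
      2 * cnt B (fun b => (((p y).pre t).s ∩ Q b).Nonempty) ≤ d y + 2 * s := by
    intro y
    by_cases h0 : d y = 0
    · refine ⟨(p y).l, ⟨(p y).hl, le_rfl⟩, by omega, ?_⟩
      have : cnt B (fun b => (((p y).pre (p y).l).s ∩ Q b).Nonempty) ≤ d y :=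
        cnt_mono fun b hb h => ⟨hb, h.mono (inter_subset_inter_left _ ((p y).pre_s_sub le_rfl))⟩
      omega
    · obtain ⟨t, ht, h1, h2⟩ := initial_lemma hR (p y) B Q hQ hQF ((d y + 1) / 2) (by omega)
        (by
          have : (B.filter fun b => ((p y).s ∩ Q b).Nonempty).card = d y := by
            rw [hd, cnt, flt]
          rw [this]; omega)
      refine ⟨t, ht, ?_, ?_⟩
      · rw [cnt, flt]; omega
      · rw [cnt, flt]; omega
  choose l' hl' hlo hhi using hex
  refine ⟨l', hl', fun θ η hη hθη hsum => ?_⟩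
  set n := Fintype.card V with hn
  let h : V → ℕ := fun y => cnt B (fun b => (((p y).pre (l' y)).s ∩ Q b).Nonempty)
  have hh : ∀ y, h y = cnt B (fun b => (((p y).pre (l' y)).s ∩ Q b).Nonempty) := fun _ => rfl
  have e1 : ∑ b0 ∈ B, ∑ y ∈ flt Y (fun y => ((p y).s ∩ Q b0).Nonempty ∧
          ¬ (((p y).pre (l' y)).s ∩ Q b0).Nonempty), h y = ∑ y ∈ Y, (d y - h y) * h y := by
    simp only [sum_flt]
    rw [Finset.sum_comm]
    refine Finset.sum_congr rfl fun y _ => ?_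
    refine (sum_flt B (fun b0 => ((p y).s ∩ Q b0).Nonempty ∧
          ¬ (((p y).pre (l' y)).s ∩ Q b0).Nonempty) (fun _ => h y)).symm.trans ?_
    rw [Finset.sum_const, smul_eq_mul]
    congr 1
    have h1 : h y + (flt B fun b0 => ((p y).s ∩ Q b0).Nonempty ∧
          ¬ (((p y).pre (l' y)).s ∩ Q b0).Nonempty).card = d y := by
      rw [hh, hd, cnt, cnt, ← Finset.card_union_of_disjoint]
      · congr 1
        ext b
        simp only [Finset.mem_union, mem_flt]
        constructor
        · rintro (⟨h1, h2⟩ | ⟨h1, h2, h3⟩)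
          · exact ⟨h1, h2.mono (inter_subset_inter_left _ ((p y).pre_s_sub (hl' y).2))⟩
          · exact ⟨h1, h2⟩
        · rintro ⟨h1, h2⟩
          by_cases h3 : (((p y).pre (l' y)).s ∩ Q b).Nonempty
          · exact Or.inl ⟨h1, h3⟩
          · exact Or.inr ⟨h1, h2, h3⟩
      · rw [Finset.disjoint_left]
        intro b hb hb'
        exact (mem_flt.1 hb').2.2 (mem_flt.1 hb).2
    omega
  have e2 : ((∑ y ∈ Y, (d y - h y) * h y : ℕ) : ℝ) ≤ θ * (n:ℝ) ^ 3 := by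
    rw [← e1]; exact hsum
  have hhd : ∀ y, h y ≤ d y := fun y =>
    cnt_mono fun b hb h => ⟨hb, h.mono (inter_subset_inter_left _ ((p y).pre_s_sub (hl' y).2))⟩
  have hdn : ∀ y, (d y : ℝ) ≤ n := fun y => by
    exact_mod_cast (cnt_le_card _ _).trans (Finset.card_le_univ _)
  have e3 : ∀ y, (d y : ℝ) ^ 2 ≤ 4 * (((d y - h y) * h y : ℕ) : ℝ) + 2 * s * n := by
    intro y
    have h1 : (d y : ℝ) ≤ 2 * h y := by exact_mod_cast hlo y
    have h2 : 2 * (h y : ℝ) ≤ d y + 2 * s := by exact_mod_cast hhi y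
    have h3 := hhd y
    have h3' : (h y : ℝ) ≤ d y := by exact_mod_cast h3
    have h4 := hdn y
    push_cast [Nat.cast_sub h3]
    have hs0 : (0:ℝ) ≤ s := Nat.cast_nonneg _
    have hd0 : (0:ℝ) ≤ d y := Nat.cast_nonneg _
    by_cases hc : (d y : ℝ) ≤ 2 * s
    · have : 0 ≤ ((d y : ℝ) - h y) * h y := mul_nonneg (by linarith) (Nat.cast_nonneg _)
      nlinarith
    · push Not at hc
      have : ((d y : ℝ) / 2 - s) * (d y / 2) ≤ ((d y : ℝ) - h y) * h y := by
        apply mul_le_mul <;> linarith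
      nlinarith
  have hYn : (Y.card : ℝ) ≤ n := by exact_mod_cast Finset.card_le_univ Y
  have hn0 : (0:ℝ) ≤ n := Nat.cast_nonneg _
  have e4 : ∑ y ∈ Y, (d y : ℝ) ^ 2 ≤ 4 * (θ * (n:ℝ) ^ 3) + n * (2 * s * n) := by
    calc _ ≤ ∑ y ∈ Y, (4 * (((d y - h y) * h y : ℕ) : ℝ) + 2 * s * n) :=
          Finset.sum_le_sum fun y _ => e3 y
      _ = 4 * ((∑ y ∈ Y, (d y - h y) * h y : ℕ) : ℝ) + Y.card * (2 * s * n) := by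
          rw [Finset.sum_add_distrib, Finset.sum_const, nsmul_eq_mul, ← Finset.mul_sum]
          push_cast; ring
      _ ≤ _ := by gcongr
  have e5 : (∑ y ∈ Y, (d y : ℝ)) ^ 2 ≤ Y.card * ∑ y ∈ Y, (d y : ℝ) ^ 2 := by
    exact sq_sum_le_card_mul_sum_sq
  have e6 : (∑ y ∈ Y, (d y : ℝ)) ^ 2 ≤ (η * (n:ℝ) ^ 2) ^ 2 := by
    calc _ ≤ _ := e5
      _ ≤ n * (4 * (θ * (n:ℝ) ^ 3) + n * (2 * s * n)) :=
          mul_le_mul hYn e4 (Finset.sum_nonneg fun _ _ => sq_nonneg _) hn0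
      _ = n * (4 * θ * (n:ℝ) ^ 3 + 2 * s * (n:ℝ) ^ 2) := by ring
      _ ≤ n * (η ^ 2 * (n:ℝ) ^ 3) := by gcongr
      _ = _ := by ring
  have := abs_le_of_sq_le_sq e6 (by positivity)
  push_cast
  exact (le_abs_self _).trans this

theorem s_le {s L n : ℕ} {ε : ℝ} (hε : 0 < ε) (hε1 : ε ≤ 1) (m : ℕ) (hm : m ≠ 0)
    (hs : 3600 * (L + 5) * (s : ℝ) ≤ ε ^ m * n) : 18000 * (s : ℝ) ≤ ε * n := by
  have h1 : ε ^ m ≤ ε := pow_le_of_le_one hε.le hε1 hm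
  have h2 : ε ^ m * n ≤ ε * n := by gcongr
  have h3 : (0:ℝ) ≤ L * s := by positivity
  nlinarith

/-- S-core. -/
theorem S_core {F : V → Set ℂ} {s L : ℕ} (hR : NoBic (Rel F) s) {ε : ℝ}
    (hε : 0 < ε) (hε1 : ε ≤ 1) (hsL : s ≤ 2 ^ L)
    (hs : 3600 * (L + 5) * (s : ℝ) ≤ ε ^ 6 * Fintype.card V)
    {A C : Set ℂ} (hA : IsPathConnected A) (hC : IsPathConnected C) (hAC : Disjoint A C)
    (B : Finset V) (r : V → Pc) (hr : ∀ b ∈ B, Rung A C (r b)) (hrF : ∀ b ∈ B, (r b).s ⊆ F b)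
    (hsp : ((∑ b ∈ B, cnt B (fun b' => ¬ Disjoint (r b).o (r b').o) : ℕ) : ℝ) ≤
      ε * (Fintype.card V : ℝ) ^ 2)
    (Y : Finset V) (p : V → Pc) (hpF : ∀ y ∈ Y, (p y).s ⊆ F y)
    (hpA : ∀ y ∈ Y, Disjoint (p y).s A) (hpC : ∀ y ∈ Y, Disjoint (p y).s C)
    {η : ℝ} (hη : 0 ≤ η) (hη2 : 14 * ε ≤ η ^ 2) :
    ((∑ y ∈ Y, cnt B (fun b => ((p y).s ∩ (r b).s).Nonempty) : ℕ) : ℝ) ≤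
      η * (Fintype.card V : ℝ) ^ 2 := by
  classical
  obtain ⟨l', hl', hmain⟩ := half_lemma hR Y B p (fun b => (r b).s)
    (fun b _ => (r b).s_closed) hrF
  set n := Fintype.card V with hn
  have hn0 : (0:ℝ) ≤ n := Nat.cast_nonneg _
  have hsn := s_le hε hε1 6 (by norm_num) hs
  have hcn : ∀ X : Finset V, (X.card : ℝ) ≤ n := fun X => by exact_mod_cast Finset.card_le_univ X
  refine hmain (3 * ε) η hη ?_ ?_
  · calc 4 * (3 * ε) * (n:ℝ) ^ 3 + 2 * s * (n:ℝ) ^ 2 = (12 * ε * n + 2 * s) * (n:ℝ) ^ 2 := by ring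
      _ ≤ (14 * ε * n) * (n:ℝ) ^ 2 := by
          gcongr
          have : (0:ℝ) ≤ s := Nat.cast_nonneg _
          linarith
      _ = 14 * ε * (n:ℝ)^3 := by ring
      _ ≤ _ := by gcongr
  · have hb0 : ∀ b0 ∈ B, ((∑ y ∈ flt Y (fun y => ((p y).s ∩ (r b0).s).Nonempty ∧
          ¬ (((p y).pre (l' y)).s ∩ (r b0).s).Nonempty),
          cnt B (fun b => (((p y).pre (l' y)).s ∩ (r b).s).Nonempty) : ℕ) : ℝ) ≤
          2 * ε * (n:ℝ) ^ 2 + n * (cnt B (fun b' => ¬ Disjoint (r b0).o (r b').o) : ℕ) := by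
      intro b0 hb0
      set J := flt Y (fun y => ((p y).s ∩ (r b0).s).Nonempty ∧
          ¬ (((p y).pre (l' y)).s ∩ (r b0).s).Nonempty) with hJ
      let I := flt B (fun b => Disjoint (r b).o (r b0).o)
      have hfs := frame_sparse hR hε hε1 hsL hs hA hC hAC (hr b0 hb0) I J r
        (fun i hi => hr i (mem_flt.1 hi).1) (fun i hi => hrF i (mem_flt.1 hi).1)
        (fun i hi => (mem_flt.1 hi).2) (fun y => ((p y).pre (l' y)).s)
        (fun y _ => Pc.s_pc _)
        (fun y hy => ((p y).pre_s_sub (hl' y).2).trans (hpF y (mem_flt.1 hy).1))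
        (fun y hy => by
          obtain ⟨h1, h2, h3⟩ := mem_flt.1 hy
          rintro x hx ((h | h) | h)
          · exact Set.disjoint_left.1 (hpA y h1) ((p y).pre_s_sub (hl' y).2 hx) h
          · exact Set.disjoint_left.1 (hpC y h1) ((p y).pre_s_sub (hl' y).2 hx) h
          · exact h3 ⟨x, hx, h⟩)
        (fun y => flt I (fun b => (((p y).pre (l' y)).s ∩ (r b).s).Nonempty))
        (fun y _ => flt_subset _ _) (fun y _ i hi => (mem_flt.1 hi).2)
      have h1 : ∑ y ∈ J, cnt B (fun b => (((p y).pre (l' y)).s ∩ (r b).s).Nonempty) ≤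
          ∑ y ∈ J, ((flt I (fun b => (((p y).pre (l' y)).s ∩ (r b).s).Nonempty)).card +
            cnt B (fun b' => ¬ Disjoint (r b0).o (r b').o)) := by
        refine Finset.sum_le_sum fun y _ => ?_
        refine (cnt_or (Q := fun b => b ∈ I ∧ (((p y).pre (l' y)).s ∩ (r b).s).Nonempty)
          (T := fun b' => ¬ Disjoint (r b0).o (r b').o) ?_).trans ?_
        · intro b hb h
          by_cases hd : Disjoint (r b0).o (r b).o
          · exact Or.inl ⟨mem_flt.2 ⟨hb, hd.symm⟩, h⟩
          · exact Or.inr hd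
        · refine Nat.add_le_add_right ?_ _
          exact Finset.card_le_card fun b hb => mem_flt.2 (mem_flt.1 hb).2
      rw [Finset.sum_add_distrib, Finset.sum_const, smul_eq_mul] at h1
      have h2 : ((∑ y ∈ J, cnt B (fun b => (((p y).pre (l' y)).s ∩ (r b).s).Nonempty) : ℕ) : ℝ) ≤
          ((∑ y ∈ J, (flt I (fun b => (((p y).pre (l' y)).s ∩ (r b).s).Nonempty)).card +
           J.card * cnt B (fun b' => ¬ Disjoint (r b0).o (r b').o) : ℕ) : ℝ) := by
        exact_mod_cast h1
      rw [Nat.cast_add, Nat.cast_mul] at h2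
      have h3 : (J.card : ℝ) * (cnt B (fun b' => ¬ Disjoint (r b0).o (r b').o) : ℕ) ≤
        n * (cnt B (fun b' => ¬ Disjoint (r b0).o (r b').o) : ℕ) := by
        exact mul_le_mul_of_nonneg_right (hcn J) (Nat.cast_nonneg _)
      linarith
    have h5 := Finset.sum_le_sum hb0
    rw [Finset.sum_add_distrib, Finset.sum_const, nsmul_eq_mul, ← Finset.mul_sum] at h5
    push_cast at h5 hsp ⊢
    calc _ ≤ _ := h5
      _ ≤ n * (2 * ε * (n:ℝ) ^ 2) + n * (ε * (n:ℝ) ^ 2) := by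
          have := hcn B
          gcongr
      _ = _ := by ring

/-- order statement for triples -/
theorem triple_order (p : Pc) {A1 A2 A3 : Set ℂ} (h1 : IsClosed A1) (h2 : IsClosed A2)
    (h3 : IsClosed A3) (h12 : Disjoint A1 A2) (hp1 : (p.s ∩ A1).Nonempty)
    (hp2 : (p.s ∩ A2).Nonempty) (hp3 : (p.s ∩ A3).Nonempty)
    (h13 : p.ft A1 ≤ p.ft A3) (h23 : p.ft A2 ≤ p.ft A3) :
    (p.HasR A1 A3 ∧ (A2 ∩ (p.rung A1 A3).s).Nonempty) ∨
    (p.HasR A2 A3 ∧ (A1 ∩ (p.rung A2 A3).s).Nonempty) := by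
  have r1 : p.HasR A1 A3 := ⟨hp3, p.ft A1, ⟨(p.ft_spec h1 hp1).1.1, h13⟩, (p.ft_spec h1 hp1).2.1⟩
  have r2 : p.HasR A2 A3 := ⟨hp3, p.ft A2, ⟨(p.ft_spec h2 hp2).1.1, h23⟩, (p.ft_spec h2 hp2).2.1⟩
  obtain ⟨a1, b1, -⟩ := p.lv_spec h1 r1.2
  obtain ⟨a2, b2, -⟩ := p.lv_spec h2 r2.2
  rcases le_total (p.lv A1 (p.ft A3)) (p.lv A2 (p.ft A3)) with h | h
  · refine Or.inl ⟨r1, _, b2, ?_⟩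
    rw [Pc.rung, Pc.sub_s _ a1.2]
    exact ⟨_, ⟨h, a2.2⟩, rfl⟩
  · refine Or.inr ⟨r2, _, b1, ?_⟩
    rw [Pc.rung, Pc.sub_s _ a2.2]
    exact ⟨_, ⟨h, a1.2⟩, rfl⟩

end Half
end QP

namespace QP

set_option linter.all false
open Finset Set

section SL
variable {V : Type*} [Fintype V]

theorem card_prod_flt (H K : Finset V) (E : V → V → Prop) :
    (flt (H ×ˢ K) fun p => E p.1 p.2).card = ∑ a ∈ H, cnt K (E a) := by
  classical
  simp only [cnt_eq_sum]
  rw [flt, Finset.card_filter, Finset.sum_product]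

theorem card_prod3_flt (H K T : Finset V) (M : V → V → V → Prop) :
    (flt (H ×ˢ K ×ˢ T) fun p => M p.1 p.2.1 p.2.2).card =
      ∑ a ∈ H, ∑ c ∈ T, cnt K (fun b => M a b c) := by
  classical
  simp only [cnt_eq_sum]
  rw [flt, Finset.card_filter, Finset.sum_product]
  refine Finset.sum_congr rfl fun a _ => ?_
  rw [Finset.sum_product, Finset.sum_comm]

theorem triple_sum' (J : Finset V) (H : V → Finset V) (E : V → V → Prop)
    (M : V → V → V → V → Prop) (e m : ℕ)
    (he : ∀ j ∈ J, (flt (H j ×ˢ H j) fun p => E p.1 p.2).card ≤ e)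
    (hm : ∑ j ∈ J, (flt (H j ×ˢ H j ×ˢ H j) fun p => M j p.1 p.2.1 p.2.2).card ≤ m)
    (hM : ∀ j ∈ J, ∀ a ∈ H j, ∀ b ∈ H j, ∀ c ∈ H j, ¬ E a b → ¬ E b c → ¬ E a c →
      M j a b c ∨ M j a c b ∨ M j b a c ∨ M j b c a ∨ M j c a b ∨ M j c b a) :
    (∑ j ∈ J, (H j).card) ^ 3 ≤
      3 * (Fintype.card V) ^ 4 * e + 6 * (Fintype.card V) ^ 2 * m :=
  triple_sum J H E M e m he hm hM

/-- rung sparsity -/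
def RungSparse (B : Finset V) (c : V → Pc) (A C : Set ℂ) (N : ℝ) : Prop :=
  ((∑ b ∈ flt B (fun b => (c b).HasR A C), cnt (flt B (fun b => (c b).HasR A C))
    (fun b' => ¬ Disjoint ((c b).rung A C).o ((c b').rung A C).o) : ℕ) : ℝ) ≤ N

set_option maxHeartbeats 1000000 in
theorem S_lemma {F : V → Set ℂ} {s L : ℕ} (hR : NoBic (Rel F) s) {z : ℝ}
    (hz : 0 < z) (hz1 : z ≤ 1) (hsL : s ≤ 2 ^ L)
    (hs : 3600 * (L + 5) * (s : ℝ) ≤ (z ^ 12) ^ 6 * Fintype.card V)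
    (W B : Finset V) (wl c : V → Pc) (hwl : ∀ a ∈ W, (wl a).s ⊆ F a) (hc : ∀ b ∈ B, (c b).s ⊆ F b)
    (hrung : ∀ a ∈ W, ∀ a' ∈ W, Disjoint (wl a).s (wl a').s →
      RungSparse B c (wl a).s (wl a').s (z ^ 12 * (Fintype.card V : ℝ) ^ 2))
    (hE : ((∑ a ∈ W, cnt W (fun a' => ((wl a).s ∩ (wl a').s).Nonempty) : ℕ) : ℝ) ≤
      z ^ 12 * (Fintype.card V : ℝ) ^ 2) :
    ((∑ b ∈ B, cnt W (fun a => ((wl a).s ∩ (c b).s).Nonempty) : ℕ) : ℝ) ≤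
      3 * z ^ 2 * (Fintype.card V : ℝ) ^ 2 := by
  classical
  set n := Fintype.card V with hn
  have hcn : ∀ X : Finset V, (X.card : ℝ) ≤ n := fun X => by exact_mod_cast Finset.card_le_univ X
  have hn0 : (0:ℝ) ≤ n := Nat.cast_nonneg _
  let H : V → Finset V := fun b => flt W (fun a => ((wl a).s ∩ (c b).s).Nonempty)
  let E : V → V → Prop := fun a a' => ((wl a).s ∩ (wl a').s).Nonempty
  let M : V → V → V → V → Prop := fun b a y a' => Disjoint (wl a).s (wl a').s ∧
    Disjoint (wl y).s (wl a).s ∧ Disjoint (wl y).s (wl a').s ∧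
    (c b).HasR (wl a).s (wl a').s ∧ ((wl y).s ∩ ((c b).rung (wl a).s (wl a').s).s).Nonempty
  let mm : ℕ := ∑ b ∈ B, (flt (H b ×ˢ H b ×ˢ H b) fun p => M b p.1 p.2.1 p.2.2).card
  have hts := triple_sum' B H E M (∑ a ∈ W, cnt W (E a)) mm ?_ (le_refl mm) ?_
  rotate_left
  · intro b hb
    have h1 := card_prod_flt (H b) (H b) E
    rw [h1]
    calc ∑ a ∈ H b, cnt (H b) (E a) ≤ ∑ a ∈ H b, cnt W (E a) :=
          Finset.sum_le_sum fun a _ => cnt_mono fun a' ha' h => ⟨flt_subset _ _ ha', h⟩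
      _ ≤ _ := Finset.sum_le_sum_of_subset (flt_subset _ _)
  · intro b hb x hx y hy w hw hxy hyw hxw
    have nd : ∀ {u v : V}, ¬ E u v → Disjoint (wl u).s (wl v).s := fun h =>
      Set.disjoint_iff_inter_eq_empty.2 (Set.not_nonempty_iff_eq_empty.1 h)
    have d1 := nd hxy
    have d2 := nd hyw
    have d3 := nd hxw
    have cl : ∀ u, IsClosed (wl u).s := fun u => Pc.s_closed _
    have hh : ∀ {u}, u ∈ H b → ((c b).s ∩ (wl u).s).Nonempty := fun hu => by
      rw [Set.inter_comm]; exact (mem_flt.1 hu).2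
    have key : ∀ {u v t : V}, u ∈ H b → v ∈ H b → t ∈ H b → Disjoint (wl u).s (wl v).s →
        Disjoint (wl u).s (wl t).s → Disjoint (wl v).s (wl t).s →
        (c b).ft (wl u).s ≤ (c b).ft (wl t).s → (c b).ft (wl v).s ≤ (c b).ft (wl t).s →
        M b u v t ∨ M b v u t := by
      intro u v t hu hv ht huv hut hvt h1 h2
      rcases triple_order (c b) (cl u) (cl v) (cl t) huv (hh hu) (hh hv) (hh ht) h1 h2 with h | h
      · exact Or.inl ⟨hut, huv.symm, hvt, h.1, h.2⟩
      · exact Or.inr ⟨hvt, huv, hut, h.1, h.2⟩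
    rcases le_total ((c b).ft (wl x).s) ((c b).ft (wl y).s) with h1 | h1
    · rcases le_total ((c b).ft (wl y).s) ((c b).ft (wl w).s) with h2 | h2
      · have := key hx hy hw d1 d3 d2 (h1.trans h2) h2
        exact this.elim Or.inl (fun h => Or.inr (Or.inr (Or.inl h)))
      · have := key hx hw hy d3 d1 d2.symm h1 h2
        exact Or.inr (this.elim Or.inl (fun h => Or.inr (Or.inr (Or.inr (Or.inl h)))))
    · rcases le_total ((c b).ft (wl x).s) ((c b).ft (wl w).s) with h2 | h2
      · have := key hx hy hw d1 d3 d2 h2 (h1.trans h2)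
        exact this.elim Or.inl (fun h => Or.inr (Or.inr (Or.inl h)))
      · have := key hy hw hx d2 d1.symm d3.symm h1 h2
        exact Or.inr (Or.inr (Or.inr (this.elim Or.inl (fun h => Or.inr (Or.inr h)))))
  have hz12 : 0 < z ^ 12 := by positivity
  have hz121 : z ^ 12 ≤ 1 := pow_le_one₀ hz.le hz1
  have hm : ((∑ b ∈ B, (flt (H b ×ˢ H b ×ˢ H b) fun p => M b p.1 p.2.1 p.2.2).card : ℕ) : ℝ) ≤
      4 * z ^ 6 * (n:ℝ) ^ 4 := by
    have h1 : ∑ b ∈ B, (flt (H b ×ˢ H b ×ˢ H b) fun p => M b p.1 p.2.1 p.2.2).card ≤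
        ∑ a ∈ W, ∑ a' ∈ W, ∑ b ∈ B, cnt W (fun y => M b a y a') := by
      calc _ ≤ ∑ b ∈ B, ∑ a ∈ W, ∑ a' ∈ W, cnt W (fun y => M b a y a') := by
            refine Finset.sum_le_sum fun b _ => ?_
            have h1 := card_prod3_flt (H b) (H b) (H b) (M b)
            rw [h1]
            calc _ ≤ ∑ a ∈ H b, ∑ a' ∈ H b, cnt W (fun y => M b a y a') :=
                  Finset.sum_le_sum fun a _ => Finset.sum_le_sum fun a' _ =>
                    cnt_mono fun y hy h => ⟨flt_subset _ _ hy, h⟩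
              _ ≤ ∑ a ∈ H b, ∑ a' ∈ W, cnt W (fun y => M b a y a') :=
                  Finset.sum_le_sum fun a _ => Finset.sum_le_sum_of_subset (flt_subset _ _)
              _ ≤ _ := Finset.sum_le_sum_of_subset (flt_subset _ _)
        _ = ∑ a ∈ W, ∑ b ∈ B, ∑ a' ∈ W, cnt W (fun y => M b a y a') := Finset.sum_comm
        _ = _ := Finset.sum_congr rfl fun a _ => Finset.sum_comm
    have h2 : ∀ a ∈ W, ∀ a' ∈ W, ((∑ b ∈ B, cnt W (fun y => M b a y a') : ℕ) : ℝ) ≤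
        4 * z ^ 6 * (n:ℝ) ^ 2 := by
      intro a ha a' ha'
      by_cases hd : Disjoint (wl a).s (wl a').s
      · have hcl := Pc.s_closed (wl a)
        have hcl' := Pc.s_closed (wl a')
        have := S_core hR hz12 hz121 hsL hs (wl a).s_pc (wl a').s_pc hd
          (flt B (fun b => (c b).HasR (wl a).s (wl a').s))
          (fun b => (c b).rung (wl a).s (wl a').s)
          (fun b hb => (c b).rung_rung hcl hcl' hd (mem_flt.1 hb).2)
          (fun b hb => ((c b).rung_s_sub hcl hcl' (mem_flt.1 hb).2).trans (hc b (mem_flt.1 hb).1))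
          (hrung a ha a' ha' hd)
          (flt W fun y => Disjoint (wl y).s (wl a).s ∧ Disjoint (wl y).s (wl a').s) wl
          (fun y hy => hwl y (mem_flt.1 hy).1) (fun y hy => (mem_flt.1 hy).2.1)
          (fun y hy => (mem_flt.1 hy).2.2) (η := 4 * z ^ 6) (by positivity)
          (by rw [mul_pow, ← pow_mul]; norm_num; linarith)
        refine le_trans ?_ this
        norm_cast
        rw [cnt_comm]
        calc ∑ y ∈ W, cnt B (fun b => M b a y a') ≤ ∑ y ∈ W,
              if Disjoint (wl y).s (wl a).s ∧ Disjoint (wl y).s (wl a').s then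
              cnt (flt B (fun b => (c b).HasR (wl a).s (wl a').s))
                (fun b => ((wl y).s ∩ ((c b).rung (wl a).s (wl a').s).s).Nonempty) else 0 := by
              refine Finset.sum_le_sum fun y _ => ?_
              split_ifs with h
              · exact cnt_mono fun b hb h => ⟨mem_flt.2 ⟨hb, h.2.2.2.1⟩, h.2.2.2.2⟩
              · refine (Finset.card_eq_zero.2 ?_).le
                refine Finset.eq_empty_of_forall_notMem fun b hb => ?_
                obtain ⟨-, -, h1, h2, -⟩ := mem_flt.1 hb
                exact h ⟨h1, h2⟩
          _ = _ := by
              rw [sum_flt]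
              refine Finset.sum_congr rfl fun y _ => ?_
              congr
      · have : ∑ b ∈ B, cnt W (fun y => M b a y a') = 0 := by
          refine Finset.sum_eq_zero fun b _ => Finset.card_eq_zero.2 ?_
          refine Finset.eq_empty_of_forall_notMem fun y hy => hd (mem_flt.1 hy).2.1
        rw [this, Nat.cast_zero]; positivity
    calc _ ≤ ((∑ a ∈ W, ∑ a' ∈ W, ∑ b ∈ B, cnt W (fun y => M b a y a') : ℕ) : ℝ) := by
          exact_mod_cast h1
      _ = ∑ a ∈ W, ∑ a' ∈ W, ((∑ b ∈ B, cnt W (fun y => M b a y a') : ℕ) : ℝ) := by push_cast; rfl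
      _ ≤ ∑ a ∈ W, ∑ a' ∈ W, 4 * z ^ 6 * (n:ℝ) ^ 2 :=
          Finset.sum_le_sum fun a ha => Finset.sum_le_sum fun a' ha' => h2 a ha a' ha'
      _ = W.card * (W.card * (4 * z ^ 6 * (n:ℝ) ^ 2)) := by simp
      _ ≤ n * (n * (4 * z ^ 6 * (n:ℝ) ^ 2)) := by
          have := hcn W
          gcongr
      _ = _ := by ring
  have hts' : ((∑ b ∈ B, (H b).card : ℕ) : ℝ) ^ 3 ≤ (3 * z ^ 2 * (n:ℝ) ^ 2) ^ 3 := by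
    have h1 : ((∑ b ∈ B, (H b).card : ℕ) : ℝ) ^ 3 ≤
        3 * (n:ℝ) ^ 4 * ((∑ a ∈ W, cnt W (E a) : ℕ) : ℝ) + 6 * (n:ℝ) ^ 2 *
        ((∑ b ∈ B, (flt (H b ×ˢ H b ×ˢ H b) fun p => M b p.1 p.2.1 p.2.2).card : ℕ) : ℝ) := by
      exact_mod_cast hts
    have hz612 : z ^ 12 ≤ z ^ 6 := pow_le_pow_of_le_one hz.le hz1 (by norm_num)
    calc _ ≤ _ := h1
      _ ≤ 3 * (n:ℝ) ^ 4 * (z ^ 12 * (n:ℝ) ^ 2) + 6 * (n:ℝ) ^ 2 * (4 * z ^ 6 * (n:ℝ) ^ 4) := by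
          gcongr
      _ = (3 * z ^ 12 + 24 * z ^ 6) * (n:ℝ)^6 := by ring
      _ ≤ (27 * z ^ 6) * (n:ℝ)^6 := by gcongr; linarith
      _ = _ := by ring
  exact le_of_pow_le_pow_left₀ (by norm_num) (by positivity) hts'

theorem half_S {F : V → Set ℂ} {s L : ℕ} (hR : NoBic (Rel F) s) {z : ℝ}
    (hz : 0 < z) (hz1 : z ≤ 1) (hsL : s ≤ 2 ^ L)
    (hs : 3600 * (L + 5) * (s : ℝ) ≤ (z ^ 12) ^ 6 * Fintype.card V)
    (I : Finset V) (p : V → Pc) (hp : ∀ a ∈ I, (p a).s ⊆ F a)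
    (hrung : ∀ l' : V → ℝ, (∀ y, l' y ∈ Set.Icc 0 (p y).l) → ∀ a ∈ I, ∀ a' ∈ I,
      Disjoint ((p a).pre (l' a)).s ((p a').pre (l' a')).s →
      RungSparse I p ((p a).pre (l' a)).s ((p a').pre (l' a')).s
        (z ^ 12 * (Fintype.card V : ℝ) ^ 2))
    (hE : ∀ l' : V → ℝ, (∀ y, l' y ∈ Set.Icc 0 (p y).l) → ∀ y ∈ I, ∀ A : Finset V,
      (∀ i ∈ A, i ∈ I ∧ ((p i).s ∩ (p y).s).Nonempty ∧ ¬ (((p i).pre (l' i)).s ∩ (p y).s).Nonempty)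
      → ((∑ a ∈ A, cnt A (fun a' => (((p a).pre (l' a)).s ∩ ((p a').pre (l' a')).s).Nonempty)
          : ℕ) : ℝ) ≤ z ^ 12 * (Fintype.card V : ℝ) ^ 2) :
    ((∑ a ∈ I, cnt I (fun a' => ((p a).s ∩ (p a').s).Nonempty) : ℕ) : ℝ) ≤
      4 * z * (Fintype.card V : ℝ) ^ 2 := by
  classical
  obtain ⟨l', hl', hmain⟩ := half_lemma hR I I p (fun b => (p b).s)
    (fun b _ => (p b).s_closed) hp
  set n := Fintype.card V with hn
  have hn0 : (0:ℝ) ≤ n := Nat.cast_nonneg _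
  have hcn : ∀ X : Finset V, (X.card : ℝ) ≤ n := fun X => by exact_mod_cast Finset.card_le_univ X
  have hsn := s_le (pow_pos hz 12) (pow_le_one₀ hz.le hz1) 6 (by norm_num) hs
  have hz122 : z ^ 12 ≤ z ^ 2 := pow_le_pow_of_le_one hz.le hz1 (by norm_num)
  refine hmain (3 * z ^ 2) (4 * z) (by positivity) ?_ ?_
  · have h1 : z ^ 12 * n ≤ z ^ 2 * n := by gcongr
    calc 4 * (3 * z ^ 2) * (n:ℝ) ^ 3 + 2 * s * (n:ℝ) ^ 2 =
          (12 * z ^ 2 * n + 2 * s) * (n:ℝ) ^ 2 := by ring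
      _ ≤ (16 * z ^ 2 * n) * (n:ℝ) ^ 2 := by
          gcongr
          have : (0:ℝ) ≤ s := Nat.cast_nonneg _
          have : (0:ℝ) ≤ z ^ 2 * n := by positivity
          linarith
      _ = _ := by ring
  · have hb0 : ∀ b0 ∈ I, ((∑ y ∈ flt I (fun y => ((p y).s ∩ (p b0).s).Nonempty ∧
          ¬ (((p y).pre (l' y)).s ∩ (p b0).s).Nonempty),
          cnt I (fun b => (((p y).pre (l' y)).s ∩ (p b).s).Nonempty) : ℕ) : ℝ) ≤
          3 * z ^ 2 * (n:ℝ) ^ 2 := by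
      intro b0 hb0
      rw [cnt_comm]
      refine S_lemma hR hz hz1 hsL hs _ I (fun y => (p y).pre (l' y)) p
        (fun a ha => ((p a).pre_s_sub (hl' a).2).trans (hp a (mem_flt.1 ha).1)) hp
        (fun a ha a' ha' => hrung l' hl' a (mem_flt.1 ha).1 a' (mem_flt.1 ha').1)
        (hE l' hl' b0 hb0 _ fun i hi => mem_flt.1 hi)
    push_cast at hb0 ⊢
    calc _ ≤ _ := Finset.sum_le_sum hb0
      _ = I.card * (3 * z ^ 2 * (n:ℝ) ^ 2) := by simp
      _ ≤ n * (3 * z ^ 2 * (n:ℝ) ^ 2) := by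
          have := hcn I
          gcongr
      _ = _ := by ring

end SL
end QP

namespace QP

set_option linter.all false
open Finset Set

section OD
variable {V : Type*} [Fintype V]

theorem drop_bad (B : Finset V) (bad : V → Prop) (Q : V → V → Prop) :
    ∑ b ∈ B, cnt B (Q b) ≤ ∑ b ∈ flt B (fun b => ¬ bad b), cnt (flt B (fun b => ¬ bad b)) (Q b) +
      2 * (cnt B bad * Fintype.card V) := by
  classical
  have hc : ∀ X : Finset V, X.card ≤ Fintype.card V := fun X => Finset.card_le_univ X
  have h1 : ∀ b, cnt B (Q b) ≤ cnt (flt B (fun b => ¬ bad b)) (Q b) + cnt B bad := by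
    intro b
    refine (cnt_or (Q := fun c => ¬ bad c ∧ Q b c) (T := bad) fun c _ h => ?_).trans ?_
    · tauto
    · refine Nat.add_le_add_right (cnt_mono fun c hc h => ⟨mem_flt.2 ⟨hc, h.1⟩, h.2⟩) _
  calc ∑ b ∈ B, cnt B (Q b) = ∑ b ∈ flt B (fun b => ¬ bad b), cnt B (Q b) +
        ∑ b ∈ flt B bad, cnt B (Q b) := by
        rw [flt, flt, add_comm, Finset.sum_filter_add_sum_filter_not]
    _ ≤ ∑ b ∈ flt B (fun b => ¬ bad b), (cnt (flt B (fun b => ¬ bad b)) (Q b) + cnt B bad) +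
        ∑ b ∈ flt B bad, Fintype.card V := by
        gcongr with b _ b _
        · exact h1 b
        · exact (cnt_le_card _ _).trans (hc _)
    _ = ∑ b ∈ flt B (fun b => ¬ bad b), cnt (flt B (fun b => ¬ bad b)) (Q b) +
        ((flt B (fun b => ¬ bad b)).card * cnt B bad + cnt B bad * Fintype.card V) := by
        rw [Finset.sum_add_distrib, Finset.sum_const, Finset.sum_const, smul_eq_mul, smul_eq_mul,
          add_assoc]
        rfl
    _ ≤ _ := by
        have := Nat.mul_le_mul_right (cnt B bad) (hc (flt B (fun b => ¬ bad b)))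
        nlinarith

theorem lemma_O {F : V → Set ℂ} {s L : ℕ} (hR : NoBic (Rel F) s) {z : ℝ}
    (hz : 0 < z) (hz1 : z ≤ 1) (hsL : s ≤ 2 ^ L)
    (hs : 3600 * (L + 5) * (s : ℝ) ≤ (z ^ 12 / 4) ^ 6 * Fintype.card V)
    {X : Set ℂ} (hX : IsClosed X) (hXp : IsPathConnected X)
    (I : Finset V) (p : V → Pc) (hp : ∀ a ∈ I, (p a).s ⊆ F a)
    (hg0 : ∀ a ∈ I, (p a).f 0 ∈ X) (hg : ∀ a ∈ I, ∀ t, 0 < t → t ≤ (p a).l → (p a).f t ∉ X) :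
    ((∑ a ∈ I, cnt I (fun a' => ((p a).s ∩ (p a').s).Nonempty) : ℕ) : ℝ) ≤
      4 * z * (Fintype.card V : ℝ) ^ 2 := by
  classical
  set n := Fintype.card V with hn
  have hn0 : (0:ℝ) ≤ n := Nat.cast_nonneg _
  have hz12 : 0 < z ^ 12 := by positivity
  have hz121 : z ^ 12 ≤ 1 := pow_le_one₀ hz.le hz1
  have hδ : 0 < z ^ 12 / 4 := by positivity
  have hδ1 : z ^ 12 / 4 ≤ 1 := by linarith
  have hsn := s_le hδ hδ1 6 (by norm_num) hs
  have hs' : 3600 * (L + 5) * (s : ℝ) ≤ (z ^ 12) ^ 6 * n := by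
    refine hs.trans ?_
    gcongr
    linarith
  -- feet
  have foot : ∀ a ∈ I, ∀ q, q ∈ (p a).s → q ∈ X → q = (p a).f 0 := by
    rintro a ha _ ⟨t, ⟨h0, h1⟩, rfl⟩ hq
    rcases h0.eq_or_lt with rfl | h0
    · rfl
    · exact absurd hq (hg a ha t h0 h1)
  have footcard : ∀ B : Finset V, B ⊆ I → ∀ q, cnt B (fun b => (p b).f 0 = q) < s := by
    intro B hB q
    refine point_lt hR q _ fun b hb => ?_
    obtain ⟨h1, h2⟩ := mem_flt.1 hb
    rw [← h2]
    exact hp b (hB h1) (p b).f0_mem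
  have arith : ∀ (N N' c : ℕ), N ≤ N' + 2 * (c * n) → c < s → (N' : ℝ) ≤ 2 * (z ^ 12 / 4) * n ^ 2 +
      s * n → (N : ℝ) ≤ z ^ 12 * n ^ 2 := by
    intro N N' c h1 h2 h3
    have h1' : (N : ℝ) ≤ N' + 2 * (c * n) := by exact_mod_cast h1
    have h2' : (c : ℝ) ≤ s := by exact_mod_cast h2.le
    have h4 : (c:ℝ) * n ≤ s * n := by gcongr
    have h5 : 18000 * (s:ℝ) * n ≤ z ^ 12 / 4 * n * n := by gcongr
    have h6 : (0:ℝ) ≤ z ^ 12 * n * n := by positivity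
    have h7 : (0:ℝ) ≤ s * n := by positivity
    nlinarith
  refine half_S hR hz hz1 hsL hs' I p hp ?_ ?_
  · intro l' hl' a ha a' ha' hd
    set Al := ((p a).pre (l' a)).s with hAl
    set Ar := ((p a').pre (l' a')).s with hAr
    have hAlc : IsClosed Al := Pc.s_closed _
    have hArc : IsClosed Ar := Pc.s_closed _
    obtain ⟨k, hk, hkX⟩ := exists_rung hAlc hArc hd hXp
      ⟨(p a).f 0, hg0 a ha, Pc.f0_mem ((p a).pre (l' a))⟩
      ⟨(p a').f 0, hg0 a' ha', Pc.f0_mem ((p a').pre (l' a'))⟩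
    set B0 := flt I (fun b => (p b).HasR Al Ar) with hB0
    set I' := flt B0 (fun b => ¬ (p b).f 0 = (p a).f 0) with hI'
    have hI'I : ∀ b ∈ I', b ∈ I ∧ (p b).HasR Al Ar ∧ ¬ (p b).f 0 = (p a).f 0 := fun b hb =>
      ⟨(mem_flt.1 (mem_flt.1 hb).1).1, (mem_flt.1 (mem_flt.1 hb).1).2, (mem_flt.1 hb).2⟩
    have hrX : ∀ b ∈ I', Disjoint ((p b).rung Al Ar).s X := by
      intro b hb
      obtain ⟨h1, h2, h3⟩ := hI'I b hb
      obtain ⟨c1, c2, c3⟩ := (p b).ft_spec hArc h2.1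
      obtain ⟨a1, a2, a3⟩ := (p b).lv_spec hAlc h2.2
      have hpos : 0 < (p b).lv Al ((p b).ft Ar) := by
        refine lt_of_le_of_ne a1.1 fun e => h3 ?_
        rw [← e] at a2
        exact foot a ha _ ((p a).pre_s_sub (hl' a).2 a2) (hg0 b h1)
      rw [Pc.rung, Pc.sub_s _ a1.2, Set.disjoint_left]
      rintro _ ⟨t, ht, rfl⟩
      exact hg b h1 t (hpos.trans_le ht.1) (ht.2.trans c1.2)
    have hru : ∀ b ∈ I', Rung Al Ar ((p b).rung Al Ar) := fun b hb =>
      (p b).rung_rung hAlc hArc hd (hI'I b hb).2.1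
    have hruF : ∀ b ∈ I', ((p b).rung Al Ar).s ⊆ F b := fun b hb =>
      ((p b).rung_s_sub hAlc hArc (hI'I b hb).2.1).trans (hp b (hI'I b hb).1)
    have hfs := frame_sparse hR hδ hδ1 hsL hs (Pc.s_pc _) (Pc.s_pc _) hd hk I' I'
      (fun b => (p b).rung Al Ar) hru hruF
      (fun b hb => (hrX b hb).mono (Pc.o_sub_s _) ((Pc.o_sub_s _).trans hkX))
      (fun b => ((p b).rung Al Ar).o) (fun b hb => Pc.o_pc _ (hru b hb).pos)
      (fun b hb => (Pc.o_sub_s _).trans (hruF b hb))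
      (fun b hb => by
        rintro x hx ((h | h) | h)
        · exact Set.disjoint_left.1 (hru b hb).avA hx h
        · exact Set.disjoint_left.1 (hru b hb).avB hx h
        · exact Set.disjoint_left.1 (hrX b hb) (Pc.o_sub_s _ hx) (hkX h))
      (fun b => flt I' (fun b' => ¬ Disjoint ((p b).rung Al Ar).o ((p b').rung Al Ar).o))
      (fun b _ => flt_subset _ _)
      (fun b _ i hi => by
        obtain ⟨x, hx1, hx2⟩ := Set.not_disjoint_iff.1 (mem_flt.1 hi).2
        exact ⟨x, hx1, Pc.o_sub_s _ hx2⟩)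
    refine arith _ _ _ (drop_bad B0 (fun b => (p b).f 0 = (p a).f 0) _)
      (footcard B0 (flt_subset _ _) _) (le_trans hfs ?_)
    have : (0:ℝ) ≤ s * n := by positivity
    linarith
  · intro l' hl' y hy A hA
    set A' := flt A (fun b => ¬ (p b).f 0 = (p y).f 0) with hA'
    have hAI : A ⊆ I := fun i hi => (hA i hi).1
    have hycl := (p y).s_closed
    have hft : ∀ i ∈ A', i ∈ I ∧ (p i).ft (p y).s ≤ (p i).l ∧ 0 < (p i).ft (p y).s ∧
        l' i < (p i).ft (p y).s ∧ (p i).f ((p i).ft (p y).s) ∈ (p y).s ∧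
        ∀ t, 0 ≤ t → t < (p i).ft (p y).s → (p i).f t ∉ (p y).s := by
      intro i hi
      obtain ⟨h1, h2⟩ := mem_flt.1 hi
      obtain ⟨h3, h4, h5⟩ := hA i h1
      obtain ⟨c1, c2, c3⟩ := (p i).ft_spec hycl h4
      refine ⟨h3, c1.2, ?_, ?_, c2, c3⟩
      · refine lt_of_le_of_ne c1.1 fun e => h2 ?_
        rw [← e] at c2
        exact foot y hy _ c2 (hg0 i h3)
      · by_contra hcon
        push Not at hcon
        refine h5 ⟨_, ?_, c2⟩
        rw [Pc.pre_s _ (hl' i).1]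
        exact ⟨_, ⟨c1.1, hcon⟩, rfl⟩
    have hu : ∀ i, ∃ u : ℝ, i ∈ A' → 0 < u ∧ u ≤ (p y).l ∧
        (p y).f u = (p i).f ((p i).ft (p y).s) := by
      intro i
      by_cases hi : i ∈ A'
      · obtain ⟨h1, h2, h3, h4, ⟨u, hu, hue⟩, h6⟩ := hft i hi
        refine ⟨u, fun _ => ⟨?_, hu.2, hue⟩⟩
        refine lt_of_le_of_ne hu.1 fun e => ?_
        have h7 := hg i h1 _ h3 h2
        rw [← hue, ← e] at h7
        exact h7 (hg0 y hy)
      · exact ⟨0, fun h => absurd h hi⟩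
    choose u hu using hu
    have hmain : ((∑ a ∈ A', cnt A' (fun a' =>
        (((p a).pre (l' a)).s ∩ ((p a').pre (l' a')).s).Nonempty) : ℕ) : ℝ) ≤
        2 * (z ^ 12 / 4) * n ^ 2 + s * n := by
      rcases A'.eq_empty_or_nonempty with he | hne
      · rw [he, Finset.sum_empty, Nat.cast_zero]; positivity
      obtain ⟨m, hm, hmin⟩ := Finset.exists_min_image A' u hne
      obtain ⟨hm1, hm2, -⟩ := hu m hm
      set Rho := ((p y).sub (u m) (p y).l).s with hRho
      have hRhoe : Rho = (p y).f '' Set.Icc (u m) (p y).l := Pc.sub_s _ hm2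
      have hRhoc : IsClosed Rho := Pc.s_closed _
      have hRhoy : Rho ⊆ (p y).s := by
        rw [hRhoe]; exact image_mono (Set.Icc_subset_Icc hm1.le le_rfl)
      have hXR : Disjoint X Rho := by
        rw [Set.disjoint_right, hRhoe]
        rintro _ ⟨t, ht, rfl⟩
        exact hg y hy t (hm1.trans_le ht.1) ht.2
      obtain ⟨k, hk, hkZ⟩ := exists_rung (Z := (p y).f '' Set.Icc 0 (u m)) hX hRhoc hXR
        (by rw [← Pc.pre_s _ hm1.le]; exact Pc.s_pc _)
        ⟨(p y).f 0, ⟨0, ⟨le_rfl, hm1.le⟩, rfl⟩, hg0 y hy⟩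
        ⟨(p y).f (u m), ⟨u m, ⟨hm1.le, le_rfl⟩, rfl⟩, by
          rw [hRhoe]; exact ⟨u m, ⟨le_rfl, hm2⟩, rfl⟩⟩
      have hky : k.s ⊆ (p y).s := hkZ.trans (image_mono (Set.Icc_subset_Icc le_rfl hm2))
      let P : V → Pc := fun i => (p i).pre ((p i).ft (p y).s)
      have hPl : ∀ i ∈ A', (P i).l = (p i).ft (p y).s := fun i hi =>
        max_eq_left (hft i hi).2.2.1.le
      have hPo : ∀ i ∈ A', (P i).o = (p i).f '' Set.Ioo 0 ((p i).ft (p y).s) := fun i hi => by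
        rw [Pc.o, hPl i hi]; rfl
      have hPy : ∀ i ∈ A', Disjoint (P i).o (p y).s := by
        intro i hi
        rw [hPo i hi, Set.disjoint_left]
        rintro _ ⟨t, ht, rfl⟩
        exact (hft i hi).2.2.2.2.2 t ht.1.le ht.2
      have hru : ∀ i ∈ A', Rung X Rho (P i) := by
        intro i hi
        refine ⟨?_, hg0 i (hft i hi).1, ?_, ?_, (hPy i hi).mono_right hRhoy⟩
        · rw [hPl i hi]; exact (hft i hi).2.2.1
        · rw [hPl i hi, hRhoe]
          exact ⟨u i, ⟨hmin i hi, (hu i hi).2.1⟩, (hu i hi).2.2⟩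
        · rw [hPo i hi, Set.disjoint_left]
          rintro _ ⟨t, ht, rfl⟩
          exact hg i (hft i hi).1 t ht.1 (ht.2.le.trans (hft i hi).2.1)
      have hPF : ∀ i ∈ A', (P i).s ⊆ F i := fun i hi =>
        (Pc.pre_s_sub _ (hft i hi).2.1).trans (hp i (hft i hi).1)
      have hfs := frame_sparse hR hδ hδ1 hsL hs hXp (Pc.s_pc _) hXR hk A' A' P hru hPF
        (fun i hi => (hPy i hi).mono_right ((Pc.o_sub_s _).trans hky))
        (fun i => (P i).o) (fun i hi => Pc.o_pc _ (hru i hi).pos)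
        (fun i hi => (Pc.o_sub_s _).trans (hPF i hi))
        (fun b hb => by
          rintro x hx ((h | h) | h)
          · exact Set.disjoint_left.1 (hru b hb).avA hx h
          · exact Set.disjoint_left.1 (hru b hb).avB hx h
          · exact Set.disjoint_left.1 (hPy b hb) hx (hky h))
        (fun b => flt A' (fun b' => ¬ Disjoint (P b).o (P b').o))
        (fun b _ => flt_subset _ _)
        (fun b _ i hi => by
          obtain ⟨x, hx1, hx2⟩ := Set.not_disjoint_iff.1 (mem_flt.1 hi).2
          exact ⟨x, hx1, Pc.o_sub_s _ hx2⟩)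
      have h1 : ∑ a ∈ A', cnt A' (fun a' =>
          (((p a).pre (l' a)).s ∩ ((p a').pre (l' a')).s).Nonempty) ≤
          ∑ a ∈ A', ((flt A' (fun b' => ¬ Disjoint (P a).o (P b').o)).card + s) := by
        refine Finset.sum_le_sum fun a ha => ?_
        refine (cnt_or (Q := fun b' => ¬ Disjoint (P a).o (P b').o)
          (T := fun b => (p b).f 0 = (p a).f 0) ?_).trans (Nat.add_le_add_left
          (footcard A' (fun i hi => (hft i hi).1) _).le _)
        rintro b hb ⟨x, hx1, hx2⟩
        rw [Pc.pre_s _ (hl' _).1] at hx1 hx2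
        obtain ⟨t1, ht1, e1⟩ := hx1
        obtain ⟨t2, ht2, e2⟩ := hx2
        have f1 := hft a ha
        have f2 := hft b hb
        by_cases hxX : x ∈ X
        · right
          rw [← foot a f1.1 x ⟨t1, ⟨ht1.1, ht1.2.trans (f1.2.2.2.1.le.trans f1.2.1)⟩, e1⟩ hxX]
          rw [← foot b f2.1 x ⟨t2, ⟨ht2.1, ht2.2.trans (f2.2.2.2.1.le.trans f2.2.1)⟩, e2⟩ hxX]
        · left
          rw [Set.not_disjoint_iff, hPo a ha, hPo b hb]
          refine ⟨x, ⟨t1, ⟨lt_of_le_of_ne ht1.1 fun e => ?_, ht1.2.trans_lt f1.2.2.2.1⟩, e1⟩,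
            ⟨t2, ⟨lt_of_le_of_ne ht2.1 fun e => ?_, ht2.2.trans_lt f2.2.2.2.1⟩, e2⟩⟩
          · rw [← e] at e1; exact hxX (e1 ▸ hg0 a f1.1)
          · rw [← e] at e2; exact hxX (e2 ▸ hg0 b f2.1)
      rw [Finset.sum_add_distrib, Finset.sum_const, smul_eq_mul] at h1
      have h2 : ((∑ a ∈ A', cnt A' (fun a' =>
          (((p a).pre (l' a)).s ∩ ((p a').pre (l' a')).s).Nonempty) : ℕ) : ℝ) ≤
          ((∑ a ∈ A', (flt A' (fun b' => ¬ Disjoint (P a).o (P b').o)).card + n * s : ℕ) : ℝ) := by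
        have : A'.card * s ≤ n * s := Nat.mul_le_mul_right _ (Finset.card_le_univ _)
        exact_mod_cast h1.trans (by omega)
      rw [Nat.cast_add, Nat.cast_mul] at h2
      nlinarith
    exact arith _ _ _ (drop_bad A (fun b => (p b).f 0 = (p y).f 0) _) (footcard A hAI _) hmain

theorem lemma_D {s L : ℕ} (γ : V → Pc) (hR : NoBic (Rel fun i => (γ i).s) s) {z : ℝ}
    (hz : 0 < z) (hz1 : z ≤ 1) (hsL : s ≤ 2 ^ L)
    (hs : 3600 * (L + 5) * (s : ℝ) ≤ ((z ^ 12 / 4) ^ 12 / 4) ^ 6 * Fintype.card V) :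
    ((∑ a : V, cnt Finset.univ (fun a' => ((γ a).s ∩ (γ a').s).Nonempty) : ℕ) : ℝ) ≤
      4 * z * (Fintype.card V : ℝ) ^ 2 := by
  classical
  set n := Fintype.card V with hn
  have hz12 : 0 < z ^ 12 := by positivity
  have hz121 : z ^ 12 ≤ 1 := pow_le_one₀ hz.le hz1
  set z' := z ^ 12 / 4 with hz'
  have hz'0 : 0 < z' := by positivity
  have hz'1 : z' ≤ 1 := by linarith
  have h4 : 4 * z' = z ^ 12 := by rw [hz']; ring
  have hs' : 3600 * (L + 5) * (s : ℝ) ≤ (z ^ 12) ^ 6 * n := by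
    refine hs.trans ?_
    have h1 : z' ^ 12 ≤ z' := pow_le_of_le_one hz'0.le hz'1 (by norm_num)
    gcongr
    linarith
  have conv : ∀ (B : Finset V) (q : V → Pc) (Q : V → V → Prop), (∀ b ∈ B, (q b).s ⊆ (γ b).s) →
      ∀ X : Set ℂ, IsClosed X → IsPathConnected X → (∀ a ∈ B, (q a).f 0 ∈ X) →
      (∀ a ∈ B, ∀ t, 0 < t → t ≤ (q a).l → (q a).f t ∉ X) →
      (∀ a ∈ B, ∀ b ∈ B, Q a b → ((q a).s ∩ (q b).s).Nonempty) →
      ((∑ a ∈ B, cnt B (Q a) : ℕ) : ℝ) ≤ z ^ 12 * n ^ 2 := by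
    intro B q Q hq X hX hXp h0 h1 hQ
    have := lemma_O hR hz'0 hz'1 hsL hs hX hXp B q hq h0 h1
    rw [h4] at this
    refine le_trans ?_ this
    norm_cast
    exact Finset.sum_le_sum fun a ha => cnt_mono fun b hb h => ⟨hb, hQ a ha b hb h⟩
  refine half_S hR hz hz1 hsL hs' Finset.univ γ (fun _ _ => subset_rfl) ?_ ?_
  · intro l' hl' a ha a' ha' hd
    have hAlc := Pc.s_closed ((γ a).pre (l' a))
    have hArc := Pc.s_closed ((γ a').pre (l' a'))
    refine conv _ _ _ (fun b hb => (γ b).rung_s_sub hAlc hArc (mem_flt.1 hb).2) _ hAlc (Pc.s_pc _)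
      (fun b hb => ((γ b).rung_rung hAlc hArc hd (mem_flt.1 hb).2).left) ?_ ?_
    · intro b hb t ht htl
      have hb' := (mem_flt.1 hb).2
      obtain ⟨a1, a2, a3⟩ := (γ b).lv_spec hAlc hb'.2
      rw [Pc.rung, Pc.sub_l _ a1.2] at htl
      exact a3 _ (by linarith) (by linarith)
    · intro b _ b' _ h
      obtain ⟨x, hx1, hx2⟩ := Set.not_disjoint_iff.1 h
      exact ⟨x, Pc.o_sub_s _ hx1, Pc.o_sub_s _ hx2⟩
  · intro l' hl' y hy A hA
    have hycl := (γ y).s_closed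
    have hft : ∀ i ∈ A, (γ i).ft (γ y).s ≤ (γ i).l ∧ 0 ≤ (γ i).ft (γ y).s ∧
        l' i < (γ i).ft (γ y).s ∧ (γ i).f ((γ i).ft (γ y).s) ∈ (γ y).s ∧
        ∀ t, 0 ≤ t → t < (γ i).ft (γ y).s → (γ i).f t ∉ (γ y).s := by
      intro i hi
      obtain ⟨h3, h4, h5⟩ := hA i hi
      obtain ⟨c1, c2, c3⟩ := (γ i).ft_spec hycl h4
      refine ⟨c1.2, c1.1, ?_, c2, c3⟩
      by_contra hcon
      push Not at hcon
      refine h5 ⟨_, ?_, c2⟩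
      rw [Pc.pre_s _ (hl' i).1]
      exact ⟨_, ⟨c1.1, hcon⟩, rfl⟩
    let q : V → Pc := fun i => ((γ i).pre ((γ i).ft (γ y).s)).rev
    have hql : ∀ i ∈ A, (q i).l = (γ i).ft (γ y).s := fun i hi => max_eq_left (hft i hi).2.1
    have hqf : ∀ i ∈ A, ∀ t, (q i).f t = (γ i).f ((γ i).ft (γ y).s - t) := fun i hi t => by
      show (γ i).f (max ((γ i).ft (γ y).s) 0 - t) = _
      rw [max_eq_left (hft i hi).2.1]
    have hqs : ∀ i, (q i).s = ((γ i).pre ((γ i).ft (γ y).s)).s := fun i => Pc.rev_s _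
    refine conv A q _ ?_ (γ y).s hycl (Pc.s_pc _) ?_ ?_ ?_
    · intro i hi
      rw [hqs]; exact Pc.pre_s_sub _ (hft i hi).1
    · intro i hi
      rw [hqf i hi, sub_zero]; exact (hft i hi).2.2.2.1
    · intro i hi t h0 h1
      rw [hql i hi] at h1
      rw [hqf i hi]
      exact (hft i hi).2.2.2.2 _ (by linarith) (by linarith)
    · intro i hi j hj h
      rw [hqs, hqs]
      have : ∀ i ∈ A, ((γ i).pre (l' i)).s ⊆ ((γ i).pre ((γ i).ft (γ y).s)).s := by
        intro i hi
        rw [Pc.pre_s _ (hl' i).1, Pc.pre_s _ (hft i hi).2.1]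
        exact image_mono (Set.Icc_subset_Icc le_rfl (hft i hi).2.2.1.le)
      exact h.mono (inter_subset_inter (this i hi) (this j hj))

end OD
end QP

namespace QP

set_option linter.all false
open Finset Set

section marg

theorem marg {ι K : Type*} [Fintype ι] [DecidableEq ι] [Fintype K] (w : K → ℝ) (hw : ∑ k, w k = 1)
    {i j : ι} (hij : i ≠ j) (g h : K → ℝ) :
    ∑ k : ι → K, (∏ e, w (k e)) * (g (k i) * h (k j)) = (∑ a, w a * g a) * (∑ a, w a * h a) := by
  have h1 : ∀ k : ι → K, (∏ e, w (k e)) * (g (k i) * h (k j)) =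
      ∏ e, w (k e) * (if e = i then g (k e) else if e = j then h (k e) else 1) := by
    intro k
    rw [Finset.prod_mul_distrib]
    congr 1
    rw [Fintype.prod_eq_mul i j hij]
    · simp [hij.symm]
    · intro x hx; simp [hx.1, hx.2]
  simp_rw [h1]
  rw [← Fintype.prod_sum (fun e a => w a * (if e = i then g a else if e = j then h a else 1))]
  rw [Fintype.prod_eq_mul i j hij]
  · simp [hij.symm]
  · intro x hx; simp [hx.1, hx.2, hw]

end marg

section load
variable {V : Type*} [Fintype V]

/-- no `K_{3,3}` pattern. -/
def NK (G : SimpleGraph V) (R : V → V → Prop) : Prop :=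
  ∀ (p q : Fin 3 → V) (W : ∀ i j, G.Walk (p i) (q j)), ∃ i i' j j', i ≠ i' ∧ j ≠ j' ∧
    ∃ x ∈ (W i j).support, ∃ y ∈ (W i' j').support, R x y

open Classical in
/-- indicator -/
noncomputable def ind (P : Prop) : ℝ := if P then 1 else 0

theorem ind_nonneg (P : Prop) : 0 ≤ ind P := by unfold ind; split <;> norm_num

theorem ind_pos {P : Prop} (h : P) : ind P = 1 := by unfold ind; simp [h]

theorem le_dsum {τ δ : Type*} {T : Finset τ} {D : Finset δ} (f : τ → δ → ℝ) (h0 : ∀ t d, 0 ≤ f t d)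
    {t : τ} {d : δ} (ht : t ∈ T) (hd : d ∈ D) (h : 1 ≤ f t d) : 1 ≤ ∑ t ∈ T, ∑ d ∈ D, f t d :=
  h.trans ((Finset.single_le_sum (f := fun d => f t d) (fun d _ => h0 t d) hd).trans
    (Finset.single_le_sum (f := fun t => ∑ d ∈ D, f t d)
      (fun t _ => Finset.sum_nonneg fun d _ => h0 t d) ht))

/-- load of a path system -/
noncomputable def load (G : SimpleGraph V) (σ : ∀ u v, G.Walk u v) (x : V) : ℝ :=
  ∑ u, ∑ v, ind (x ∈ (σ u v).support)

set_option maxHeartbeats 400000 in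
theorem load_lemma [Nonempty V] (G : SimpleGraph V) (R : V → V → Prop) (hNK : NK G R)
    {K : Type} [Fintype K] (w : K → ℝ) (hw0 : ∀ k, 0 ≤ w k) (hw : ∑ k, w k = 1)
    (σ : K → ∀ u v, G.Walk u v) (C : ℝ) (hC : 0 ≤ C)
    (hl : ∀ x, ∑ k, w k * load G (σ k) x ≤ C) :
    (Fintype.card V : ℝ) ^ 4 ≤ 36 * ((∑ x, cnt univ (R x) : ℕ) : ℝ) * C ^ 2 := by
  classical
  obtain ⟨n, hn⟩ : ∃ n : ℝ, n = (Fintype.card V : ℝ) := ⟨_, rfl⟩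
  rw [← hn]
  have hn0 : 0 < n := by rw [hn]; exact_mod_cast Fintype.card_pos
  let ν : V → ℝ := fun _ => 1 / n
  have hν : ∑ v, ν v = 1 := by
    simp only [ν, Finset.sum_const, Finset.card_univ, nsmul_eq_mul]; rw [← hn]; field_simp
  have hν0 : ∀ v, 0 ≤ ν v := fun v => by simp only [ν]; positivity
  let Wt : (Fin 3 → V) × (Fin 3 → V) × (Fin 3 × Fin 3 → K) → ℝ := fun ω =>
    (∏ e, ν (ω.1 e)) * ((∏ e, ν (ω.2.1 e)) * (∏ e, w (ω.2.2 e)))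
  have hWt0 : ∀ ω, 0 ≤ Wt ω := fun ω => mul_nonneg (Finset.prod_nonneg fun e _ => hν0 (ω.1 e))
    (mul_nonneg (Finset.prod_nonneg fun e _ => hν0 (ω.2.1 e)) (Finset.prod_nonneg fun e _ => hw0 _))
  have hWt1 : ∑ ω, Wt ω = 1 := by
    have e1 : ∑ k : Fin 3 × Fin 3 → K, (∏ e, w (k e)) = 1 := by
      rw [← Fintype.prod_sum (fun e a => w a)]; simp [hw]
    have e2 : ∑ k : Fin 3 → V, (∏ e, ν (k e)) = 1 := by
      rw [← Fintype.prod_sum (fun e a => ν a)]; simp [hν]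
    simp only [Wt, Fintype.sum_prod_type, ← Finset.mul_sum, e1, e2, mul_one]
  -- conditional probability
  let P : V → V → V → ℝ := fun x u v => ∑ k, w k * ind (x ∈ (σ k u v).support)
  have key : ∀ (i i' j j' : Fin 3), i ≠ i' → j ≠ j' → ∀ x y : V,
      ∑ ω, Wt ω * (ind (x ∈ (σ (ω.2.2 (i, j)) (ω.1 i) (ω.2.1 j)).support) *
        ind (y ∈ (σ (ω.2.2 (i', j')) (ω.1 i') (ω.2.1 j')).support)) ≤ (C / n ^ 2) ^ 2 := by
    intro i i' j j' hi hj x y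
    have e0 : ∀ x, ∑ v, ν v * (∑ u, ν u * P x u v) = (∑ k, w k * load G (σ k) x) / n ^ 2 := by
      intro x
      simp only [ν, P, load, Finset.mul_sum, Finset.sum_div]
      rw [Finset.sum_comm]
      rw [Finset.sum_congr rfl (fun u _ => Finset.sum_comm)]
      rw [Finset.sum_comm]
      refine Finset.sum_congr rfl fun k _ => Finset.sum_congr rfl fun u _ =>
        Finset.sum_congr rfl fun v _ => ?_
      field_simp
    have e1 : ∑ ω, Wt ω * (ind (x ∈ (σ (ω.2.2 (i, j)) (ω.1 i) (ω.2.1 j)).support) *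
        ind (y ∈ (σ (ω.2.2 (i', j')) (ω.1 i') (ω.2.1 j')).support)) =
        (∑ v, ν v * (∑ u, ν u * P x u v)) * (∑ v, ν v * (∑ u, ν u * P y u v)) := by
      rw [← marg ν hν hj (fun v => ∑ u, ν u * P x u v) (fun v => ∑ u, ν u * P y u v)]
      rw [Fintype.sum_prod_type, ]
      simp only [Fintype.sum_prod_type]
      rw [Finset.sum_comm]
      refine Finset.sum_congr rfl fun q _ => ?_
      rw [← marg ν hν hi (fun u => P x u (q j)) (fun u => P y u (q j')), Finset.mul_sum]
      refine Finset.sum_congr rfl fun p _ => ?_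
      have : ((i, j) : Fin 3 × Fin 3) ≠ (i', j') := fun h => hi (Prod.ext_iff.1 h).1
      rw [← marg w hw this (fun k => ind (x ∈ (σ k (p i) (q j)).support))
        (fun k => ind (y ∈ (σ k (p i') (q j')).support)), Finset.mul_sum, Finset.mul_sum]
      refine Finset.sum_congr rfl fun k _ => ?_
      simp only [Wt]; ring
    rw [e1, e0, e0, pow_two (C / n ^ 2)]
    have hnn : ∀ x, 0 ≤ ∑ k, w k * load G (σ k) x := fun x => Finset.sum_nonneg fun k _ =>
      mul_nonneg (hw0 k) (Finset.sum_nonneg fun _ _ => Finset.sum_nonneg fun _ _ => ind_nonneg _)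
    exact mul_le_mul (by gcongr; exact hl x) (by gcongr; exact hl y)
      (div_nonneg (hnn _) (by positivity)) (by positivity)
  clear_value Wt
  obtain ⟨T, hTm, hT⟩ : ∃ T : Finset ((Fin 3 × Fin 3) × (Fin 3 × Fin 3)),
      (∀ t, t ∈ T ↔ t.1.1 ≠ t.1.2 ∧ t.2.1 ≠ t.2.2) ∧ T.card = 36 :=
    ⟨univ.filter (fun t => t.1.1 ≠ t.1.2 ∧ t.2.1 ≠ t.2.2), fun t => by simp, by decide⟩
  obtain ⟨D, hDm, hD⟩ : ∃ D : Finset (V × V), (∀ t, t ∈ D ↔ R t.1 t.2) ∧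
      D.card = ∑ x, cnt univ (R x) :=
    ⟨univ.filter (fun t => R t.1 t.2), fun t => by simp, by
      simp only [cnt_eq_sum, Finset.card_filter, Fintype.sum_prod_type]⟩
  obtain ⟨F, hF⟩ : ∃ F : ((Fin 3 → V) × (Fin 3 → V) × (Fin 3 × Fin 3 → K)) →
      ((Fin 3 × Fin 3) × (Fin 3 × Fin 3)) → (V × V) → ℝ, ∀ ω t d, F ω t d =
          (ind (d.1 ∈ (σ (ω.2.2 (t.1.1, t.2.1)) (ω.1 t.1.1) (ω.2.1 t.2.1)).support) *
          ind (d.2 ∈ (σ (ω.2.2 (t.1.2, t.2.2)) (ω.1 t.1.2) (ω.2.1 t.2.2)).support)) :=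
    ⟨_, fun _ _ _ => rfl⟩
  have hF0 : ∀ ω t d, 0 ≤ F ω t d := fun ω t d => by
    rw [hF]; exact mul_nonneg (ind_nonneg _) (ind_nonneg _)
  have hF1 : ∀ ω, 1 ≤ ∑ t ∈ T, ∑ d ∈ D, F ω t d := by
    intro ω
    obtain ⟨i, i', j, j', hi, hj, x, hx, y, hy, hxy⟩ :=
      hNK ω.1 ω.2.1 (fun i j => σ (ω.2.2 (i, j)) (ω.1 i) (ω.2.1 j))
    have ht : ((i, i'), (j, j')) ∈ T := (hTm _).2 ⟨hi, hj⟩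
    have hd : (x, y) ∈ D := (hDm _).2 hxy
    refine le_dsum (F ω) (hF0 ω) ht hd ?_
    rw [hF]
    rw [ind_pos hx, ind_pos hy]; norm_num
  have hF2 : ∀ t ∈ T, ∀ d, ∑ ω, Wt ω * F ω t d ≤ (C / n ^ 2) ^ 2 := by
    intro t ht d
    have := (hTm t).1 ht
    simp only [hF]
    exact key _ _ _ _ this.1 this.2 _ _
  clear key hNK
  have hf : 1 ≤ ∑ t ∈ T, ∑ d ∈ D, (C / n ^ 2) ^ 2 := by
    calc (1 : ℝ) = ∑ ω, Wt ω := hWt1.symm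
      _ ≤ ∑ ω, Wt ω * (∑ t ∈ T, ∑ d ∈ D, F ω t d) :=
        Finset.sum_le_sum fun ω _ => le_mul_of_one_le_right (hWt0 ω) (hF1 ω)
      _ = ∑ t ∈ T, ∑ d ∈ D, ∑ ω, Wt ω * F ω t d := by
        simp only [Finset.mul_sum]
        rw [Finset.sum_comm]
        refine Finset.sum_congr rfl fun t _ => Finset.sum_comm
      _ ≤ _ := Finset.sum_le_sum fun t ht => Finset.sum_le_sum fun d _ => hF2 t ht d
  simp only [Finset.sum_const, hT, hD, nsmul_eq_mul] at hf
  have : (C / n ^ 2) ^ 2 = C ^ 2 / n ^ 4 := by field_simp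
  rw [this] at hf
  have h4 : 0 < n ^ 4 := by positivity
  have e : ((36 : ℕ) : ℝ) * (((∑ x, cnt univ (R x) : ℕ) : ℝ) * (C ^ 2 / n ^ 4)) =
    (36 * ((∑ x, cnt univ (R x) : ℕ) : ℝ) * C ^ 2) / n ^ 4 := by push_cast; ring
  rw [e, le_div_iff₀ h4, one_mul] at hf
  exact hf

/-- weights from duality -/
theorem weight_lemma [Nonempty V] (G : SimpleGraph V) (hG : ∀ u v, Nonempty (G.Walk u v))
    (R : V → V → Prop) (hNK : NK G R)
    (C : ℝ) (hC : 0 < C)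
    (hCM : 36 * ((∑ x, cnt univ (R x) : ℕ) : ℝ) * C ^ 2 < (Fintype.card V : ℝ) ^ 4) :
    ∃ s : V → ℝ, (∀ x, 0 ≤ s x) ∧ 0 < ∑ x, s x ∧
      ∀ σ : ∀ u v, G.Walk u v, C * ∑ x, s x ≤ ∑ x, s x * load G σ x := by
  classical
  let O : Set (V → ℝ) := {y | ∀ x, y x < C}
  have hO1 : Convex ℝ O := by
    have : O = ⋂ x, {y : V → ℝ | y x < C} := by ext; simp [O]
    rw [this]
    refine convex_iInter fun x => ?_
    exact convex_halfSpace_lt (f := fun y : V → ℝ => y x) ⟨fun _ _ => rfl, fun _ _ => rfl⟩ C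
  have hO2 : IsOpen O := by
    have : O = ⋂ x, {y : V → ℝ | y x < C} := by ext; simp [O]
    rw [this]
    exact isOpen_iInter_of_finite fun x => isOpen_lt (continuous_apply x) continuous_const
  let H : Set (V → ℝ) := convexHull ℝ (Set.range fun σ : (∀ u v, G.Walk u v) => load G σ)
  have disj : Disjoint O H := by
    rw [Set.disjoint_left]
    intro y hy hyH
    obtain ⟨K, _, w, z, hw0, hw1, hz, hzy⟩ := mem_convexHull_iff_exists_fintype.1 hyH
    choose σ hσ using hz
    have := load_lemma G R hNK w hw0 hw1 σ C hC.le (by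
      intro x
      have := congrFun hzy x
      simp only [Finset.sum_apply, Pi.smul_apply, smul_eq_mul] at this
      simp only [← hσ] at this
      rw [this]; exact (hy x).le)
    linarith
  obtain ⟨f, u, h1, h2⟩ := geometric_hahn_banach_open hO1 hO2 (convex_convexHull ℝ _) disj
  let s : V → ℝ := fun x => f (Pi.single x 1)
  have fs : ∀ y, f y = ∑ x, s x * y x := by
    intro y
    have : y = ∑ x, y x • (Pi.single x (1:ℝ) : V → ℝ) := by
      ext i; simp [Finset.sum_apply, Pi.single_apply]
    conv_lhs => rw [this]
    simp [map_sum, s, mul_comm]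
  have h0 : ∀ x, 0 ≤ s x := by
    intro x
    by_contra hneg
    push Not at hneg
    have hu : 0 < u := by
      have := h1 0 (fun x => hC); simpa using this
    have := h1 ((u / s x) • (Pi.single x (1:ℝ) : V → ℝ)) (by
      intro i
      simp only [Pi.smul_apply, Pi.single_apply, smul_eq_mul]
      have : u / s x < 0 := div_neg_of_pos_of_neg hu hneg
      split_ifs <;> nlinarith)
    rw [map_smul, smul_eq_mul] at this
    change u / s x * s x < u at this
    rw [div_mul_cancel₀ _ hneg.ne] at this
    exact lt_irrefl _ this
  have hCs : C * ∑ x, s x ≤ u := by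
    by_contra hlt
    push Not at hlt
    have hu : 0 < u := by
      have := h1 0 (fun x => hC); simpa using this
    have hS : 0 < ∑ x, s x := by
      by_contra h; push Not at h; nlinarith
    have := h1 (fun _ => u / ∑ x, s x) (by
      intro x; rw [div_lt_iff₀ hS]; exact hlt)
    rw [fs, ← Finset.sum_mul] at this
    rw [mul_div_cancel₀ _ hS.ne'] at this
    exact lt_irrefl _ this
  have hle : ∀ σ : ∀ u v, G.Walk u v, u ≤ ∑ x, s x * load G σ x := by
    intro σ
    rw [← fs]; exact h2 _ (subset_convexHull ℝ _ ⟨σ, rfl⟩)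
  refine ⟨s, h0, ?_, fun σ => hCs.trans (hle σ)⟩
  have hu : 0 < u := by
    have := h1 0 (fun x => hC); simpa using this
  by_contra h
  have h' : ∑ x, s x = 0 := le_antisymm (not_lt.1 h) (Finset.sum_nonneg fun x _ => h0 x)
  have hz : ∀ x, s x = 0 := fun x => (Finset.sum_eq_zero_iff_of_nonneg (fun x _ => h0 x)).1 h' x (mem_univ x)
  have σ : ∀ u v, G.Walk u v := fun u v => (hG u v).some
  have := hle σ
  simp [hz] at this
  linarith

/-- integer weights -/
theorem int_weight_lemma [Nonempty V] (G : SimpleGraph V) (hG : ∀ u v, Nonempty (G.Walk u v))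
    (R : V → V → Prop) (hNK : NK G R)
    (C : ℝ) (hC : 0 < C)
    (hCM : 36 * ((∑ x, cnt univ (R x) : ℕ) : ℝ) * C ^ 2 < (Fintype.card V : ℝ) ^ 4) :
    ∃ a : V → ℕ, (∀ x, 1 ≤ a x) ∧ ∑ x, a x ≤ 2 * Fintype.card V ∧
      ∀ σ : ∀ u v, G.Walk u v, C * Fintype.card V ≤ ∑ x, a x * load G σ x := by
  obtain ⟨s, hs0, hs1, hs⟩ := weight_lemma G hG R hNK C hC hCM
  set S := ∑ x, s x with hS
  set n : ℝ := (Fintype.card V : ℝ) with hn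
  have hnn : 0 ≤ n := by rw [hn]; positivity
  refine ⟨fun x => ⌊n * s x / S⌋₊ + 1, fun x => Nat.le_add_left _ _, ?_, ?_⟩
  · rw [Finset.sum_add_distrib]
    have : ((∑ x, ⌊n * s x / S⌋₊ : ℕ) : ℝ) ≤ n := by
      push_cast
      calc ∑ x, (⌊n * s x / S⌋₊ : ℝ) ≤ ∑ x, n * s x / S :=
            Finset.sum_le_sum fun x _ => Nat.floor_le (div_nonneg (mul_nonneg hnn (hs0 x)) hs1.le)
        _ = n := by rw [← Finset.sum_div, ← Finset.mul_sum, ← hS]; field_simp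
    rw [hn] at this
    have : ∑ x, ⌊n * s x / S⌋₊ ≤ Fintype.card V := by exact_mod_cast this
    simp; omega
  · intro σ
    have h := hs σ
    calc C * n = (C * S) * (n / S) := by field_simp
      _ ≤ (∑ x, s x * load G σ x) * (n / S) := mul_le_mul_of_nonneg_right h (by positivity)
      _ = ∑ x, (n * s x / S) * load G σ x := by
        rw [Finset.sum_mul]; refine Finset.sum_congr rfl fun x _ => by ring
      _ ≤ _ := by
        refine Finset.sum_le_sum fun x _ => mul_le_mul_of_nonneg_right ?_
          (Finset.sum_nonneg fun _ _ => Finset.sum_nonneg fun _ _ => ind_nonneg _)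
        push_cast
        exact (Nat.lt_floor_add_one _).le
end load
end QP

namespace QP

set_option linter.all false
open Finset Set

section ball
variable {V : Type*} [Fintype V]

/-- reachable at entry cost at most `r`. -/
inductive Rc (G : SimpleGraph V) (a : V → ℕ) (U : Set V) (z : V) : ℕ → V → Prop
  | base : z ∈ U → Rc G a U z 0 z
  | step {r : ℕ} {v w : V} : Rc G a U z r v → G.Adj v w → w ∈ U → Rc G a U z (r + a v) w
  | mono {r r' : ℕ} {v : V} : Rc G a U z r v → r ≤ r' → Rc G a U z r' v

variable {G : SimpleGraph V} {a : V → ℕ} {U : Set V} {z : V}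

theorem Rc.mem {r : ℕ} {v : V} (h : Rc G a U z r v) : v ∈ U := by
  induction h with
  | base h => exact h
  | step _ _ h _ => exact h
  | mono _ _ h => exact h

theorem Rc.univ {r : ℕ} {v : V} (h : Rc G a U z r v) : Rc G a Set.univ z r v := by
  induction h with
  | base h => exact .base trivial
  | step _ h1 h2 ih => exact .step ih h1 trivial
  | mono _ h ih => exact .mono ih h

theorem Rc.trans {r s : ℕ} {v w : V} (h : Rc G a U z r v) (h' : Rc G a U v s w) :
    Rc G a U z (r + s) w := by
  induction h' with
  | base _ => exact h
  | step _ h1 h2 ih => rw [← add_assoc]; exact .step ih h1 h2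
  | mono _ h ih => exact .mono ih (by omega)

theorem Rc.symm {r : ℕ} {v : V} (h : Rc G a U z r v) : ∃ s, Rc G a U v s z ∧ s + a z ≤ r + a v := by
  induction h with
  | base h => exact ⟨0, .base h, by omega⟩
  | @step r v w hv hvw hw ih =>
    obtain ⟨s, h1, h2⟩ := ih
    have h3 : Rc G a U w (0 + a w) v := .step (.base hw) hvw.symm hv.mem
    exact ⟨_, h3.trans h1, by omega⟩
  | mono _ h ih =>
    obtain ⟨s, h1, h2⟩ := ih
    exact ⟨s, h1, by omega⟩

theorem Rc.walk {r : ℕ} {v : V} (h : Rc G a U z r v) :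
    ∃ W : G.Walk z v, (W.support.map a).sum ≤ r + a v := by
  induction h with
  | base h => exact ⟨.nil, by simp⟩
  | @step r v w _ h1 h2 ih =>
    obtain ⟨W, hW⟩ := ih
    refine ⟨W.concat h1, ?_⟩
    rw [SimpleGraph.Walk.support_concat]
    simp; omega
  | mono _ h ih => obtain ⟨W, hW⟩ := ih; exact ⟨W, by omega⟩

theorem Rc.of_walk {v : V} (W : G.Walk z v) : ∃ r, Rc G a Set.univ z r v := by
  induction W with
  | nil => exact ⟨0, .base trivial⟩
  | cons h p ih =>
    obtain ⟨r, hr⟩ := ih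
    exact ⟨_, (Rc.step (U := Set.univ) (.base trivial) h trivial).trans hr⟩

variable (G a U z)
noncomputable def En (r : ℕ) : Finset V := flt univ (fun v => Rc G a U z r v)
noncomputable def Bl (r : ℕ) : Finset V := flt univ (fun v => ∃ s, Rc G a U z s v ∧ s + a v ≤ r)
open Classical in
noncomputable def Sh (r : ℕ) : Finset V := En G a U z r \ Bl G a U z r
variable {G a U z}

theorem mem_En {r : ℕ} {v : V} : v ∈ En G a U z r ↔ Rc G a U z r v := by simp [En, mem_flt]
theorem mem_Bl {r : ℕ} {v : V} : v ∈ Bl G a U z r ↔ ∃ s, Rc G a U z s v ∧ s + a v ≤ r := by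
  simp [Bl, mem_flt]
theorem mem_Sh {r : ℕ} {v : V} : v ∈ Sh G a U z r ↔ v ∈ En G a U z r ∧ v ∉ Bl G a U z r := by
  classical simp [Sh]
theorem Bl_sub_En (r : ℕ) : Bl G a U z r ⊆ En G a U z r := by
  intro v hv
  obtain ⟨s, h1, h2⟩ := mem_Bl.1 hv
  exact mem_En.2 (h1.mono (by omega))
theorem Bl_mono {r r' : ℕ} (h : r ≤ r') : Bl G a U z r ⊆ Bl G a U z r' := by
  intro v hv
  obtain ⟨s, h1, h2⟩ := mem_Bl.1 hv
  exact mem_Bl.2 ⟨s, h1, by omega⟩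
theorem En_mono {r r' : ℕ} (h : r ≤ r') : En G a U z r ⊆ En G a U z r' := by
  intro v hv
  exact mem_En.2 ((mem_En.1 hv).mono h)
theorem Bl_adj {r : ℕ} {v w : V} (hv : v ∈ Bl G a U z r) (h : G.Adj v w) (hw : w ∈ U) :
    w ∈ En G a U z r := by
  obtain ⟨s, h1, h2⟩ := mem_Bl.1 hv
  exact mem_En.2 ((h1.step h hw).mono h2)

theorem shell_count (N : ℕ) (v : V) : cnt (Finset.range N) (fun r => v ∈ Sh G a U z r) ≤ a v := by
  classical
  by_cases h : ∃ e, Rc G a U z e v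
  · have he := Nat.find_spec h
    have : flt (Finset.range N) (fun r => v ∈ Sh G a U z r) ⊆
        Finset.Ico (Nat.find h) (Nat.find h + a v) := by
      intro r hr
      obtain ⟨h1, h2⟩ := mem_Sh.1 (mem_flt.1 hr).2
      rw [Finset.mem_Ico]
      refine ⟨Nat.find_min' h (mem_En.1 h1), ?_⟩
      by_contra h3
      exact h2 (mem_Bl.2 ⟨_, he, by omega⟩)
    have := Finset.card_le_card this
    simpa [cnt] using this
  · have : flt (Finset.range N) (fun r => v ∈ Sh G a U z r) = ∅ := by
      rw [Finset.eq_empty_iff_forall_notMem]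
      intro r hr
      exact h ⟨r, mem_En.1 (mem_Sh.1 (mem_flt.1 hr).2).1⟩
    simp [cnt, this]

theorem sum_shell_le (N : ℕ) (T : Finset V) (hT : ∀ r < N, Sh G a U z r ⊆ T) :
    ∑ r ∈ Finset.range N, (Sh G a U z r).card ≤ ∑ v ∈ T, a v := by
  have h1 : ∀ r ∈ Finset.range N, (Sh G a U z r).card ≤ cnt T (fun v => v ∈ Sh G a U z r) := by
    intro r hr
    refine Finset.card_le_card ?_
    intro v hv
    exact mem_flt.2 ⟨hT r (Finset.mem_range.1 hr) hv, hv⟩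
  refine (Finset.sum_le_sum h1).trans ?_
  rw [cnt_comm]
  exact Finset.sum_le_sum fun v _ => shell_count N v

theorem growth (ha : ∀ v, 1 ≤ a v) (hz : z ∈ U) (hA : ∑ v, a v ≤ 2 * Fintype.card V) {q L : ℕ}
    (hq : 1 ≤ q) (hL : 3 * Fintype.card V < 2 ^ L) :
    ∃ r, r ≤ L * q ∧ q * (Sh G a U z r).card ≤ (Bl G a U z r).card + ∑ v ∈ En G a U z r, a v := by
  classical
  by_contra hcon
  push Not at hcon
  let Φ : ℕ → ℕ := fun r => (Bl G a U z r).card + ∑ r' ∈ Finset.range r, (Sh G a U z r').card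
  have hΦle : ∀ r, Φ r ≤ (Bl G a U z r).card + ∑ v ∈ En G a U z r, a v := by
    intro r
    refine Nat.add_le_add_left (sum_shell_le r _ ?_) _
    intro r' hr' v hv
    exact En_mono hr'.le (mem_Sh.1 hv).1
  have hΦs : ∀ r, Φ r + (Sh G a U z r).card ≤ Φ (r + 1) := by
    intro r
    simp only [Φ, Finset.sum_range_succ]
    have := Finset.card_le_card (Bl_mono (G := G) (a := a) (U := U) (z := z) (Nat.le_succ r))
    simp only [Nat.succ_eq_add_one] at this
    omega
  have hΦ1 : 1 ≤ Φ 1 := by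
    have : z ∈ Sh G a U z 0 := by
      rw [mem_Sh]
      refine ⟨mem_En.2 (.base hz), fun h => ?_⟩
      obtain ⟨s, _, h2⟩ := mem_Bl.1 h
      have := ha z; omega
    have h2 := hΦs 0
    have h3 := Finset.card_pos.2 ⟨z, this⟩
    have h4 : Φ (0 + 1) = Φ 1 := rfl
    omega
  have hstep : ∀ k, k ≤ L * q → ((1 : ℝ) + 1 / q) ^ k ≤ (Φ (1 + k) : ℝ) := by
    intro k
    induction k with
    | zero => intro _; simpa using hΦ1
    | succ k ih =>
      intro hk
      have h1 := ih (by omega)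
      have h2 := hcon (1 + k) (by omega)
      have h3 := hΦle (1 + k)
      have h4 := hΦs (1 + k)
      have h5 : (Φ (1 + k) : ℝ) ≤ q * (Sh G a U z (1 + k)).card := by exact_mod_cast (h3.trans h2.le)
      have h6 : (Φ (1 + k) : ℝ) + (Sh G a U z (1 + k)).card ≤ Φ (1 + (k + 1)) := by exact_mod_cast h4
      have hq0 : (0 : ℝ) < q := by exact_mod_cast hq
      rw [pow_succ]
      have h7 : (Φ (1 + k) : ℝ) / q ≤ (Sh G a U z (1 + k)).card := by
        rw [div_le_iff₀ hq0]; linarith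
      calc _ ≤ (Φ (1 + k) : ℝ) * (1 + 1 / q) := by gcongr
        _ = (Φ (1 + k) : ℝ) + (Φ (1 + k) : ℝ) / q := by ring
        _ ≤ _ := by linarith
  have h1 := hstep (L * q) le_rfl
  have h2 : (2 : ℝ) ≤ (1 + 1 / q) ^ q := by
    have hq0 : (0 : ℝ) < q := by exact_mod_cast hq
    have := one_add_mul_le_pow (a := (1 : ℝ) / q) (by have : (0:ℝ) ≤ 1 / q := by positivity
                                                      linarith) q
    have e : (q : ℝ) * (1 / q) = 1 := by field_simp
    linarith
  have h3 : (2 : ℝ) ^ L ≤ ((1 : ℝ) + 1 / q) ^ (L * q) := by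
    rw [mul_comm, pow_mul]; gcongr
  have h4 : Φ (1 + L * q) ≤ 3 * Fintype.card V := by
    refine (hΦle _).trans ?_
    have := Finset.card_le_univ (Bl G a U z (1 + L * q))
    have h5 : ∑ v ∈ En G a U z (1 + L * q), a v ≤ ∑ v, a v :=
      Finset.sum_le_sum_of_subset (Finset.subset_univ _)
    omega
  have h5 : (Φ (1 + L * q) : ℝ) < 2 ^ L := by exact_mod_cast (lt_of_le_of_lt h4 hL)
  linarith

/-- separation -/
def Sepd (G : SimpleGraph V) (q : ℕ) : Prop := ∃ X Y : Finset V, X.Nonempty ∧ Y.Nonempty ∧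
  Disjoint X Y ∧ (∀ x ∈ X, ∀ y ∈ Y, ¬ G.Adj x y) ∧
  q * (Fintype.card V - X.card - Y.card) ≤ X.card ∧ q * (Fintype.card V - X.card - Y.card) ≤ Y.card

theorem case2 (ha : ∀ v, 1 ≤ a v) (hA : ∑ v, a v ≤ 2 * Fintype.card V) {q L : ℕ}
    (hq : 1 ≤ q) (hL : 3 * Fintype.card V < 2 ^ L) (hn : 0 < Fintype.card V)
    (hB : ∀ z, 4 * (Bl G a Set.univ z (L * (12 * q))).card < Fintype.card V) : Sepd G q := by
  classical
  let P : Finset (Finset V × Finset V) := univ.filter (fun t => Disjoint t.1 t.2 ∧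
    (∀ v ∈ t.1, ∀ w, G.Adj v w → w ∈ t.1 ∪ t.2) ∧
    12 * q * t.2.card ≤ t.1.card + ∑ v ∈ t.1 ∪ t.2, a v ∧ 2 * t.1.card ≤ Fintype.card V)
  have hP : P.Nonempty := ⟨(∅, ∅), by simp [P]⟩
  obtain ⟨⟨A, S⟩, hAS, hmax⟩ := Finset.exists_max_image P (fun t => t.1.card + t.2.card) hP
  obtain ⟨hd, hN, hS, hA2⟩ := (Finset.mem_filter.1 hAS).2
  simp only at hd hN hS hA2 hmax
  have hsum : ∑ v ∈ A ∪ S, a v ≤ ∑ v, a v := Finset.sum_le_sum_of_subset (Finset.subset_univ _)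
  have hAn := Finset.card_le_univ A
  have hS3 : 12 * q * S.card ≤ 3 * Fintype.card V := by omega
  have hS4 : 4 * S.card ≤ Fintype.card V := by nlinarith
  have hcard : (A ∪ S).card = A.card + S.card := Finset.card_union_of_disjoint hd
  have hA4 : Fintype.card V ≤ 4 * A.card := by
    by_contra hlt
    push Not at hlt
    obtain ⟨z, hz⟩ : ∃ z, z ∉ A ∪ S := by
      by_contra h
      push Not at h
      have : A ∪ S = Finset.univ := Finset.eq_univ_iff_forall.2 h
      have := congrArg Finset.card this
      rw [Finset.card_univ, hcard] at this
      omega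
    let U : Set V := {v | v ∉ A ∪ S}
    obtain ⟨r, hr, hg⟩ := growth (G := G) (U := U) (z := z) (q := 12 * q) (L := L) ha hz hA (by omega) hL
    set B := Bl G a U z r with hBdef
    set S' := Sh G a U z r with hSdef
    have hEn : B ∪ S' = En G a U z r := by
      ext v
      simp only [Finset.mem_union, hSdef, mem_Sh]
      constructor
      · rintro (h | h)
        · exact Bl_sub_En _ h
        · exact h.1
      · intro h; by_cases h' : v ∈ B
        · exact Or.inl h'
        · exact Or.inr ⟨h, h'⟩
    have hEU : ∀ v ∈ B ∪ S', v ∉ A ∪ S := by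
      intro v hv; rw [hEn] at hv
      exact (mem_En.1 hv).mem
    have hBc : 4 * B.card < Fintype.card V := by
      refine lt_of_le_of_lt ?_ (hB z)
      refine Nat.mul_le_mul_left _ (Finset.card_le_card ?_)
      intro v hv
      obtain ⟨s, h1, h2⟩ := mem_Bl.1 hv
      exact mem_Bl.2 ⟨s, h1.univ, by omega⟩
    have hBS' : Disjoint B S' := by
      rw [Finset.disjoint_left]; intro v h1 h2; exact (mem_Sh.1 h2).2 h1
    have dAB : Disjoint A B := by
      rw [Finset.disjoint_left]; intro v h1 h2
      exact hEU v (Finset.mem_union_left _ h2) (Finset.mem_union_left _ h1)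
    have dSS : Disjoint S S' := by
      rw [Finset.disjoint_left]; intro v h1 h2
      exact hEU v (Finset.mem_union_right _ h2) (Finset.mem_union_right _ h1)
    have hnew : (A ∪ B, S ∪ S') ∈ P := by
      rw [Finset.mem_filter]
      refine ⟨mem_univ _, ?_, ?_, ?_, ?_⟩
      · simp only
        rw [Finset.disjoint_left]
        intro v h1 h2
        rcases Finset.mem_union.1 h1 with h1 | h1 <;> rcases Finset.mem_union.1 h2 with h2 | h2
        · exact Finset.disjoint_left.1 hd h1 h2
        · exact hEU v (Finset.mem_union_right _ h2) (Finset.mem_union_left _ h1)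
        · exact hEU v (Finset.mem_union_left _ h1) (Finset.mem_union_right _ h2)
        · exact Finset.disjoint_left.1 hBS' h1 h2
      · simp only
        intro v hv w hvw
        rcases Finset.mem_union.1 hv with h1 | h1
        · rcases Finset.mem_union.1 (hN v h1 w hvw) with h | h <;> simp [h]
        · by_cases hw : w ∈ A ∪ S
          · rcases Finset.mem_union.1 hw with h | h <;> simp [h]
          · have : w ∈ B ∪ S' := by
              rw [hEn]; exact Bl_adj h1 hvw hw
            rcases Finset.mem_union.1 this with h | h <;> simp [h]
      · simp only
        have e : (A ∪ B) ∪ (S ∪ S') = (A ∪ S) ∪ (B ∪ S') := by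
          ext v; simp only [Finset.mem_union]; tauto
        rw [e, Finset.sum_union, Finset.card_union_of_disjoint dAB, Finset.card_union_of_disjoint dSS]
        · rw [hEn, Nat.mul_add]; omega
        · rw [Finset.disjoint_left]; intro v h1 h2; exact hEU v h2 h1
      · simp only
        rw [Finset.card_union_of_disjoint dAB]; omega
    have := hmax _ hnew
    simp only at this
    rw [Finset.card_union_of_disjoint dAB, Finset.card_union_of_disjoint dSS] at this
    have hz' : z ∈ B ∪ S' := by
      rw [hEn]; exact mem_En.2 (.mono (.base hz) (Nat.zero_le _))
    have := Finset.card_pos.2 ⟨z, hz'⟩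
    rw [Finset.card_union_of_disjoint hBS'] at this
    omega
  refine ⟨A, (A ∪ S)ᶜ, ?_, ?_, ?_, ?_, ?_, ?_⟩
  · apply Finset.card_pos.1; omega
  · apply Finset.card_pos.1; rw [Finset.card_compl]; omega
  · rw [Finset.disjoint_left]; intro v h1 h2
    exact (Finset.mem_compl.1 h2) (Finset.mem_union_left _ h1)
  · intro x hx y hy hxy
    exact (Finset.mem_compl.1 hy) (hN x hx y hxy)
  all_goals
    have h1 : Fintype.card V - A.card - ((A ∪ S)ᶜ : Finset V).card = S.card := by
      rw [Finset.card_compl]; omega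
    rw [h1]
  · nlinarith
  · rw [Finset.card_compl]
    have : 4 * (q * S.card) ≤ Fintype.card V := by nlinarith
    omega

variable (G a) in
/-- entry distance -/
noncomputable def ed (u v : V) : ℕ := sInf {r | Rc G a Set.univ u r v}

theorem ed_spec (hG : ∀ u v, Nonempty (G.Walk u v)) (u v : V) : Rc G a Set.univ u (ed G a u v) v := by
  have : {r | Rc G a Set.univ u r v}.Nonempty := Rc.of_walk (hG u v).some
  exact Nat.sInf_mem this
theorem ed_le {u v : V} {r : ℕ} (h : Rc G a Set.univ u r v) : ed G a u v ≤ r := Nat.sInf_le h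

theorem case1 (ha : ∀ v, 1 ≤ a v) (hA : ∑ v, a v ≤ 2 * Fintype.card V) {q R : ℕ}
    (hq : 1 ≤ q) (hn : 0 < Fintype.card V)
    (hB : Fintype.card V ≤ 4 * (Bl G a Set.univ z R).card)
    (hE : (R + 8 * q) * Fintype.card V < ∑ v, ed G a z v) : Sepd G q := by
  classical
  obtain ⟨r, hr, hT, hK⟩ : ∃ r, R ≤ r ∧ ((Bl G a Set.univ z r)ᶜ : Finset V).Nonempty ∧
      4 * q * (Sh G a Set.univ z r).card < ((Bl G a Set.univ z r)ᶜ : Finset V).card := by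
    by_contra hcon
    push Not at hcon
    obtain ⟨N, hN⟩ : ∃ N, ∀ v, ed G a z v ≤ N := ⟨∑ v, ed G a z v, fun v =>
      Finset.single_le_sum (f := fun v => ed G a z v) (fun _ _ => Nat.zero_le _) (Finset.mem_univ v)⟩
    have h1 : ∑ v, ed G a z v ≤ ∑ r ∈ Finset.range N, ((Bl G a Set.univ z r)ᶜ : Finset V).card := by
      have e1 : ∀ r ∈ Finset.range N, ((Bl G a Set.univ z r)ᶜ : Finset V).card =
          cnt Finset.univ (fun v => v ∉ Bl G a Set.univ z r) := by
        intro r _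
        unfold cnt; congr 1; ext v; simp [mem_flt]
      rw [Finset.sum_congr rfl e1, cnt_comm]
      refine Finset.sum_le_sum fun v _ => ?_
      have : Finset.range (ed G a z v) ⊆ flt (Finset.range N) (fun r => v ∉ Bl G a Set.univ z r) := by
        intro r hr
        rw [Finset.mem_range] at hr
        refine mem_flt.2 ⟨Finset.mem_range.2 (by have := hN v; omega), fun h => ?_⟩
        obtain ⟨s, h1, h2⟩ := mem_Bl.1 h
        have := ed_le h1
        omega
      have := Finset.card_le_card this
      simpa [cnt] using this
    have h2 : ∀ r ∈ Finset.range N, ((Bl G a Set.univ z r)ᶜ : Finset V).card ≤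
        (if r ∈ Finset.range R then Fintype.card V else 0) + 4 * q * (Sh G a Set.univ z r).card := by
      intro r _
      by_cases hr : r < R
      · simp only [Finset.mem_range, hr, if_true]
        have := Finset.card_le_univ ((Bl G a Set.univ z r)ᶜ : Finset V)
        omega
      · by_cases hne : ((Bl G a Set.univ z r)ᶜ : Finset V).Nonempty
        · have := hcon r (by omega) hne
          omega
        · rw [Finset.not_nonempty_iff_eq_empty] at hne
          rw [hne]; simp
    have h3 := h1.trans (Finset.sum_le_sum h2)
    rw [Finset.sum_add_distrib, ← Finset.mul_sum, ← Finset.sum_filter, Finset.sum_const] at h3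
    have h4 : ((Finset.range N).filter (fun r => r ∈ Finset.range R)).card ≤ R := by
      calc _ ≤ (Finset.range R).card := Finset.card_le_card (fun x hx => (Finset.mem_filter.1 hx).2)
        _ = R := Finset.card_range R
    have h5 := sum_shell_le (G := G) (a := a) (U := Set.univ) (z := z) N Finset.univ
      (fun r _ => Finset.subset_univ _)
    have h6 : ∑ r ∈ Finset.range N, (Sh G a Set.univ z r).card ≤ 2 * Fintype.card V := h5.trans hA
    have h7 := Nat.mul_le_mul_left (4 * q) h6
    have h8 := Nat.mul_le_mul_right (Fintype.card V) h4
    rw [smul_eq_mul] at h3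
    have : (R + 8 * q) * Fintype.card V = R * Fintype.card V + 4 * q * (2 * Fintype.card V) := by ring
    omega
  have hBr := Finset.card_le_card (Bl_mono (G := G) (a := a) (U := Set.univ) (z := z) hr)
  have hdis : Disjoint (Bl G a Set.univ z r) (Sh G a Set.univ z r) := by
    rw [Finset.disjoint_left]; intro v h1 h2; exact (mem_Sh.1 h2).2 h1
  have hEn : Bl G a Set.univ z r ∪ Sh G a Set.univ z r = En G a Set.univ z r := by
    unfold Sh; exact Finset.union_sdiff_of_subset (Bl_sub_En r)
  have hc := congrArg Finset.card hEn
  rw [Finset.card_union_of_disjoint hdis] at hc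
  have hle := Finset.card_le_univ (En G a Set.univ z r)
  rw [Finset.card_compl] at hK
  have hS1 : 4 * (q * (Sh G a Set.univ z r).card) < Fintype.card V - (Bl G a Set.univ z r).card := by
    rw [← mul_assoc]; exact hK
  have hS2 : (Sh G a Set.univ z r).card ≤ q * (Sh G a Set.univ z r).card := Nat.le_mul_of_pos_left _ hq
  refine ⟨Bl G a Set.univ z r, (En G a Set.univ z r)ᶜ, ?_, ?_, ?_, ?_, ?_, ?_⟩
  · apply Finset.card_pos.1; omega
  · apply Finset.card_pos.1; rw [Finset.card_compl]; omega
  · rw [Finset.disjoint_left]; intro v h1 h2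
    exact (Finset.mem_compl.1 h2) (Bl_sub_En r h1)
  · intro x hx y hy hxy
    exact (Finset.mem_compl.1 hy) (Bl_adj hx hxy trivial)
  all_goals
    have h1 : Fintype.card V - (Bl G a Set.univ z r).card - ((En G a Set.univ z r)ᶜ : Finset V).card =
        (Sh G a Set.univ z r).card := by
      rw [Finset.card_compl]; omega
    rw [h1]
  · omega
  · rw [Finset.card_compl]; omega

theorem sum_load (σ : ∀ u v, G.Walk u v) (f : V → V → ℕ)
    (h : ∀ u v, ((σ u v).support.map a).sum ≤ f u v) :
    ∑ x, (a x : ℝ) * load G σ x ≤ ((∑ u, ∑ v, f u v : ℕ) : ℝ) := by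
  classical
  have e1 : ∑ x, (a x : ℝ) * load G σ x = ∑ u, ∑ v, ∑ x, (a x : ℝ) * ind (x ∈ (σ u v).support) := by
    simp only [load, Finset.mul_sum]
    rw [Finset.sum_comm]
    exact Finset.sum_congr rfl fun u _ => Finset.sum_comm
  rw [e1]
  push_cast
  refine Finset.sum_le_sum fun u _ => Finset.sum_le_sum fun v _ => ?_
  have h1 : ∑ x, (a x : ℝ) * ind (x ∈ (σ u v).support) = ((∑ x ∈ (σ u v).support.toFinset, a x : ℕ) : ℝ) := by
    push_cast
    rw [← Finset.sum_subset (Finset.subset_univ (σ u v).support.toFinset)]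
    · refine Finset.sum_congr rfl fun x hx => ?_
      rw [ind_pos (List.mem_toFinset.1 hx), mul_one]
    · intro x _ hx
      rw [List.mem_toFinset] at hx
      simp [ind, hx]
  rw [h1]
  have h2 : ∑ x ∈ (σ u v).support.toFinset, a x ≤ ((σ u v).support.map a).sum := by
    rw [Finset.sum_list_map_count]
    refine Finset.sum_le_sum fun x hx => ?_
    have := List.count_pos_iff.2 (List.mem_toFinset.1 hx)
    rw [smul_eq_mul]
    exact Nat.le_mul_of_pos_left _ this
  exact_mod_cast h2.trans (h u v)

theorem sep (G : SimpleGraph V) (R : V → V → Prop) (hNK : NK G R) {q L : ℕ} (hq : 1 ≤ q)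
    (hL : 3 * Fintype.card V < 2 ^ L) (hn : 2 ≤ Fintype.card V)
    (hM : (270 * L * q : ℝ) ^ 2 * ((∑ x, cnt univ (R x) : ℕ) : ℝ) < (Fintype.card V : ℝ) ^ 2) :
    Sepd G q := by
  classical
  haveI : Nonempty V := Fintype.card_pos_iff.1 (by omega)
  by_cases hG : ∀ u v, Nonempty (G.Walk u v)
  swap
  · push Not at hG
    obtain ⟨u, v, huv⟩ := hG
    let X := flt Finset.univ (fun w => G.Reachable u w)
    have hu : u ∈ X := mem_flt.2 ⟨Finset.mem_univ _, ⟨.nil⟩⟩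
    have hv : v ∈ Xᶜ := Finset.mem_compl.2 fun h => huv.false (mem_flt.1 h).2.some
    refine ⟨X, Xᶜ, ⟨u, hu⟩, ⟨v, hv⟩, disjoint_compl_right, ?_, ?_, ?_⟩
    · intro x hx y hy hxy
      exact (Finset.mem_compl.1 hy) (mem_flt.2 ⟨Finset.mem_univ _, (mem_flt.1 hx).2.trans hxy.reachable⟩)
    all_goals
      have : Fintype.card V - X.card - (Xᶜ : Finset V).card = 0 := by
        rw [Finset.card_compl]; omega
      rw [this]; simp
  set n := Fintype.card V with hnd
  have hL1 : 1 ≤ L := by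
    by_contra h; have : L = 0 := by omega
    subst this; simp at hL; omega
  have hn0 : (0 : ℝ) < n := by exact_mod_cast (by omega : 0 < n)
  have hL0 : (1 : ℝ) ≤ L := by exact_mod_cast hL1
  have hq0 : (1 : ℝ) ≤ q := by exact_mod_cast hq
  obtain ⟨a, ha, hA, hσ⟩ := int_weight_lemma G hG R hNK (45 * L * q * n) (by positivity) (by
    rw [← hnd]
    have : (36 : ℝ) * ((∑ x, cnt univ (R x) : ℕ) : ℝ) * (45 * L * q * n) ^ 2 =
      ((270 * L * q : ℝ) ^ 2 * ((∑ x, cnt univ (R x) : ℕ) : ℝ)) * n ^ 2 := by ring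
    rw [this]
    have : (n : ℝ) ^ 4 = n ^ 2 * n ^ 2 := by ring
    rw [this]
    gcongr)
  by_cases hB : ∀ z, 4 * (Bl G a Set.univ z (L * (12 * q))).card < Fintype.card V
  · exact case2 ha hA hq hL (by omega) hB
  push Not at hB
  obtain ⟨z, hz⟩ := hB
  refine case1 (z := z) ha hA hq (by omega) hz ?_
  by_contra hE
  push Not at hE
  choose σ hσ' using fun u v => (ed_spec (a := a) hG u v).walk
  have h1 := (hσ σ).trans (sum_load σ _ hσ')
  have h2 : ∑ u, ∑ v, (ed G a u v + a v) ≤ ∑ u, ∑ v, ((ed G a z u + a u + ed G a z v) + a v) := by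
    refine Finset.sum_le_sum fun u _ => Finset.sum_le_sum fun v _ => ?_
    obtain ⟨s, hs1, hs2⟩ := (ed_spec (a := a) hG z u).symm
    have := ed_le (hs1.trans (ed_spec (a := a) hG z v))
    omega
  have h3 : ∑ u, ∑ v, ((ed G a z u + a u + ed G a z v) + a v) =
      2 * n * (∑ v, ed G a z v) + 2 * n * ∑ v, a v := by
    simp only [Finset.sum_add_distrib, Finset.sum_const, Finset.card_univ, ← hnd, smul_eq_mul,
      ← Finset.mul_sum]
    ring
  rw [h3] at h2
  have h4 : 2 * n * (∑ v, ed G a z v) + 2 * n * ∑ v, a v ≤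
      2 * n * ((L * (12 * q) + 8 * q) * n) + 2 * n * (2 * n) := by gcongr
  have h5 : (45 * L * q * n * n : ℝ) ≤ ((2 * n * ((L * (12 * q) + 8 * q) * n) + 2 * n * (2 * n) : ℕ) : ℝ) :=
    h1.trans (by exact_mod_cast h2.trans h4)
  push_cast at h5
  have h6 : (45 * L * q : ℝ) * (n * n) ≤ (24 * L * q + 16 * q + 4) * (n * n) := by nlinarith
  have h7 := le_of_mul_le_mul_right h6 (by positivity)
  nlinarith
end ball
end QP

namespace QP

set_option linter.all false
open Finset Set

section NKs
variable {V : Type*} [Fintype V]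

/-- intersection graph -/
def RG (F : V → Set ℂ) : SimpleGraph V where
  Adj i j := i ≠ j ∧ Rel F i j
  symm := ⟨fun i j h => ⟨h.1.symm, by
    obtain ⟨x, hx⟩ := h.2; exact ⟨x, hx.2, hx.1⟩⟩⟩
  loopless := ⟨fun i h => h.1 rfl⟩

theorem joined_walk (γ : V → Pc) {u v : V} (W : (RG fun i => (γ i).s).Walk u v) :
    JoinedIn (⋃ x ∈ W.support, (γ x).s) ((γ u).f 0) ((γ v).f 0) := by
  induction W with
  | @nil u =>
    have := (γ u).s_pc.joinedIn _ (γ u).f0_mem _ (γ u).f0_mem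
    exact this.mono (by simp)
  | @cons u v w h p ih =>
    obtain ⟨x, hx1, hx2⟩ := h.2
    have h1 := (γ u).s_pc.joinedIn _ (γ u).f0_mem _ hx1
    have h2 := (γ v).s_pc.joinedIn _ hx2 _ (γ v).f0_mem
    refine ((h1.mono ?_).trans (h2.mono ?_)).trans (ih.mono ?_)
    · intro y hy; simp only [Set.mem_iUnion]; exact ⟨u, by simp, hy⟩
    · intro y hy; simp only [Set.mem_iUnion]
      exact ⟨v, by simp, hy⟩
    · intro y hy
      simp only [Set.mem_iUnion] at hy ⊢
      obtain ⟨x, hx, hy⟩ := hy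
      exact ⟨x, by simp [hx], hy⟩

theorem NK_string (γ : V → Pc) : NK (RG fun i => (γ i).s) (Rel fun i => (γ i).s) := by
  intro p q W
  obtain ⟨i, i', j, j', hi, hj, z, hz1, hz2⟩ := k33 (fun i => (γ (p i)).f 0) (fun j => (γ (q j)).f 0)
    _ (fun i j => joined_walk γ (W i j))
  simp only [Set.mem_iUnion] at hz1 hz2
  obtain ⟨x, hx, hzx⟩ := hz1
  obtain ⟨y, hy, hzy⟩ := hz2
  exact ⟨i, i', j, j', hi, hj, x, hx, y, hy, z, hzx, hzy⟩

/-- planar drawing -/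
structure PD (G : SimpleGraph V) (pos : V → ℂ) (A : V → V → Set ℂ) : Prop where
  inj : Function.Injective pos
  join : ∀ u v, G.Adj u v → JoinedIn (A u v) (pos u) (pos v)
  avoid : ∀ u v, G.Adj u v → ∀ w, w ≠ u → w ≠ v → pos w ∉ A u v
  disj : ∀ u v x y, G.Adj u v → G.Adj x y → u ≠ x → u ≠ y → v ≠ x → v ≠ y → Disjoint (A u v) (A x y)

/-- point set of a walk -/
def ws (G : SimpleGraph V) (pos : V → ℂ) (A : V → V → Set ℂ) (S : List V) : Set ℂ :=
  {z | (∃ x ∈ S, z = pos x) ∨ ∃ x ∈ S, ∃ y ∈ S, G.Adj x y ∧ z ∈ A x y}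

theorem ws_mono (G : SimpleGraph V) (pos : V → ℂ) (A : V → V → Set ℂ) {S T : List V} (h : S ⊆ T) :
    ws G pos A S ⊆ ws G pos A T := by
  rintro z (⟨x, hx, hz⟩ | ⟨x, hx, y, hy, hz⟩)
  · exact Or.inl ⟨x, h hx, hz⟩
  · exact Or.inr ⟨x, h hx, y, h hy, hz⟩

theorem joined_walk' {G : SimpleGraph V} {pos : V → ℂ} {A : V → V → Set ℂ} (h : PD G pos A)
    {u v : V} (W : G.Walk u v) : JoinedIn (ws G pos A W.support) (pos u) (pos v) := by
  induction W with
  | @nil u => exact JoinedIn.refl (Or.inl ⟨u, by simp, rfl⟩)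
  | @cons u v w hh p ih =>
    refine ((h.join _ _ hh).mono ?_).trans (ih.mono (ws_mono _ _ _ (by simp)))
    intro z hz
    exact Or.inr ⟨u, by simp, v, by simp, hh, hz⟩

theorem NK_planar {G : SimpleGraph V} {pos : V → ℂ} {A : V → V → Set ℂ} (h : PD G pos A) :
    NK G (fun x y => x = y) := by
  intro p q W
  obtain ⟨i, i', j, j', hi, hj, z, hz1, hz2⟩ := k33 (fun i => pos (p i)) (fun j => pos (q j))
    _ (fun i j => joined_walk' h (W i j))
  refine ⟨i, i', j, j', hi, hj, ?_⟩
  by_contra hcon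
  push Not at hcon
  rcases hz1 with ⟨x, hx, rfl⟩ | ⟨x, hx, y, hy, hxy, hz⟩ <;>
    rcases hz2 with ⟨x', hx', hz'⟩ | ⟨x', hx', y', hy', hxy', hz'⟩
  · exact hcon x hx x' hx' (h.inj hz')
  · exact h.avoid _ _ hxy' x (hcon _ hx _ hx') (hcon _ hx _ hy') hz'
  · subst hz'
    exact h.avoid _ _ hxy x' (hcon _ hx _ hx').symm (hcon _ hy _ hx').symm hz
  · exact Set.disjoint_left.1 (h.disj _ _ _ _ hxy hxy' (hcon _ hx _ hx') (hcon _ hx _ hy')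
      (hcon _ hy _ hx') (hcon _ hy _ hy')) hz hz'
end NKs

section planar

/-- number of ordered adjacent pairs -/
noncomputable def oe {V : Type*} [Fintype V] (G : SimpleGraph V) : ℕ := ∑ u, cnt univ (G.Adj u)

theorem oe_le {V : Type*} [Fintype V] (G : SimpleGraph V) : oe G ≤ Fintype.card V * Fintype.card V := by
  unfold oe
  calc _ ≤ ∑ u : V, Fintype.card V := Finset.sum_le_sum fun u _ => cnt_le_card _ _
    _ = _ := by simp

theorem oe_le_one {V : Type*} [Fintype V] (G : SimpleGraph V) (h : Fintype.card V ≤ 1) : oe G = 0 := by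
  classical
  unfold oe
  refine Finset.sum_eq_zero fun u _ => ?_
  rw [cnt, Finset.card_eq_zero, Finset.eq_empty_iff_forall_notMem]
  intro v hv
  have := (mem_flt.1 hv).2
  exact this.ne (Fintype.card_le_one_iff.1 h u v)

theorem oe_induce {V : Type*} [Fintype V] (G : SimpleGraph V) (X : Finset V) :
    oe (G.comap (fun x : X => (x : V))) = ∑ u ∈ X, cnt X (G.Adj u) := by
  classical
  unfold oe
  rw [← Finset.sum_coe_sort X (fun u => cnt X (G.Adj u))]
  refine Finset.sum_congr rfl fun u _ => ?_
  unfold cnt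
  refine Finset.card_bij (fun v _ => (v : V)) ?_ ?_ ?_
  · intro v hv; exact mem_flt.2 ⟨v.2, (mem_flt.1 hv).2⟩
  · intro v _ w _ h; exact Subtype.ext h
  · intro v hv; exact ⟨⟨v, (mem_flt.1 hv).1⟩, mem_flt.2 ⟨Finset.mem_univ _, (mem_flt.1 hv).2⟩, rfl⟩

theorem PD.comap {V : Type*} [Fintype V] {G : SimpleGraph V} {pos : V → ℂ} {A : V → V → Set ℂ}
    (h : PD G pos A) (X : Finset V) :
    PD (G.comap (fun x : X => (x : V))) (fun x => pos x) (fun x y => A x y) where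
  inj := fun x y hxy => Subtype.ext (h.inj hxy)
  join := fun u v huv => h.join _ _ huv
  avoid := fun u v huv w h1 h2 => h.avoid _ _ huv _ (fun e => h1 (Subtype.ext e)) (fun e => h2 (Subtype.ext e))
  disj := fun u v x y h1 h2 e1 e2 e3 e4 => h.disj _ _ _ _ h1 h2 (fun e => e1 (Subtype.ext e))
    (fun e => e2 (Subtype.ext e)) (fun e => e3 (Subtype.ext e)) (fun e => e4 (Subtype.ext e))

/-- arithmetic of the planar recursion; `x ≤ y`. -/
theorem planar_arith {x y s L : ℝ} (hx : 0 < x) (hxy : x ≤ y) (hs : 0 ≤ s) (hsx : 2 * L * s ≤ x)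
    (hL : 1 ≤ L) (hm : Real.logb 2 (x + y + s) ≤ L) :
    (x + s) * Real.logb 2 (x + s) + (y + s) * Real.logb 2 (y + s) ≤
      (x + y + s) * Real.logb 2 (x + y + s) := by
  have hy : 0 < y := lt_of_lt_of_le hx hxy
  have h1 : Real.logb 2 (y + s) ≤ Real.logb 2 (x + y + s) :=
    Real.logb_le_logb_of_le (by norm_num) (by linarith) (by linarith)
  have hsx2 : 2 * s ≤ x := by nlinarith
  have h2 : Real.logb 2 (x + s) + 1 / 2 ≤ Real.logb 2 (x + y + s) := by
    have h3 : Real.logb 2 (Real.sqrt 2) = 1 / 2 := by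
      rw [Real.sqrt_eq_rpow, Real.logb_rpow (by norm_num) (by norm_num)]
    rw [← h3, ← Real.logb_mul (by positivity) (by positivity)]
    refine Real.logb_le_logb_of_le (by norm_num) (by positivity) ?_
    have h4 : Real.sqrt 2 ≤ 3 / 2 := by
      rw [Real.sqrt_le_left (by norm_num)]; norm_num
    have : (x + s) * Real.sqrt 2 ≤ (x + s) * (3 / 2) := by gcongr
    nlinarith
  have h5 : s * Real.logb 2 (x + y + s) ≤ s * L := by gcongr
  nlinarith [mul_le_mul_of_nonneg_left h1 (by linarith : 0 ≤ y + s),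
    mul_le_mul_of_nonneg_left h2 (by linarith : 0 ≤ x + s)]

theorem planar_bound (L : ℕ) : ∀ (m : ℕ) (V : Type) [Fintype V] (G : SimpleGraph V) (pos : V → ℂ)
    (A : V → V → Set ℂ), PD G pos A → Fintype.card V = m → 3 * m < 2 ^ L →
    (oe G : ℝ) ≤ (540 * L ^ 2) ^ 2 * (m * Real.logb 2 m) := by
  intro m
  induction m using Nat.strong_induction_on with
  | _ m ih =>
  intro V _ G pos A hPD hm hL
  classical
  by_cases hm2 : m < 2
  · rw [oe_le_one G (by omega)]
    interval_cases m <;> simp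
  push Not at hm2
  have hL1 : 1 ≤ L := by
    by_contra h; have : L = 0 := by omega
    subst this; simp at hL; omega
  have hL1' : (1 : ℝ) ≤ L := by exact_mod_cast hL1
  have hm0 : (0 : ℝ) < m := by exact_mod_cast (by omega : 0 < m)
  have hlog1 : (1 : ℝ) ≤ Real.logb 2 m := by
    rw [Real.le_logb_iff_rpow_le (by norm_num) hm0]; simpa using (by exact_mod_cast hm2 : (2 : ℝ) ≤ m)
  have hlogL : Real.logb 2 m ≤ L := by
    rw [Real.logb_le_iff_le_rpow (by norm_num) hm0, Real.rpow_natCast]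
    exact_mod_cast (by omega : m ≤ 2 ^ L)
  by_cases hsmall : (m : ℝ) ≤ (540 * L ^ 2) ^ 2
  · have h1 : (oe G : ℝ) ≤ m * m := by
      have := oe_le G; rw [hm] at this; exact_mod_cast this
    calc (oe G : ℝ) ≤ m * m := h1
      _ ≤ (540 * L ^ 2) ^ 2 * m := by gcongr
      _ ≤ _ := by
        have : (m : ℝ) ≤ m * Real.logb 2 m := by nlinarith
        gcongr
  push Not at hsmall
  have hM : ∑ x : V, cnt Finset.univ (fun y => x = y) = m := by
    have : ∀ x : V, cnt Finset.univ (fun y => x = y) = 1 := by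
      intro x
      rw [cnt, Finset.card_eq_one]
      exact ⟨x, by ext y; simp [mem_flt, eq_comm]⟩
    simp [this, hm]
  obtain ⟨X, Y, hX, hY, hXY, hadj, hqX, hqY⟩ := sep G (fun x y => x = y) (NK_planar hPD)
    (q := 2 * L) (L := L) (by omega) (by rw [hm]; exact hL) (by omega) (by
      rw [hM, hm]; push_cast
      have : (270 * (L : ℝ) * (2 * L)) ^ 2 = (540 * L ^ 2) ^ 2 := by ring
      rw [this, pow_two (m : ℝ)]
      gcongr)
  rw [hm] at hqX hqY
  let X' : Finset V := Yᶜ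
  let Y' : Finset V := Xᶜ
  have hXc := Finset.card_pos.2 hX
  have hYc := Finset.card_pos.2 hY
  have hle : X.card + Y.card ≤ m := by
    rw [← Finset.card_union_of_disjoint hXY, ← hm]; exact Finset.card_le_univ _
  have hX'c : X'.card = m - Y.card := by rw [Finset.card_compl, hm]
  have hY'c : Y'.card = m - X.card := by rw [Finset.card_compl, hm]
  have hsplit : oe G ≤ oe (G.comap (fun x : X' => (x : V))) + oe (G.comap (fun x : Y' => (x : V))) := by
    rw [oe_induce, oe_induce]
    have key : ∀ u, cnt Finset.univ (G.Adj u) ≤ (if u ∈ X' then cnt X' (G.Adj u) else 0) +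
        (if u ∈ Y' then cnt Y' (G.Adj u) else 0) := by
      intro u
      by_cases hu : u ∈ X
      · have hu' : u ∈ X' := Finset.mem_compl.2 (Finset.disjoint_left.1 hXY hu)
        rw [if_pos hu']
        refine le_trans ?_ (Nat.le_add_right _ _)
        exact cnt_mono fun v _ hv => ⟨Finset.mem_compl.2 fun h => hadj u hu v h hv, hv⟩
      · have hu' : u ∈ Y' := Finset.mem_compl.2 hu
        rw [if_pos hu']
        by_cases hy : u ∈ Y
        · refine le_trans ?_ (Nat.le_add_left _ _)
          exact cnt_mono fun v _ hv => ⟨Finset.mem_compl.2 fun h => hadj v h u hy hv.symm, hv⟩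
        · rw [if_pos (Finset.mem_compl.2 hy)]
          unfold cnt
          rw [← Finset.card_union_add_card_inter]
          refine le_trans (Finset.card_le_card ?_) (Nat.le_add_right _ _)
          intro v hv
          rw [Finset.mem_union]
          by_cases hvX : v ∈ X
          · exact Or.inl (mem_flt.2 ⟨Finset.mem_compl.2 (Finset.disjoint_left.1 hXY hvX), (mem_flt.1 hv).2⟩)
          · exact Or.inr (mem_flt.2 ⟨Finset.mem_compl.2 hvX, (mem_flt.1 hv).2⟩)
    unfold oe
    refine (Finset.sum_le_sum fun u _ => key u).trans ?_
    rw [Finset.sum_add_distrib]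
    simp
  have i1 := ih X'.card (by omega) X' (G.comap (fun x : X' => (x : V))) _ _ (hPD.comap X')
    (by simp) (by omega)
  have i2 := ih Y'.card (by omega) Y' (G.comap (fun x : Y' => (x : V))) _ _ (hPD.comap Y')
    (by simp) (by omega)
  obtain ⟨s, hs⟩ : ∃ s, m = X.card + Y.card + s := ⟨m - X.card - Y.card, by omega⟩
  have hX's : (X'.card : ℝ) = X.card + s := by rw [hX'c]; exact_mod_cast (by omega : m - Y.card = X.card + s)
  have hY's : (Y'.card : ℝ) = Y.card + s := by rw [hY'c]; exact_mod_cast (by omega : m - X.card = Y.card + s)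
  have hms : (m : ℝ) = X.card + Y.card + s := by exact_mod_cast hs
  have es : m - X.card - Y.card = s := by omega
  rw [es] at hqX hqY
  have hqX' : 2 * (L : ℝ) * s ≤ X.card := by exact_mod_cast hqX
  have hqY' : 2 * (L : ℝ) * s ≤ Y.card := by exact_mod_cast hqY
  have hXc' : (0 : ℝ) < X.card := by exact_mod_cast hXc
  have hYc' : (0 : ℝ) < Y.card := by exact_mod_cast hYc
  have hsum : (X'.card : ℝ) * Real.logb 2 X'.card + Y'.card * Real.logb 2 Y'.card ≤ m * Real.logb 2 m := by
    rw [hX's, hY's]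
    rcases le_total (X.card : ℝ) Y.card with h | h
    · have := planar_arith hXc' h (Nat.cast_nonneg s) hqX' hL1' (by rw [← hms]; exact hlogL)
      rw [← hms] at this; exact this
    · have e : (m : ℝ) = Y.card + X.card + s := by rw [hms]; ring
      have := planar_arith hYc' h (Nat.cast_nonneg s) hqY' hL1' (by rw [← e]; exact hlogL)
      rw [← e] at this; linarith
  have h0 : (oe G : ℝ) ≤ oe (G.comap (fun x : X' => (x : V))) + oe (G.comap (fun x : Y' => (x : V))) := by
    exact_mod_cast hsplit
  calc (oe G : ℝ) ≤ _ := h0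
    _ ≤ (540 * L ^ 2) ^ 2 * (X'.card * Real.logb 2 X'.card) + (540 * L ^ 2) ^ 2 * (Y'.card * Real.logb 2 Y'.card) :=
      add_le_add i1 i2
    _ = (540 * L ^ 2) ^ 2 * (X'.card * Real.logb 2 X'.card + Y'.card * Real.logb 2 Y'.card) := by ring
    _ ≤ _ := by gcongr
end planar
end QP

namespace QP

set_option linter.all false
open Finset Set

/-- density parameter -/
noncomputable def zz (L : ℕ) : ℝ := 1 / (8 * (540 * (L : ℝ) ^ 2) ^ 2)
/-- bi-clique fraction -/
noncomputable def cc (L : ℕ) : ℝ := ((zz L ^ 12 / 4) ^ 12 / 4) ^ 6 / (3600 * (L + 5))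

theorem zz_pos {L : ℕ} (h : 1 ≤ L) : 0 < zz L := by
  have : (0 : ℝ) < L := by exact_mod_cast h
  unfold zz; positivity
theorem zz_le {L : ℕ} (h : 1 ≤ L) : zz L ≤ 1 := by
  have : (1 : ℝ) ≤ L := by exact_mod_cast h
  unfold zz
  rw [div_le_one (by positivity)]
  have : (1 : ℝ) ≤ L ^ 2 := one_le_pow₀ this
  nlinarith
theorem cc_pos {L : ℕ} (h : 1 ≤ L) : 0 < cc L := by
  have := zz_pos h
  unfold cc; positivity
theorem cc_le {L : ℕ} (h : 1 ≤ L) : cc L ≤ 1 := by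
  have h0 := (zz_pos h).le
  have h1 := zz_le h
  unfold cc
  rw [div_le_one (by positivity)]
  have a1 : zz L ^ 12 ≤ 1 := pow_le_one₀ h0 h1
  have a2 : (zz L ^ 12 / 4) ^ 12 ≤ 1 := pow_le_one₀ (by positivity) (by linarith)
  have a3 : ((zz L ^ 12 / 4) ^ 12 / 4) ^ 6 ≤ 1 := pow_le_one₀ (by positivity) (by linarith)
  have : (0 : ℝ) ≤ L := Nat.cast_nonneg L
  linarith

theorem string_arith {x y s L : ℝ} (hx : 0 < x) (hxy : x ≤ y) (hs : 0 ≤ s) (hsx : 2 * L * s ≤ x)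
    (hL : 1 ≤ L) :
    (x + y + s) * (1 - Real.logb 2 (x + y + s) / (2 * L)) ≤
    x * (1 - Real.logb 2 x / (2 * L)) + y * (1 - Real.logb 2 y / (2 * L)) + s * (-Real.logb 2 (x + y + s) / (2 * L)) := by
  have hy : 0 < y := lt_of_lt_of_le hx hxy
  have h1 : Real.logb 2 y ≤ Real.logb 2 (x + y + s) :=
    Real.logb_le_logb_of_le (by norm_num) (by linarith) (by linarith)
  have h2 : Real.logb 2 x + 1 ≤ Real.logb 2 (x + y + s) := by
    have h3 : Real.logb 2 2 = 1 := Real.logb_self_eq_one (by norm_num)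
    rw [← h3, ← Real.logb_mul (by positivity) (by positivity)]
    exact Real.logb_le_logb_of_le (by norm_num) (by positivity) (by linarith)
  have e1 : x * (1 - Real.logb 2 x / (2 * L)) + y * (1 - Real.logb 2 y / (2 * L)) + s * (-Real.logb 2 (x + y + s) / (2 * L)) -
    (x + y + s) * (1 - Real.logb 2 (x + y + s) / (2 * L)) =
    (x * (Real.logb 2 (x + y + s) - Real.logb 2 x) + y * (Real.logb 2 (x + y + s) - Real.logb 2 y) - 2 * L * s) / (2 * L) := by
    field_simp; ring
  have e2 : 0 ≤ (x * (Real.logb 2 (x + y + s) - Real.logb 2 x) + y * (Real.logb 2 (x + y + s) - Real.logb 2 y) - 2 * L * s) / (2 * L) := by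
    apply div_nonneg _ (by linarith)
    nlinarith [mul_nonneg hy.le (sub_nonneg.2 h1), mul_nonneg hx.le (sub_nonneg.2 h2)]
  linarith

theorem Rel.comm {V : Type*} {F : V → Set ℂ} {a b : V} (h : Rel F a b) : Rel F b a := by
  obtain ⟨x, hx⟩ := h; exact ⟨x, hx.2, hx.1⟩

theorem string_bound (L : ℕ) : ∀ (j m : ℕ) (V : Type) [Fintype V] (γ : V → Pc),
    Fintype.card V = m → 3 * m < 2 ^ L →
    (∀ K : Finset V, (∀ a ∈ K, ∀ b ∈ K, Rel (fun i => (γ i).s) a b) → K.card < 2 ^ j) →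
    ∃ I : Finset V, (∀ a ∈ I, ∀ b ∈ I, a ≠ b → ¬ Rel (fun i => (γ i).s) a b) ∧
      m * (1 - Real.logb 2 m / (2 * L)) ≤ (8 / cc L) ^ j * I.card := by
  intro j
  induction j with
  | zero =>
    intro m V _ γ hm hL hK
    have : m = 0 := by
      by_contra h
      obtain ⟨v⟩ : Nonempty V := Fintype.card_pos_iff.1 (by omega)
      have := hK {v} (by
        intro a ha b hb
        rw [Finset.mem_singleton.1 ha, Finset.mem_singleton.1 hb]
        exact ⟨_, (γ v).f0_mem, (γ v).f0_mem⟩)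
      simp at this
    exact ⟨∅, by simp, by simp [this]⟩
  | succ j ihj =>
  intro m
  induction m using Nat.strong_induction_on with
  | _ m ih =>
  intro V _ γ hm hL hK
  classical
  by_cases hm1 : m < 1
  · have : m = 0 := by omega
    exact ⟨∅, by simp, by simp [this]⟩
  push Not at hm1
  have hL1 : 1 ≤ L := by
    by_contra h; have : L = 0 := by omega
    subst this; simp at hL; omega
  have hL1' : (1 : ℝ) ≤ L := by exact_mod_cast hL1
  have hc0 := cc_pos hL1
  have hc1 := cc_le hL1
  have hQ1 : 1 ≤ 8 / cc L := by rw [le_div_iff₀ hc0]; linarith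
  have hm0 : (0 : ℝ) < m := by exact_mod_cast hm1
  have hlog0 : ∀ k : ℕ, 0 ≤ Real.logb 2 k := by
    intro k
    rcases Nat.eq_zero_or_pos k with h | h
    · simp [h]
    · exact Real.logb_nonneg (by norm_num) (by exact_mod_cast h)
  have hlogL : ∀ k : ℕ, k ≤ m → Real.logb 2 k ≤ L := by
    intro k hk
    rcases Nat.eq_zero_or_pos k with h | h
    · simp [h]
    rw [Real.logb_le_iff_le_rpow (by norm_num) (by exact_mod_cast h), Real.rpow_natCast]
    exact_mod_cast (by omega : k ≤ 2 ^ L)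
  have hle1 : (m : ℝ) * (1 - Real.logb 2 m / (2 * L)) ≤ m := by
    have : 0 ≤ Real.logb 2 m / (2 * L) := div_nonneg (hlog0 m) (by positivity)
    nlinarith
  -- a single vertex
  by_cases hsm : (m : ℝ) ≤ 8 / cc L
  · obtain ⟨v⟩ : Nonempty V := Fintype.card_pos_iff.1 (by omega)
    refine ⟨{v}, ?_, ?_⟩
    · intro a ha b hb hab
      rw [Finset.mem_singleton.1 ha, Finset.mem_singleton.1 hb] at hab
      exact absurd rfl hab
    · simp only [Finset.card_singleton, Nat.cast_one, mul_one]
      refine hle1.trans (hsm.trans ?_)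
      exact le_self_pow₀ hQ1 (by omega)
  push Not at hsm
  have hm2 : 2 ≤ m := by
    have : (1 : ℝ) < m := by linarith
    have : 1 < m := by exact_mod_cast this
    omega
  set M := ∑ x : V, cnt Finset.univ (fun y => Rel (fun i => (γ i).s) x y) with hMdef
  by_cases hM : (270 * L * (2 * L : ℕ) : ℝ) ^ 2 * (M : ℝ) < (m : ℝ) ^ 2
  · -- sparse
    obtain ⟨X, Y, hX, hY, hXY, hadj, hqX, hqY⟩ := sep _ _ (NK_string γ)
      (q := 2 * L) (L := L) (by omega) (by rw [hm]; exact hL) (by omega) (by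
        rw [hm]; exact hM)
    rw [hm] at hqX hqY
    have hXc := Finset.card_pos.2 hX
    have hYc := Finset.card_pos.2 hY
    have hle : X.card + Y.card ≤ m := by
      rw [← Finset.card_union_of_disjoint hXY, ← hm]; exact Finset.card_le_univ _
    have sub : ∀ Z : Finset V, Z.card < m → ∃ I : Finset V, I ⊆ Z ∧
        (∀ a ∈ I, ∀ b ∈ I, a ≠ b → ¬ Rel (fun i => (γ i).s) a b) ∧
        Z.card * (1 - Real.logb 2 Z.card / (2 * L)) ≤ (8 / cc L) ^ (j + 1) * I.card := by
      intro Z hZ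
      obtain ⟨I, h1, h2⟩ := ih Z.card hZ Z (fun i => γ i) (by simp) (by omega) (by
        intro K hKK
        have := hK (K.map (Function.Embedding.subtype _)) (by
          intro a ha b hb
          obtain ⟨a, ha', rfl⟩ := Finset.mem_map.1 ha
          obtain ⟨b, hb', rfl⟩ := Finset.mem_map.1 hb
          exact hKK a ha' b hb')
        simpa using this)
      refine ⟨I.map (Function.Embedding.subtype _), ?_, ?_, by simpa using h2⟩
      · intro a ha
        obtain ⟨a, ha', rfl⟩ := Finset.mem_map.1 ha
        exact a.2
      · intro a ha b hb hab
        obtain ⟨a, ha', rfl⟩ := Finset.mem_map.1 ha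
        obtain ⟨b, hb', rfl⟩ := Finset.mem_map.1 hb
        exact h1 a ha' b hb' (fun e => hab (by rw [e]))
    obtain ⟨I1, hI1, hI1i, hI1c⟩ := sub X (by omega)
    obtain ⟨I2, hI2, hI2i, hI2c⟩ := sub Y (by omega)
    have hdI : Disjoint I1 I2 := Finset.disjoint_of_subset_left hI1 (Finset.disjoint_of_subset_right hI2 hXY)
    refine ⟨I1 ∪ I2, ?_, ?_⟩
    · intro a ha b hb hab hR
      rcases Finset.mem_union.1 ha with ha | ha <;> rcases Finset.mem_union.1 hb with hb | hb
      · exact hI1i a ha b hb hab hR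
      · exact hadj a (hI1 ha) b (hI2 hb) ⟨hab, hR⟩
      · exact hadj b (hI1 hb) a (hI2 ha) ⟨hab.symm, hR.comm⟩
      · exact hI2i a ha b hb hab hR
    · rw [Finset.card_union_of_disjoint hdI]
      obtain ⟨s, hs⟩ : ∃ s, m = X.card + Y.card + s := ⟨m - X.card - Y.card, by omega⟩
      have hms : (m : ℝ) = X.card + Y.card + s := by exact_mod_cast hs
      have es : m - X.card - Y.card = s := by omega
      rw [es] at hqX hqY
      have hqX' : 2 * (L : ℝ) * s ≤ X.card := by exact_mod_cast hqX
      have hqY' : 2 * (L : ℝ) * s ≤ Y.card := by exact_mod_cast hqY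
      have hXc' : (0 : ℝ) < X.card := by exact_mod_cast hXc
      have hYc' : (0 : ℝ) < Y.card := by exact_mod_cast hYc
      have hneg : (s : ℝ) * (-Real.logb 2 m / (2 * L)) ≤ 0 := by
        refine mul_nonpos_of_nonneg_of_nonpos (Nat.cast_nonneg s) ?_
        exact div_nonpos_of_nonpos_of_nonneg (by linarith [hlog0 m]) (by positivity)
      push_cast
      rw [mul_add]
      rcases le_total (X.card : ℝ) Y.card with h | h
      · have := string_arith hXc' h (Nat.cast_nonneg s) hqX' hL1'
        rw [← hms] at this; linarith
      · have e : (m : ℝ) = Y.card + X.card + s := by rw [hms]; ring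
        have := string_arith hYc' h (Nat.cast_nonneg s) hqY' hL1'
        rw [← e] at this; linarith
  · -- dense
    push Not at hM
    obtain ⟨k, hk⟩ : ∃ k, k = ⌊cc L * m / 2⌋₊ := ⟨_, rfl⟩
    have hcm : 8 < cc L * m := by rw [div_lt_iff₀ hc0] at hsm; linarith
    have hk1 : (k : ℝ) ≤ cc L * m / 2 := by rw [hk]; exact Nat.floor_le (by positivity)
    have hk2 : cc L * m / 4 ≤ k := by
      have : cc L * m / 2 < k + 1 := by rw [hk]; exact Nat.lt_floor_add_one _
      linarith
    have hk0 : 1 ≤ k := by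
      have : (0 : ℝ) < k := by linarith
      exact_mod_cast this
    have hkm : 2 * k ≤ m := by
      have : (2 * k : ℝ) ≤ m := by nlinarith
      exact_mod_cast this
    have hnb : ¬ NoBic (Rel fun i => (γ i).s) (2 * k) := by
      intro hnb
      have hz := zz_pos hL1
      have := lemma_D (s := 2 * k) (L := L) γ hnb hz (zz_le hL1) (by omega) (by
        rw [hm]; push_cast
        have : 2 * (k : ℝ) ≤ cc L * m := by linarith
        calc 3600 * ((L : ℝ) + 5) * (2 * k) ≤ 3600 * ((L : ℝ) + 5) * (cc L * m) := by gcongr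
          _ = _ := by unfold cc; field_simp)
      rw [hm] at this
      change (M : ℝ) ≤ _ at this
      have h1 : (270 * L * (2 * L : ℕ) : ℝ) ^ 2 * (4 * zz L * m ^ 2) = m ^ 2 / 2 := by
        unfold zz; push_cast; field_simp; ring
      have h2 : (270 * L * (2 * L : ℕ) : ℝ) ^ 2 * (M : ℝ) ≤ m ^ 2 / 2 := by
        rw [← h1]; gcongr
      nlinarith
    unfold NoBic at hnb
    push Not at hnb
    obtain ⟨X, Y, hXY, hXc, hYc⟩ := hnb
    obtain ⟨X', hX', hX'c⟩ := Finset.exists_subset_card_eq (show k ≤ X.card by omega)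
    have hY'c : k ≤ (Y \ X').card := by
      have := Finset.le_card_sdiff X' Y
      omega
    have fin : ∀ Z : Finset V, k ≤ Z.card →
        (∀ K : Finset V, K ⊆ Z → (∀ a ∈ K, ∀ b ∈ K, Rel (fun i => (γ i).s) a b) → K.card < 2 ^ j) →
        ∃ I : Finset V, (∀ a ∈ I, ∀ b ∈ I, a ≠ b → ¬ Rel (fun i => (γ i).s) a b) ∧
        m * (1 - Real.logb 2 m / (2 * L)) ≤ (8 / cc L) ^ (j + 1) * I.card := by
      intro Z hZ hZK
      have hZm : Z.card ≤ m := by rw [← hm]; exact Finset.card_le_univ _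
      obtain ⟨I, h1, h2⟩ := ihj Z.card Z (fun i => γ i) (by simp) (by omega) (by
        intro K hKK
        have := hZK (K.map (Function.Embedding.subtype _)) (by
          intro a ha
          obtain ⟨a, ha', rfl⟩ := Finset.mem_map.1 ha
          exact a.2) (by
          intro a ha b hb
          obtain ⟨a, ha', rfl⟩ := Finset.mem_map.1 ha
          obtain ⟨b, hb', rfl⟩ := Finset.mem_map.1 hb
          exact hKK a ha' b hb')
        simpa using this)
      refine ⟨I.map (Function.Embedding.subtype _), ?_, ?_⟩
      · intro a ha b hb hab
        obtain ⟨a, ha', rfl⟩ := Finset.mem_map.1 ha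
        obtain ⟨b, hb', rfl⟩ := Finset.mem_map.1 hb
        exact h1 a ha' b hb' (fun e => hab (by rw [e]))
      · rw [Finset.card_map]
        have h3 : (1 : ℝ) / 2 ≤ 1 - Real.logb 2 Z.card / (2 * L) := by
          have : Real.logb 2 Z.card / (2 * L) ≤ 1 / 2 := by
            rw [div_le_div_iff₀ (by positivity) (by norm_num)]
            linarith [hlogL _ hZm]
          linarith
        have h4 : (k : ℝ) * (1 / 2) ≤ (8 / cc L) ^ j * I.card := by
          refine le_trans ?_ h2
          have : (k : ℝ) ≤ Z.card := by exact_mod_cast hZ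
          gcongr
        refine hle1.trans ?_
        calc (m : ℝ) = (8 / cc L) * (cc L * m / 4 * (1 / 2)) := by field_simp; norm_num
          _ ≤ (8 / cc L) * (k * (1 / 2)) := by gcongr
          _ ≤ (8 / cc L) * ((8 / cc L) ^ j * I.card) := by gcongr
          _ = _ := by ring
    by_cases hZ1 : ∀ K : Finset V, K ⊆ X' → (∀ a ∈ K, ∀ b ∈ K, Rel (fun i => (γ i).s) a b) → K.card < 2 ^ j
    · exact fin X' hX'c.ge hZ1
    by_cases hZ2 : ∀ K : Finset V, K ⊆ Y \ X' → (∀ a ∈ K, ∀ b ∈ K, Rel (fun i => (γ i).s) a b) → K.card < 2 ^ j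
    · exact fin _ hY'c hZ2
    exfalso
    push Not at hZ1 hZ2
    obtain ⟨K1, hK1, hK1c, hK1n⟩ := hZ1
    obtain ⟨K2, hK2, hK2c, hK2n⟩ := hZ2
    have hd : Disjoint K1 K2 := by
      rw [Finset.disjoint_left]; intro a h1 h2
      exact (Finset.mem_sdiff.1 (hK2 h2)).2 (hK1 h1)
    have := hK (K1 ∪ K2) (by
      intro a ha b hb
      rcases Finset.mem_union.1 ha with ha | ha <;> rcases Finset.mem_union.1 hb with hb | hb
      · exact hK1c a ha b hb
      · exact hXY a (hX' (hK1 ha)) b (Finset.mem_sdiff.1 (hK2 hb)).1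
      · exact (hXY b (hX' (hK1 hb)) a (Finset.mem_sdiff.1 (hK2 ha)).1).comm
      · exact hK2c a ha b hb)
    rw [Finset.card_union_of_disjoint hd, pow_succ] at this
    omega
end QP

namespace QP

set_option linter.all false
open Finset Set

theorem Pc.s_cases (p : Pc) {x : ℂ} (h : x ∈ p.s) : x ∈ p.o ∨ x = p.f 0 ∨ x = p.f p.l := by
  obtain ⟨t, ⟨h0, h1⟩, rfl⟩ := h
  rcases h0.eq_or_lt with rfl | h0
  · exact Or.inr (Or.inl rfl)
  rcases h1.eq_or_lt with rfl | h1
  · exact Or.inr (Or.inr rfl)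
  exact Or.inl ⟨t, ⟨h0, h1⟩, rfl⟩

/-- A finite subset of an open arc lies in a closed subarc. -/
theorem Pc.trim1 (p : Pc) (hl : 0 < p.l) (F : Finset ℂ) (hF : ∀ x ∈ F, x ∈ p.o) :
    ∃ a b : ℝ, 0 < a ∧ a ≤ b ∧ b < p.l ∧ ∀ x ∈ F, x ∈ p.f '' Set.Icc a b := by
  classical
  induction F using Finset.induction_on with
  | empty => exact ⟨p.l / 2, p.l / 2, by linarith, le_rfl, by linarith, by simp⟩
  | insert x F _ ih =>
    obtain ⟨a, b, h0, h1, h2, h3⟩ := ih fun y hy => hF y (Finset.mem_insert_of_mem hy)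
    obtain ⟨t, ⟨t0, t1⟩, rfl⟩ := hF x (Finset.mem_insert_self _ _)
    refine ⟨min a t, max b t, lt_min h0 t0, (min_le_left _ _).trans (h1.trans (le_max_left _ _)),
      max_lt h2 t1, fun y hy => ?_⟩
    rcases Finset.mem_insert.1 hy with rfl | hy
    · exact ⟨t, ⟨min_le_right _ _, le_max_right _ _⟩, rfl⟩
    · exact image_mono (Set.Icc_subset_Icc (min_le_left _ _) (le_max_left _ _)) (h3 y hy)

theorem Pc.trim (p : Pc) (hl : 0 < p.l) (F : Finset ℂ) (hF : ∀ x ∈ F, x ∈ p.o) :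
    ∃ q : Pc, q.s ⊆ p.o ∧ ∀ x ∈ F, x ∈ q.s := by
  obtain ⟨a, b, h0, h1, h2, h3⟩ := p.trim1 hl F hF
  refine ⟨p.sub a b, ?_, ?_⟩
  · rw [p.sub_s h1]
    exact image_mono fun t ht => ⟨h0.trans_le ht.1, ht.2.trans_lt h2⟩
  · rw [p.sub_s h1]; exact h3

theorem trim_all {E : Type} [Fintype E] (p : E → Pc) (hl : ∀ e, 0 < (p e).l) :
    ∃ γ : E → Pc, (∀ e, (γ e).s ⊆ (p e).o) ∧
      ∀ e e', ((p e).o ∩ (p e').o).Nonempty → Rel (fun i => (γ i).s) e e' := by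
  classical
  have hx : ∀ e e', ∃ x, ((p e).o ∩ (p e').o).Nonempty → x ∈ (p e).o ∩ (p e').o := fun e e' => by
    by_cases h : ((p e).o ∩ (p e').o).Nonempty
    · exact ⟨_, fun _ => h.choose_spec⟩
    · exact ⟨0, fun h' => absurd h' h⟩
  choose x hx using hx
  let S : E → Finset ℂ := fun e => (Finset.univ.image (x e) ∪ Finset.univ.image fun e' => x e' e).filter (· ∈ (p e).o)
  have h := fun e => (p e).trim (hl e) (S e) fun y hy => (Finset.mem_filter.1 hy).2
  choose γ h1 h2 using h
  refine ⟨γ, h1, fun e e' hn => ⟨x e e', h2 _ _ ?_, h2 _ _ ?_⟩⟩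
  · exact Finset.mem_filter.2 ⟨Finset.mem_union_left _ (Finset.mem_image_of_mem _ (Finset.mem_univ _)), (hx e e' hn).1⟩
  · exact Finset.mem_filter.2 ⟨Finset.mem_union_right _ (Finset.mem_image.2 ⟨e, Finset.mem_univ _, rfl⟩), (hx e e' hn).2⟩

/-- The plane as the complex numbers. -/
noncomputable def Phi (x : ℝ × ℝ) : ℂ := Complex.equivRealProdCLM.symm x
theorem Phi_cont : Continuous Phi := Complex.equivRealProdCLM.symm.continuous
theorem Phi_inj : Function.Injective Phi := Complex.equivRealProdCLM.symm.injective

theorem edge_pc {V : Type} (T : TopologicalGraph V) {e : Sym2 V} (he : e ∈ T.G.edgeSet) :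
    ∃ (u v : V) (p : Pc), e = s(u, v) ∧ T.G.Adj u v ∧ 0 < p.l ∧ p.f 0 = Phi (T.pos u) ∧
      p.f p.l = Phi (T.pos v) ∧ p.s ⊆ Phi '' T.arc u v ∧ ∀ w, Phi (T.pos w) ∉ p.o := by
  induction e using Sym2.ind with
  | _ u v =>
  rw [SimpleGraph.mem_edgeSet] at he
  obtain ⟨f, hf, f0, f1, ha⟩ := T.arc_spec u v he
  have hZ : IsPathConnected (Phi '' T.arc u v) := by
    rw [ha]
    have h1 : IsPathConnected (Set.Icc (0 : ℝ) 1) :=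
      (convex_Icc 0 1).isPathConnected ⟨0, by simp⟩
    exact (h1.image' hf).image Phi_cont
  have hne : u ≠ v := he.ne
  have hd : Disjoint ({Phi (T.pos u)} : Set ℂ) {Phi (T.pos v)} := by
    rw [Set.disjoint_singleton]
    exact fun h => hne (T.pos_inj (Phi_inj h))
  obtain ⟨p, hp, hs⟩ := exists_rung isClosed_singleton isClosed_singleton hd hZ
    ⟨Phi (T.pos u), ⟨T.pos u, by rw [ha]; exact ⟨0, by simp, f0⟩, rfl⟩, rfl⟩
    ⟨Phi (T.pos v), ⟨T.pos v, by rw [ha]; exact ⟨1, by simp, f1⟩, rfl⟩, rfl⟩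
  obtain ⟨a1, a2, a3, a4, a5⟩ := hp
  refine ⟨u, v, p, rfl, he, a1, a2, a3, hs, fun w hw => ?_⟩
  by_cases hwu : w = u
  · subst hwu; exact Set.disjoint_left.1 a4 hw rfl
  by_cases hwv : w = v
  · subst hwv; exact Set.disjoint_left.1 a5 hw rfl
  obtain ⟨q, hq, hq'⟩ := hs (p.o_sub_s hw)
  rw [Phi_inj hq'] at hq
  exact T.arc_avoid u v he w hwu hwv hq

theorem core {V : Type} [Fintype V] (T : TopologicalGraph V) [Fintype T.G.edgeSet] {t : ℕ}
    (hq : T.QuasiPlanar t) {L j : ℕ} (hL : 3 * Fintype.card V ^ 2 < 2 ^ L) (hL1 : 1 ≤ L)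
    (hj : t ≤ 2 ^ j) (hn : 2 < Fintype.card V) :
    (T.G.edgeFinset.card : ℝ) * (1 / 2) ≤ (8 / cc L) ^ j * ((540 * (L : ℝ) ^ 2) ^ 2 *
      (Fintype.card V * Real.logb 2 (Fintype.card V))) := by
  classical
  let E : Type := {e // e ∈ T.G.edgeFinset}
  have hE : ∀ e : E, e.1 ∈ T.G.edgeSet := fun e => SimpleGraph.mem_edgeFinset.1 e.2
  have hcE : Fintype.card E = T.G.edgeFinset.card := Fintype.card_coe _
  choose u v p h1 hadj hl hf0 hfl hs hav using fun e : E => edge_pc T (hE e)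
  obtain ⟨γ, g1, g2⟩ := trim_all p hl
  have hcross : ∀ e e', Rel (fun i => (γ i).s) e e' → T.CrossesE e.1 e'.1 := by
    rintro e e' ⟨x, hx, hx'⟩
    have o1 := g1 _ hx
    have o2 := g1 _ hx'
    obtain ⟨q, hq, hqx⟩ := hs _ ((p e).o_sub_s o1)
    obtain ⟨q', hq', hqx'⟩ := hs _ ((p e').o_sub_s o2)
    have : q' = q := Phi_inj (hqx'.trans hqx.symm)
    subst this
    refine ⟨_, _, _, _, h1 e, h1 e', q', ⟨hq, hq'⟩, fun w _ _ hw => ?_⟩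
    subst hw
    rw [← hqx] at o1
    exact hav _ _ o1
  have hcl : ∀ K : Finset E, (∀ a ∈ K, ∀ b ∈ K, Rel (fun i => (γ i).s) a b) → K.card < 2 ^ j := by
    intro K hK
    refine lt_of_lt_of_le ?_ hj
    by_contra hc
    obtain ⟨K', hK', hc'⟩ := Finset.exists_subset_card_eq (not_lt.1 hc)
    refine hq ⟨K'.map ⟨Subtype.val, Subtype.val_injective⟩, ?_, by rw [Finset.card_map, hc'], ?_⟩
    · intro e he
      obtain ⟨e, _, rfl⟩ := Finset.mem_map.1 (Finset.mem_coe.1 he)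
      exact hE e
    · intro a ha b hb _
      obtain ⟨a, ha1, rfl⟩ := Finset.mem_map.1 (Finset.mem_coe.1 ha)
      obtain ⟨b, hb1, rfl⟩ := Finset.mem_map.1 (Finset.mem_coe.1 hb)
      exact hcross _ _ (hK a (hK' ha1) b (hK' hb1))
  have hinj : ∀ e e' : E, u e = u e' → v e = v e' → e = e' := fun e e' hu hv =>
    Subtype.ext (by rw [h1 e, h1 e', hu, hv])
  have hN : Fintype.card E ≤ Fintype.card V ^ 2 := by
    rw [sq, ← Fintype.card_prod]
    refine Fintype.card_le_of_injective (fun e : E => (u e, v e)) fun e e' h => ?_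
    exact hinj e e' (congrArg Prod.fst h) (congrArg Prod.snd h)
  have hL2 : 3 * Fintype.card E < 2 ^ L := lt_of_le_of_lt (by omega) hL
  obtain ⟨I, hI, hb⟩ := string_bound L j _ E γ rfl hL2 hcl
  have hLr : (0 : ℝ) < L := by exact_mod_cast hL1
  have hhalf : (T.G.edgeFinset.card : ℝ) * (1 / 2) ≤ (8 / cc L) ^ j * I.card := by
    rw [hcE] at hb hL2
    refine le_trans ?_ hb
    refine mul_le_mul_of_nonneg_left ?_ (Nat.cast_nonneg _)
    have : Real.logb 2 (T.G.edgeFinset.card : ℝ) ≤ L := by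
      rcases Nat.eq_zero_or_pos T.G.edgeFinset.card with h0 | h0
      · rw [h0]; simp
      · rw [Real.logb_le_iff_le_rpow (by norm_num) (by exact_mod_cast h0), Real.rpow_natCast]
        have : T.G.edgeFinset.card ≤ 2 ^ L := by omega
        exact_mod_cast this
    have : Real.logb 2 (T.G.edgeFinset.card : ℝ) / (2 * L) ≤ 1 / 2 := by
      rw [div_le_iff₀ (by positivity)]; linarith
    linarith
  -- the planar graph
  let H : SimpleGraph V := SimpleGraph.fromRel fun x y => ∃ e ∈ I, e.1 = s(x, y)
  have hH : ∀ x y, H.Adj x y → ∃ e ∈ I, e.1 = s(x, y) := by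
    intro x y h
    rcases (SimpleGraph.fromRel_adj _ _ _).1 h with ⟨_, ⟨e, he, h⟩ | ⟨e, he, h⟩⟩
    · exact ⟨e, he, h⟩
    · exact ⟨e, he, by rw [h, Sym2.eq_swap]⟩
  let A : V → V → Set ℂ := fun x y => {z | ∃ e ∈ I, e.1 = s(x, y) ∧ z ∈ (p e).s}
  have hav2 : ∀ e x y w, e.1 = s(x, y) → Phi (T.pos w) ∈ (p e).s → w = x ∨ w = y := by
    intro e x y w he hw
    have : w = u e ∨ w = v e := by
      by_contra hc
      push Not at hc
      obtain ⟨q, hq, hqx⟩ := hs _ hw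
      rw [Phi_inj hqx] at hq
      exact T.arc_avoid _ _ (hadj e) w hc.1 hc.2 hq
    have h2 : w ∈ e.1 := by rw [h1 e]; exact Sym2.mem_iff.2 this
    rw [he] at h2
    exact Sym2.mem_iff.1 h2
  have hends : ∀ e x y z, e.1 = s(x, y) → z ∈ (p e).s → z ∈ (p e).o ∨ z = Phi (T.pos x) ∨ z = Phi (T.pos y) := by
    intro e x y z he hz
    rw [h1 e] at he
    rcases (p e).s_cases hz with h | h | h
    · exact Or.inl h
    · rw [hf0] at h
      rcases Sym2.eq_iff.1 he with ⟨a, b⟩ | ⟨a, b⟩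
      · rw [a] at h; exact Or.inr (Or.inl h)
      · rw [a] at h; exact Or.inr (Or.inr h)
    · rw [hfl] at h
      rcases Sym2.eq_iff.1 he with ⟨a, b⟩ | ⟨a, b⟩
      · rw [b] at h; exact Or.inr (Or.inr h)
      · rw [b] at h; exact Or.inr (Or.inl h)
  have hPD : PD H (fun w => Phi (T.pos w)) A := by
    refine ⟨fun a b h => T.pos_inj (Phi_inj h), fun x y h => ?_, fun x y h w hx hy hw => ?_,
      fun x y x' y' h h' n1 n2 n3 n4 => ?_⟩
    · obtain ⟨e, heI, he⟩ := hH x y h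
      have hsub : (p e).s ⊆ A x y := fun z hz => ⟨e, heI, he, hz⟩
      have hJ : JoinedIn (p e).s (Phi (T.pos (u e))) (Phi (T.pos (v e))) := by
        rw [← hf0, ← hfl]
        exact (p e).s_pc.joinedIn _ (p e).f0_mem _ (p e).fl_mem
      have he' := he
      rw [h1 e] at he'
      rcases Sym2.eq_iff.1 he' with ⟨a, b⟩ | ⟨a, b⟩
      · rw [a, b] at hJ; exact hJ.mono hsub
      · rw [a, b] at hJ; exact hJ.symm.mono hsub
    · obtain ⟨e, _, he, hz⟩ := hw
      rcases hav2 e x y w he hz with h | h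
      · exact hx h
      · exact hy h
    · rw [Set.disjoint_left]
      rintro z ⟨e, heI, he, hz⟩ ⟨e', heI', he', hz'⟩
      have hne : e ≠ e' := by
        rintro rfl
        rw [he] at he'
        rcases Sym2.eq_iff.1 he' with ⟨a, b⟩ | ⟨a, b⟩
        · exact n1 a
        · exact n2 a
      rcases hends e x y z he hz with o1 | rfl | rfl
      · rcases hends e' x' y' z he' hz' with o2 | rfl | rfl
        · exact hI e heI e' heI' hne (g2 e e' ⟨z, o1, o2⟩)
        · rcases hav2 e x y _ he hz with h | h
          · exact n1 h.symm
          · exact n3 h.symm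
        · rcases hav2 e x y _ he hz with h | h
          · exact n2 h.symm
          · exact n4 h.symm
      · rcases hav2 e' x' y' _ he' hz' with h | h
        · exact n1 h
        · exact n2 h
      · rcases hav2 e' x' y' _ he' hz' with h | h
        · exact n3 h
        · exact n4 h
  have hn3 : 3 * Fintype.card V < 2 ^ L := lt_of_le_of_lt (by nlinarith) hL
  have hpl := planar_bound L _ V H _ A hPD rfl hn3
  have hIo : I.card ≤ oe H := by
    unfold oe cnt
    rw [← Finset.card_sigma]
    refine Finset.card_le_card_of_injOn (fun e => (⟨u e, v e⟩ : Σ _ : V, V)) ?_ ?_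
    · intro e he
      refine Finset.mem_coe.2 (Finset.mem_sigma.2 ⟨Finset.mem_univ _, mem_flt.2 ⟨Finset.mem_univ _, ?_⟩⟩)
      exact (SimpleGraph.fromRel_adj _ _ _).2 ⟨(hadj e).ne, Or.inl ⟨e, he, h1 e⟩⟩
    · intro e _ e' _ h
      simp only [Sigma.mk.injEq, heq_eq_eq] at h
      exact hinj e e' h.1 h.2
  refine hhalf.trans (mul_le_mul_of_nonneg_left ?_ ?_)
  · exact le_trans (by exact_mod_cast hIo) hpl
  · have := cc_pos hL1; positivity

theorem pow_cc : ∃ B : ℕ, ∀ L : ℕ, 2 ≤ L → 8 / cc L ≤ (L : ℝ) ^ B := by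
  refine ⟨3 + 16 + 6 * (2 + 12 * (2 + 12 * 26)), fun L hL => ?_⟩
  have h2 : (2 : ℝ) ≤ L := by exact_mod_cast hL
  have h0 : (0 : ℝ) < L := by linarith
  have k : ∀ m : ℕ, (2 : ℝ) ^ m ≤ (L : ℝ) ^ m := fun m => pow_le_pow_left₀ (by norm_num) h2 m
  have hz : 1 / (L : ℝ) ^ 26 ≤ zz L := by
    unfold zz
    refine one_div_le_one_div_of_le (by positivity) ?_
    calc 8 * (540 * (L : ℝ) ^ 2) ^ 2 = 2332800 * (L : ℝ) ^ 4 := by ring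
      _ ≤ (L : ℝ) ^ 22 * (L : ℝ) ^ 4 := by
        gcongr
        exact le_trans (by norm_num) (k 22)
      _ = _ := by rw [← pow_add]
  have step : ∀ (x : ℝ) (a m : ℕ), 1 / (L : ℝ) ^ a ≤ x → 1 / (L : ℝ) ^ (2 + m * a) ≤ x ^ m / 4 := by
    intro x a m h
    have : 1 / (L : ℝ) ^ (m * a) ≤ x ^ m := by
      have := pow_le_pow_left₀ (by positivity) h m
      rwa [one_div, inv_pow, ← pow_mul, mul_comm a m, ← one_div] at this
    calc 1 / (L : ℝ) ^ (2 + m * a) = (1 / (L : ℝ) ^ (m * a)) * (1 / (L : ℝ) ^ 2) := by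
          rw [pow_add]; field_simp
      _ ≤ x ^ m * (1 / 4) := by
          refine mul_le_mul this (one_div_le_one_div_of_le (by norm_num) ?_) (by positivity) ?_
          · exact le_trans (by norm_num) (k 2)
          · exact le_trans (by positivity) this
      _ = _ := by ring
  have h3 := step _ _ 12 (step _ _ 12 hz)
  have h4 := pow_le_pow_left₀ (by positivity) h3 6
  rw [one_div, inv_pow, ← pow_mul, ← one_div] at h4
  have h5 : 3600 * ((L : ℝ) + 5) ≤ (L : ℝ) ^ 16 := by
    calc 3600 * ((L : ℝ) + 5) ≤ 2 ^ 15 * L := by linarith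
      _ ≤ (L : ℝ) ^ 15 * L := by gcongr
      _ = _ := by ring
  have h6 := k 3
  rw [mul_comm] at h4
  have hpos : 0 < cc L := cc_pos (by omega)
  rw [div_le_iff₀ hpos]
  unfold cc
  set Y := (zz L ^ 12 / 4) ^ 12 / 4
  generalize 6 * (2 + 12 * (2 + 12 * 26)) = b at *
  have h7 : 1 ≤ (L : ℝ) ^ b * Y ^ 6 := by
    rw [div_le_iff₀ (by positivity)] at h4
    linarith
  have h8 : 1 ≤ (L : ℝ) ^ 16 / (3600 * (L + 5)) := by
    rw [one_le_div (by positivity)]; exact h5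
  calc (8 : ℝ) = 2 ^ 3 * 1 * 1 := by norm_num
    _ ≤ (L : ℝ) ^ 3 * ((L : ℝ) ^ 16 / (3600 * (L + 5))) * ((L : ℝ) ^ b * Y ^ 6) := by gcongr
    _ = _ := by rw [pow_add, pow_add]; ring

theorem main :
    ∃ c : ℝ, 0 < c ∧
      ∀ (t : ℕ), 2 ≤ t →
        ∀ (V : Type) [Fintype V] (T : TopologicalGraph V) [Fintype T.G.edgeSet],
          T.QuasiPlanar t → 2 < Fintype.card V →
          (T.G.edgeFinset.card : ℝ) ≤
            (Fintype.card V : ℝ) *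
              (Real.logb 2 (Fintype.card V)) ^ (c * Real.logb 2 t) := by
  obtain ⟨B, hB⟩ := pow_cc
  refine ⟨10 * (B + 26), by positivity, fun t ht V _ T _ hq hn => ?_⟩
  set n := Fintype.card V with hnd
  have hnr : (3 : ℝ) ≤ n := by exact_mod_cast hn
  have hn0 : (0 : ℝ) < n := by linarith
  set g := Real.logb 2 (n : ℝ) with hg
  have hg1 : 3 / 2 ≤ g := by
    rw [hg, Real.le_logb_iff_rpow_le (by norm_num) hn0]
    refine le_trans ?_ hnr
    have : ((2 : ℝ) ^ (3 / 2 : ℝ)) ^ 2 = 8 := by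
      rw [← Real.rpow_natCast, ← Real.rpow_mul (by norm_num)]; norm_num
    nlinarith [Real.rpow_pos_of_pos (show (0 : ℝ) < 2 by norm_num) (3 / 2 : ℝ)]
  have hgn : (2 : ℝ) ^ g = n := Real.rpow_logb (by norm_num) (by norm_num) hn0
  set L : ℕ := ⌊2 * g⌋₊ + 3 with hLd
  have hLlo : 2 * g + 2 ≤ (L : ℝ) := by
    have := Nat.lt_floor_add_one (2 * g)
    rw [hLd]; push_cast; linarith
  have hLhi : (L : ℝ) ≤ g ^ 5 := by
    have := Nat.floor_le (show 0 ≤ 2 * g by linarith)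
    have h1 : (L : ℝ) ≤ 4 * g := by rw [hLd]; push_cast; linarith
    have h2 : (3 / 2 : ℝ) ^ 4 ≤ g ^ 4 := pow_le_pow_left₀ (by norm_num) hg1 4
    calc (L : ℝ) ≤ 4 * g := h1
      _ ≤ g ^ 4 * g := by
        refine mul_le_mul_of_nonneg_right ?_ (by linarith)
        norm_num at h2; linarith
      _ = _ := by ring
  have hL2 : 2 ≤ L := by omega
  have hL2r : (2 : ℝ) ≤ L := by exact_mod_cast hL2
  have hL3 : 3 * n ^ 2 < 2 ^ L := by
    have : (3 * (n : ℝ) ^ 2) < 2 ^ L := by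
      calc 3 * (n : ℝ) ^ 2 < 4 * (n : ℝ) ^ 2 := by nlinarith
        _ = (2 : ℝ) ^ (2 * g + 2) := by
          rw [Real.rpow_add (by norm_num), two_mul, Real.rpow_add (by norm_num), hgn]
          norm_num; ring
        _ ≤ (2 : ℝ) ^ (L : ℝ) := Real.rpow_le_rpow_of_exponent_le (by norm_num) hLlo
        _ = _ := Real.rpow_natCast _ _
    exact_mod_cast this
  have htr : (2 : ℝ) ≤ t := by exact_mod_cast ht
  set k := Real.logb 2 (t : ℝ) with hk
  have hk1 : 1 ≤ k := by
    rw [hk, Real.le_logb_iff_rpow_le (by norm_num) (by linarith)]; simpa using htr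
  set j : ℕ := ⌈k⌉₊ with hjd
  have hjk : k ≤ j := Nat.le_ceil _
  have hjk2 : (j : ℝ) ≤ 2 * k := by
    have := Nat.ceil_lt_add_one (show 0 ≤ k by linarith)
    linarith
  have hj1 : 1 ≤ j := by
    have : (1 : ℝ) ≤ j := by linarith
    exact_mod_cast this
  have htj : t ≤ 2 ^ j := by
    have : (t : ℝ) ≤ 2 ^ j := by
      rw [← Real.rpow_natCast, ← Real.logb_le_iff_le_rpow (by norm_num) (by linarith)]
      exact hjk
    exact_mod_cast this
  have hc := core T hq hL3 (by omega) htj hn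
  rw [← hnd, ← hg] at hc
  have hcc := hB L hL2
  have hccp : 0 < cc L := cc_pos (by omega)
  have e1 : (540 * (L : ℝ) ^ 2) ^ 2 ≤ (L : ℝ) ^ 24 := by
    calc (540 * (L : ℝ) ^ 2) ^ 2 ≤ (2 ^ 10 * (L : ℝ) ^ 2) ^ 2 := by gcongr; norm_num
      _ ≤ ((L : ℝ) ^ 10 * (L : ℝ) ^ 2) ^ 2 := by gcongr
      _ = _ := by ring
  have e2 : (8 / cc L) ^ j ≤ (L : ℝ) ^ (B * j) := by
    rw [pow_mul]; exact pow_le_pow_left₀ (by positivity) hcc j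
  have hgL : g ≤ L := by linarith
  have hg0 : 0 ≤ g := by linarith
  have e3 : (T.G.edgeFinset.card : ℝ) ≤ n * (L : ℝ) ^ (B * j + 26) := by
    calc (T.G.edgeFinset.card : ℝ) = 2 * ((T.G.edgeFinset.card : ℝ) * (1 / 2)) := by ring
      _ ≤ 2 * ((8 / cc L) ^ j * ((540 * (L : ℝ) ^ 2) ^ 2 * (n * g))) := by gcongr
      _ ≤ L * ((L : ℝ) ^ (B * j) * ((L : ℝ) ^ 24 * (n * L))) := by gcongr
      _ = _ := by rw [pow_add]; ring
  refine e3.trans (mul_le_mul_of_nonneg_left ?_ hn0.le)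
  have e4 : B * j + 26 ≤ (B + 26) * j := by nlinarith
  calc (L : ℝ) ^ (B * j + 26) ≤ (L : ℝ) ^ ((B + 26) * j) := pow_le_pow_right₀ (by linarith) e4
    _ ≤ (g ^ 5) ^ ((B + 26) * j) := pow_le_pow_left₀ (by linarith) hLhi _
    _ = g ^ ((5 * ((B + 26) * j) : ℕ) : ℝ) := by rw [Real.rpow_natCast, pow_mul g 5]
    _ ≤ _ := by
      refine Real.rpow_le_rpow_of_exponent_le (by linarith) ?_
      push_cast
      have : (0 : ℝ) ≤ B + 26 := by positivity
      nlinarith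

end QP

/-- There is an absolute constant `c > 0` such that for every integer `t ≥ 2`, every
`t`-quasi-planar topological graph on `n > 2` vertices has at most
`n·(log₂ n)^(c·log₂ t)` edges. -/
theorem quasi_planar_edge_bound :
    ∃ c : ℝ, 0 < c ∧
      ∀ (t : ℕ), 2 ≤ t →
        ∀ (V : Type) [Fintype V] (T : TopologicalGraph V) [DecidableRel T.G.Adj],
          T.QuasiPlanar t → 2 < Fintype.card V →
          (T.G.edgeFinset.card : ℝ) ≤
            (Fintype.card V : ℝ) *
              (Real.logb 2 (Fintype.card V)) ^ (c * Real.logb 2 t) := by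
  obtain ⟨c, hc, h⟩ := QP.main
  exact ⟨c, hc, fun t ht V _ T _ hq hn => h t ht V T hq hn⟩
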